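/- Let β ∈ ℂ and let A, B be invertible N×N complex matrices. Then ∫_{SU(N)} exp(β Tr(UA + U†B)) dμ(U) = Σ_{λ : ℓ(λ)≤N} β^{2|λ|} s_λ(p_∞)² s_λ(AB)/s_λ(I_N) + Σ_{q≥1} Σ_{λ : ℓ(λ)≤N} β^{2|λ|+qN} s_λ(p_∞) s_{λ+q^N}(p_∞) · (s_{λ+q^N}(AB)/s_{λ+q^N}(I_N)) · ((det A)^{−q} + (det B)^{−q}), where all sums converge absolutely. -/

import Mathlib

open scoped BigOperators Classical
open MeasureTheory Matrix

noncomputable section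

/-- Complete homogeneous symmetric functions of the eigenvalues of `X`, defined through
Newton's identities from the power sums `p_m = Tr(X^m)`. -/
def hMat {N : ℕ} (X : Matrix (Fin N) (Fin N) ℂ) : ℕ → ℂ
  | 0 => 1
  | (k+1) => ((k : ℂ) + 1)⁻¹ *
      ∑ m ∈ Finset.range (k+1), (X ^ (m+1)).trace * hMat X (k - m)
  termination_by k => k
  decreasing_by exact Nat.lt_succ_of_le (Nat.sub_le _ _)

def hMatZ {N : ℕ} (X : Matrix (Fin N) (Fin N) ℂ) (k : ℤ) : ℂ :=
  if k < 0 then 0 else hMat X k.toNat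

/-- The Schur polynomial `s_λ(X)` of an `N×N` complex matrix `X`, evaluated at the
eigenvalues of `X`, via the Jacobi-Trudi formula `s_λ = det(h_{λ_i - i + j})`.
Here `l : Fin N → ℕ` lists the (at most `N`) parts of the partition `λ`. -/
def schur {N : ℕ} (l : Fin N → ℕ) (X : Matrix (Fin N) (Fin N) ℂ) : ℂ :=
  (Matrix.of fun i j : Fin N => hMatZ X ((l i : ℤ) - (i : ℤ) + (j : ℤ))).det

/-- Partitions with at most `N` parts (weakly decreasing functions `Fin N → ℕ`). -/
def PartitionN (N : ℕ) := {l : Fin N → ℕ // Antitone l}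

/-- `1/k!` for `k : ℤ`, zero for negative `k`. -/
def factInvZ (k : ℤ) : ℂ := if k < 0 then 0 else ((Nat.factorial k.toNat : ℂ))⁻¹

/-- The specialization `s_λ(p_∞) = dim λ / |λ|!` of the Schur function at the power sums
`p_1 = 1`, `p_k = 0` for `k ≥ 2`, via Jacobi-Trudi (`h_k(p_∞) = 1/k!`). -/
def schurPInf {N : ℕ} (l : Fin N → ℕ) : ℂ :=
  (Matrix.of fun i j : Fin N => factInvZ ((l i : ℤ) - (i : ℤ) + (j : ℤ))).det

/-- The weight `|λ| = Σ λ_i` of a partition. -/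
def wt {N : ℕ} (l : Fin N → ℕ) : ℕ := ∑ i, l i

/-- The unitary group `U(N)`. -/
abbrev UN (N : ℕ) := Matrix.unitaryGroup (Fin N) ℂ

instance (N : ℕ) : MeasurableSpace (UN N) := borel _

/-- The special unitary group `SU(N)`, as a subgroup of `U(N)`. -/
def SUN (N : ℕ) : Subgroup (UN N) where
  carrier := {U | (U : Matrix (Fin N) (Fin N) ℂ).det = 1}
  one_mem' := by simp
  mul_mem' := by
    intro a b ha hb
    simp only [Set.mem_setOf_eq, Submonoid.coe_mul, Matrix.det_mul] at *
    rw [ha, hb, mul_one]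
  inv_mem' := by
    intro a ha
    simp only [Set.mem_setOf_eq] at *
    have h1 : ((a⁻¹ : UN N) : Matrix (Fin N) (Fin N) ℂ)
        = star (a : Matrix (Fin N) (Fin N) ℂ) := rfl
    have h2 : (star (a : Matrix (Fin N) (Fin N) ℂ)).det
        = star ((a : Matrix (Fin N) (Fin N) ℂ)).det := by
      simp [Matrix.star_eq_conjTranspose, Matrix.det_conjTranspose]
    rw [h1, h2, ha, star_one]

instance (N : ℕ) : MeasurableSpace (SUN N) := borel _

/-- Power sums of the eigenvalues of a matrix. -/
def psumMat {K : Type*} [CommRing K] {N : ℕ} (X : Matrix (Fin N) (Fin N) K) (m : ℕ) : K :=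
  (X ^ (m + 1)).trace

theorem map_psumMat {K K' : Type*} [CommRing K] [CommRing K'] (f : K →+* K') {N : ℕ}
    (X : Matrix (Fin N) (Fin N) K) (m : ℕ) : f (psumMat X m) = psumMat (X.map f) m := by
  rw [psumMat, psumMat, ← RingHom.mapMatrix_apply, ← map_pow]
  exact AddMonoidHom.map_trace f.toAddMonoidHom _

section Sequences

variable {K : Type*} [CommRing K] [Algebra ℂ K]

/-- Complete homogeneous functions built from power sums; `p m` is the power sum of degree
`m + 1`. -/
def hseq (p : ℕ → K) : ℕ → K
  | 0 => 1
  | (k+1) => ((k : ℂ) + 1)⁻¹ • ∑ m ∈ Finset.range (k+1), p m * hseq p (k - m)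
  termination_by k => k
  decreasing_by exact Nat.lt_succ_of_le (Nat.sub_le _ _)

def hseqZ (p : ℕ → K) (k : ℤ) : K := if k < 0 then 0 else hseq p k.toNat

/-- The Jacobi-Trudi determinant in the power sums `p`. -/
def jacobiTrudi {N : ℕ} (p : ℕ → K) (l : Fin N → ℕ) : K :=
  (Matrix.of fun i j : Fin N => hseqZ p ((l i : ℤ) - (i : ℤ) + (j : ℤ))).det

theorem hseq_zero (p : ℕ → K) : hseq p 0 = 1 := by rw [hseq]

theorem hseq_succ (p : ℕ → K) (k : ℕ) :
    ((k : ℂ) + 1) • hseq p (k + 1) = ∑ m ∈ Finset.range (k+1), p m * hseq p (k - m) := by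
  rw [hseq, smul_smul, mul_inv_cancel₀ (Nat.cast_add_one_ne_zero k), one_smul]

theorem hseqZ_natCast (p : ℕ → K) (k : ℕ) : hseqZ p (k : ℤ) = hseq p k := by
  simp [hseqZ]

theorem hseqZ_neg (p : ℕ → K) {k : ℤ} (hk : k < 0) : hseqZ p k = 0 := by
  simp [hseqZ, hk]

theorem map_hseq {K' : Type*} [CommRing K'] [Algebra ℂ K'] (f : K →ₐ[ℂ] K') (p : ℕ → K) (k : ℕ) :
    f (hseq p k) = hseq (fun m => f (p m)) k := by
  induction k using Nat.strong_induction_on with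
  | _ k ih =>
    cases k with
    | zero => simp [hseq_zero]
    | succ k =>
      rw [hseq, hseq, map_smul, map_sum]
      congr 1
      refine Finset.sum_congr rfl fun m _ => ?_
      rw [map_mul, ih (k - m) (by omega)]

theorem map_hseqZ {K' : Type*} [CommRing K'] [Algebra ℂ K'] (f : K →ₐ[ℂ] K') (p : ℕ → K) (k : ℤ) :
    f (hseqZ p k) = hseqZ (fun m => f (p m)) k := by
  unfold hseqZ
  split_ifs
  · simp
  · exact map_hseq f p _

theorem map_jacobiTrudi {K' : Type*} [CommRing K'] [Algebra ℂ K'] (f : K →ₐ[ℂ] K') {N : ℕ}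
    (p : ℕ → K) (l : Fin N → ℕ) :
    f (jacobiTrudi p l) = jacobiTrudi (fun m => f (p m)) l := by
  unfold jacobiTrudi
  rw [AlgHom.map_det]
  congr 1
  ext i j
  simp [map_hseqZ]

theorem hMat_eq_hseq {N : ℕ} (X : Matrix (Fin N) (Fin N) ℂ) (k : ℕ) :
    hMat X k = hseq (psumMat X) k := by
  induction k using Nat.strong_induction_on with
  | _ k ih =>
    cases k with
    | zero => rw [hMat, hseq]
    | succ k =>
      rw [hMat, hseq, smul_eq_mul]
      congr 1
      refine Finset.sum_congr rfl fun m _ => ?_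
      rw [ih (k - m) (by omega), psumMat]

theorem schur_eq_jacobiTrudi {N : ℕ} (l : Fin N → ℕ) (X : Matrix (Fin N) (Fin N) ℂ) :
    schur l X = jacobiTrudi (psumMat X) l := by
  unfold schur jacobiTrudi hMatZ hseqZ
  simp_rw [hMat_eq_hseq]

/-- The power sums `p_1 = 1`, `p_k = 0` for `k ≥ 2`. -/
def pInf (m : ℕ) : ℂ := if m = 0 then 1 else 0

theorem hseq_pInf (k : ℕ) : hseq pInf k = ((k.factorial : ℂ))⁻¹ := by
  induction k with
  | zero => simp [hseq_zero]
  | succ k ih =>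
    rw [hseq, Finset.sum_eq_single 0]
    · simp [pInf, ih, Nat.factorial_succ, mul_comm]
    · intro b _ hb
      simp [pInf, hb]
    · simp

theorem schurPInf_eq_jacobiTrudi {N : ℕ} (l : Fin N → ℕ) :
    schurPInf l = jacobiTrudi pInf l := by
  unfold schurPInf jacobiTrudi factInvZ hseqZ
  simp_rw [hseq_pInf]

theorem jacobiTrudi_zero {N : ℕ} (p : ℕ → K) : jacobiTrudi p (fun _ : Fin N => 0) = 1 := by
  unfold jacobiTrudi
  rw [Matrix.det_of_isUpperTriangular]
  · refine Finset.prod_eq_one fun i _ => ?_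
    simpa [hseq_zero] using hseqZ_natCast p 0
  · intro i j hij
    exact hseqZ_neg p (by simp only [id] at hij; simp; omega)

end Sequences

theorem Derivation.leibniz_finset_prod {R K ι : Type*} [DecidableEq ι] [CommRing R] [CommRing K]
    [Algebra R K]
    (D : Derivation R K K) (s : Finset ι) (f : ι → K) :
    D (∏ i ∈ s, f i) = ∑ i ∈ s, (∏ j ∈ s.erase i, f j) * D (f i) := by
  induction s using Finset.induction_on with
  | empty => simp
  | insert a s ha ih =>
    rw [Finset.prod_insert ha, D.leibniz, ih, Finset.sum_insert ha, Finset.erase_insert ha,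
      smul_eq_mul, smul_eq_mul, add_comm, Finset.mul_sum]
    congr 1
    refine Finset.sum_congr rfl fun i hi => ?_
    rw [Finset.erase_insert_of_ne (by rintro rfl; exact ha hi), Finset.prod_insert (by simp [ha]),
      mul_assoc]

/-- Leibniz rule for determinants. -/
theorem Derivation.map_matrix_det {R K : Type*} [CommRing R] [CommRing K]
    [Algebra R K]
    (D : Derivation R K K) {n : Type*} [Fintype n] [DecidableEq n] (M : Matrix n n K) :
    D M.det = ∑ i, (M.updateRow i fun j => D (M i j)).det := by
  simp_rw [Matrix.det_apply]
  rw [map_sum, Finset.sum_comm]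
  refine Finset.sum_congr rfl fun σ _ => ?_
  rw [← Finset.smul_sum, Units.smul_def, map_zsmul, ← Units.smul_def]
  congr 1
  rw [Derivation.leibniz_finset_prod]
  conv_rhs => rw [← Equiv.sum_comp σ]
  refine Finset.sum_congr rfl fun i _ => ?_
  rw [← Finset.mul_prod_erase _ _ (Finset.mem_univ i), mul_comm]
  congr 1
  · simp
  · refine Finset.prod_congr (by ext; simp) fun j hj => ?_
    rw [Matrix.updateRow_ne]
    simpa using Finset.ne_of_mem_erase hj

theorem Matrix.det_updateRow_eq_sum_adjugate {K : Type*} [CommRing K] 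
    {n : Type*} [Fintype n] [DecidableEq n] (M : Matrix n n K) (i : n) (v : n → K) :
    (M.updateRow i v).det = ∑ j, v j * M.adjugate j i := by
  rw [← Matrix.cramer_transpose_apply, Matrix.cramer_eq_adjugate_mulVec,
    ← Matrix.adjugate_transpose, Matrix.mulVec, dotProduct]
  exact Finset.sum_congr rfl fun j _ => mul_comm _ _

/-- Infinitesimal form of `det (M * T) = det M * det T`. -/
theorem Matrix.sum_det_updateRow_mul {K : Type*} [CommRing K] 
    {n : Type*} [Fintype n] [DecidableEq n] (M T : Matrix n n K) :
    ∑ i, (M.updateRow i ((M * T) i)).det = T.trace * M.det := by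
  simp_rw [Matrix.det_updateRow_eq_sum_adjugate]
  have : ∑ i, ∑ j, (M * T) i j * M.adjugate j i = ((M * T) * M.adjugate).trace := rfl
  rw [this, Matrix.trace_mul_comm, ← Matrix.mul_assoc, Matrix.adjugate_mul, Matrix.smul_mul,
    Matrix.one_mul, Matrix.trace_smul, smul_eq_mul, mul_comm]

theorem Matrix.sum_det_updateRow_scale {K : Type*} [CommRing K] 
    {n : Type*} [Fintype n] [DecidableEq n] (M : Matrix n n K) (r c : n → K) :
    ∑ i, (M.updateRow i fun j => (r i + c j) * M i j).det
      = (∑ i, r i + ∑ j, c j) * M.det := by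
  have h1 : ∀ i, (M.updateRow i fun j => (r i + c j) * M i j).det
      = r i * M.det + (M.updateRow i ((M * Matrix.diagonal c) i)).det := by
    intro i
    have : (fun j => (r i + c j) * M i j) = r i • M i + (M * Matrix.diagonal c) i := by
      ext j; simp [Matrix.mul_diagonal]; ring
    rw [this, Matrix.det_updateRow_add, Matrix.det_updateRow_smul]
    simp
  simp_rw [h1]
  rw [Finset.sum_add_distrib, Matrix.sum_det_updateRow_mul, Matrix.trace_diagonal,
    ← Finset.sum_mul, add_mul]

section CharpolyRev

variable {K : Type*} [CommRing K] {N : ℕ}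

open Polynomial in
theorem charpolyRev_coeff_zero (X : Matrix (Fin N) (Fin N) K) : X.charpolyRev.coeff 0 = 1 := by
  simp [Polynomial.coeff_zero_eq_eval_zero]

theorem coeff_charpolyRev [Nontrivial K] (X : Matrix (Fin N) (Fin N) K) (a : ℕ) (ha : a ≤ N) :
    X.charpolyRev.coeff a = X.charpoly.coeff (N - a) := by
  rw [← Matrix.reverse_charpoly, Polynomial.coeff_reverse, Matrix.charpoly_natDegree_eq_dim,
    Fintype.card_fin, Polynomial.revAt_le ha]

theorem coeff_charpolyRev_of_lt [Nontrivial K] (X : Matrix (Fin N) (Fin N) K) (a : ℕ) (ha : N < a) :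
    X.charpolyRev.coeff a = 0 := by
  apply Polynomial.coeff_eq_zero_of_natDegree_lt
  rw [← Matrix.reverse_charpoly]
  refine (Polynomial.reverse_natDegree_le _).trans_lt ?_
  rwa [Matrix.charpoly_natDegree_eq_dim, Fintype.card_fin]

open Polynomial in
/-- Newton's identities for the coefficients of `det (1 - t X)`. -/
theorem newton_charpolyRev (X : Matrix (Fin N) (Fin N) K) (k : ℕ) :
    X.charpolyRev.coeff (k + 1) * (k + 1) =
      - ∑ m ∈ Finset.range (k + 1), psumMat X m * X.charpolyRev.coeff (k - m) := by
  set Z : Matrix (Fin N) (Fin N) K[X] := 1 - (Polynomial.X : K[X]) • X.map C with hZ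
  have hdet : Z.det = X.charpolyRev := rfl
  -- the geometric series of `t X`
  let G : Matrix (Fin N) (Fin N) (PowerSeries K) :=
    Matrix.of fun i j => PowerSeries.mk fun k => (X ^ k) i j
  let φ : K[X] →+* PowerSeries K := Polynomial.coeToPowerSeries.ringHom
  have hG : (φ.mapMatrix Z) * G = 1 := by
    have hZ' : φ.mapMatrix Z = 1 - (PowerSeries.X : PowerSeries K) •
        X.map (PowerSeries.C) := by
      rw [hZ, map_sub, map_one]
      congr 1
      ext1 i j
      simp [φ, mul_comm (PowerSeries.C _)]
    rw [hZ', sub_mul, one_mul, Matrix.smul_mul]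
    ext i j k
    have e1 : ((X.map (PowerSeries.C)) * G) i j = PowerSeries.mk fun k => (X ^ (k+1)) i j := by
      ext k
      rw [Matrix.mul_apply, map_sum, PowerSeries.coeff_mk, pow_succ', Matrix.mul_apply]
      simp [G]
    rw [Matrix.sub_apply, Matrix.smul_apply, e1, smul_eq_mul, map_sub]
    cases k with
    | zero => 
      by_cases hij : i = j <;> simp [G, hij, Matrix.one_apply]
    | succ k =>
      rw [PowerSeries.coeff_succ_X_mul]
      by_cases hij : i = j <;> simp [G, hij, Matrix.one_apply, PowerSeries.coeff_one]
  have hadj : φ.mapMatrix Z.adjugate = (φ X.charpolyRev) • G := by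
    calc φ.mapMatrix Z.adjugate = φ.mapMatrix Z.adjugate * ((φ.mapMatrix Z) * G) := by
          rw [hG, mul_one]
      _ = φ.mapMatrix (Z.adjugate * Z) * G := by rw [← mul_assoc, map_mul]
      _ = _ := by
          rw [Matrix.adjugate_mul, hdet]
          have : φ.mapMatrix (X.charpolyRev • (1 : Matrix (Fin N) (Fin N) K[X]))
            = (φ X.charpolyRev) • 1 := by
            ext1 i j
            by_cases hij : i = j <;> simp [hij]
          rw [this, Matrix.smul_mul, one_mul]
  have hderiv : derivative X.charpolyRev = - ∑ i, ∑ j, C (X i j) * Z.adjugate j i := by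
    have h := Derivation.map_matrix_det (Polynomial.derivative' (R := K)) Z
    simp_rw [Matrix.det_updateRow_eq_sum_adjugate] at h
    rw [hdet] at h
    change derivative X.charpolyRev = _ at h
    rw [h, ← Finset.sum_neg_distrib]
    refine Finset.sum_congr rfl fun i _ => ?_
    rw [← Finset.sum_neg_distrib]
    refine Finset.sum_congr rfl fun j _ => ?_
    have : derivative' (R := K) (Z i j) = - C (X i j) := by
      by_cases hij : i = j <;> simp [hZ, hij, derivative']
    rw [this, neg_mul]
  have hderiv2 := congrArg φ hderiv
  rw [map_neg, map_sum] at hderiv2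
  have hAG : ∀ i j, φ (Z.adjugate j i) = φ X.charpolyRev * G j i := fun i j =>
    congrFun (congrFun hadj j) i
  have h3 : φ (derivative X.charpolyRev) =
      - (φ X.charpolyRev * PowerSeries.mk (psumMat X)) := by
    rw [hderiv2]
    congr 1
    calc _ = ∑ i, ∑ j, φ X.charpolyRev * (PowerSeries.C (X i j) * G j i) := by
          refine Finset.sum_congr rfl fun i _ => ?_
          rw [map_sum]
          refine Finset.sum_congr rfl fun j _ => ?_
          rw [map_mul, hAG]
          have : φ (C (X i j)) = PowerSeries.C (X i j) := by simp [φ]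
          rw [this]; ring
      _ = _ := by
          simp_rw [← Finset.mul_sum]
          congr 1
          ext k
          rw [PowerSeries.coeff_mk, psumMat, pow_succ', Matrix.trace]
          simp [G, Matrix.mul_apply]
  have h4 := congrArg (PowerSeries.coeff k) h3
  have h5 : PowerSeries.coeff k (φ (derivative X.charpolyRev)) =
      X.charpolyRev.coeff (k+1) * (k+1) := by
    simp [φ, Polynomial.coeff_derivative]
  rw [h5] at h4
  rw [h4, map_neg, mul_comm (φ _), PowerSeries.coeff_mul,
    Finset.Nat.sum_antidiagonal_eq_sum_range_succ_mk]
  simp [φ]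

/-- Matrices with the same characteristic polynomial have the same power sums. -/
theorem psumMat_congr {n : ℕ} {X : Matrix (Fin N) (Fin N) K}
    {Y : Matrix (Fin n) (Fin n) K} (h : X.charpolyRev = Y.charpolyRev) : 
    psumMat X = psumMat Y := by
  ext k
  induction k using Nat.strong_induction_on with
  | _ k ih =>
    have h1 := newton_charpolyRev X k
    have h2 := newton_charpolyRev Y k
    rw [Finset.sum_range_succ, Nat.sub_self, charpolyRev_coeff_zero, mul_one] at h1 h2
    have h3 : ∑ m ∈ Finset.range k, psumMat X m * X.charpolyRev.coeff (k - m) =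
        ∑ m ∈ Finset.range k, psumMat Y m * Y.charpolyRev.coeff (k - m) :=
      Finset.sum_congr rfl fun m hm => by rw [ih m (Finset.mem_range.1 hm), h]
    rw [h3, h, h2] at h1
    linear_combination h1

end CharpolyRev

section Recurrence

variable {K : Type*} [CommRing K] [Algebra ℂ K] {N : ℕ}

theorem sum_charpolyRev_mul_hseq (X : Matrix (Fin N) (Fin N) K) (k : ℕ) :
    ∑ a ∈ Finset.range (k + 2), X.charpolyRev.coeff a * hseq (psumMat X) (k + 1 - a) = 0 := by
  set E : PowerSeries K := PowerSeries.mk fun k => X.charpolyRev.coeff k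
  set H : PowerSeries K := PowerSeries.mk fun k => hseq (psumMat X) k
  set P : PowerSeries K := PowerSeries.mk fun k => psumMat X k
  have hE : PowerSeries.derivative K E = - (P * E) := by
    ext k
    rw [PowerSeries.coeff_derivative, map_neg, PowerSeries.coeff_mul,
      Finset.Nat.sum_antidiagonal_eq_sum_range_succ_mk]
    simp only [E, P, PowerSeries.coeff_mk]
    exact newton_charpolyRev X k
  have hH : PowerSeries.derivative K H = P * H := by
    ext k
    rw [PowerSeries.coeff_derivative, PowerSeries.coeff_mul,
      Finset.Nat.sum_antidiagonal_eq_sum_range_succ_mk]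
    simp only [H, P, PowerSeries.coeff_mk]
    rw [← hseq_succ, Algebra.smul_def, mul_comm]
    simp
  have hEH : PowerSeries.derivative K (E * H) = 0 := by
    rw [Derivation.leibniz, hE, hH, smul_eq_mul, smul_eq_mul]
    ring
  have h := congrArg (PowerSeries.coeff k) hEH
  rw [PowerSeries.coeff_derivative, map_zero, PowerSeries.coeff_mul,
    Finset.Nat.sum_antidiagonal_eq_sum_range_succ_mk] at h
  simp only [E, H, PowerSeries.coeff_mk] at h
  have h2 : ((k : ℂ) + 1) • ∑ a ∈ Finset.range (k + 2),
      X.charpolyRev.coeff a * hseq (psumMat X) (k + 1 - a) = 0 := by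
    rw [Algebra.smul_def, mul_comm]
    simpa using h
  have h3 := congrArg (fun z => ((k : ℂ) + 1)⁻¹ • z) h2
  simpa only [smul_smul, inv_mul_cancel₀ (Nat.cast_add_one_ne_zero (R := ℂ) k), one_smul,
    smul_zero] using h3

theorem sum_charpolyRev_mul_hseqZ [Nontrivial K] (X : Matrix (Fin N) (Fin N) K) (k : ℤ)
    (hk : 1 ≤ k) :
    ∑ a ∈ Finset.range (N + 1), X.charpolyRev.coeff a * hseqZ (psumMat X) (k - a) = 0 := by
  obtain ⟨k, rfl⟩ : ∃ n : ℕ, k = n + 1 := ⟨(k - 1).toNat, by omega⟩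
  rw [← sum_charpolyRev_mul_hseq X k]
  have h1 : ∑ a ∈ Finset.range (k + 2), X.charpolyRev.coeff a * hseq (psumMat X) (k + 1 - a) =
      ∑ a ∈ Finset.range (k + 2), X.charpolyRev.coeff a * hseqZ (psumMat X) ((k : ℤ) + 1 - a) := by
    refine Finset.sum_congr rfl fun a ha => ?_
    rw [← hseqZ_natCast, Nat.cast_sub (by have := Finset.mem_range.1 ha; omega)]
    simp
  rw [h1]
  rcases le_total N (k + 1) with h | h
  · refine Finset.sum_subset (Finset.range_mono (by omega)) fun a _ ha => ?_
    rw [coeff_charpolyRev_of_lt X a (by simpa using ha), zero_mul]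
  · refine (Finset.sum_subset (Finset.range_mono (by omega)) fun a _ ha => ?_).symm
    rw [hseqZ_neg _ (by have := Finset.mem_range.not.1 ha; omega), mul_zero]

/-- The `l`-th row from which the Jacobi-Trudi matrices are built. -/
def hrow (p : ℕ → K) (l : ℕ) (j : Fin N) : K := hseqZ p ((l : ℤ) - ((N : ℤ) - 1) + j)

/-- The shifted parts `λ_i + N - 1 - i` of a partition. -/
def shiftedPart (l : Fin N → ℕ) (i : Fin N) : ℕ := l i + (N - 1 - i)

theorem jacobiTrudi_eq_det_hrow (p : ℕ → K) (l : Fin N → ℕ) :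
    jacobiTrudi p l = (Matrix.of fun i => hrow p (shiftedPart l i)).det := by
  unfold jacobiTrudi
  congr 1
  ext i j
  simp only [Matrix.of_apply, hrow, shiftedPart]
  congr 1
  have := i.2
  omega

/-- Linear recurrences whose coefficients are those of `det (1 - t X)`. -/
def IsCharRec {V : Type*} [AddCommGroup V] [Module K V] (X : Matrix (Fin N) (Fin N) K)
    (w : ℕ → V) : Prop :=
  ∀ l, ∑ a ∈ Finset.range (N + 1), X.charpolyRev.coeff a • w (l + N - a) = 0

theorem isCharRec_hrow [Nontrivial K] (X : Matrix (Fin N) (Fin N) K) :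
    IsCharRec X (hrow (N := N) (psumMat X)) := by
  intro l
  ext j
  simp only [Finset.sum_apply, Pi.smul_apply, smul_eq_mul, Pi.zero_apply]
  rw [← sum_charpolyRev_mul_hseqZ X (l + 1 + j) (by omega)]
  refine Finset.sum_congr rfl fun a ha => ?_
  have := Finset.mem_range.1 ha
  rw [hrow]
  congr 2
  omega

theorem IsCharRec.ext {V : Type*} [AddCommGroup V] [Module K V] {X : Matrix (Fin N) (Fin N) K}
    {w w' : ℕ → V} (h : IsCharRec X w) (h' : IsCharRec X w') (h0 : ∀ l < N, w l = w' l) :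
    w = w' := by
  ext l
  induction l using Nat.strong_induction_on with
  | _ l ih =>
    rcases lt_or_ge l N with hl | hl
    · exact h0 l hl
    · have h1 := h (l - N)
      have h2 := h' (l - N)
      rw [Finset.sum_range_succ', charpolyRev_coeff_zero, one_smul,
        show l - N + N - 0 = l by omega] at h1 h2
      have h3 : ∑ k ∈ Finset.range N, X.charpolyRev.coeff (k + 1) • w (l - N + N - (k + 1)) =
          ∑ k ∈ Finset.range N, X.charpolyRev.coeff (k + 1) • w' (l - N + N - (k + 1)) :=
        Finset.sum_congr rfl fun k hk => by
          have := Finset.mem_range.1 hk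
          rw [ih _ (by omega)]
      rw [h3] at h1
      exact add_left_cancel (h1.trans h2.symm)

/-- Vector orbits of `X` satisfy the recurrence, by Cayley-Hamilton. -/
theorem isCharRec_of_vecMul [Nontrivial K] (X : Matrix (Fin N) (Fin N) K) (w : ℕ → Fin N → K)
    (hw : ∀ l, w (l + 1) = w l ᵥ* X) : IsCharRec X w := by
  have hpow : ∀ k l, w (l + k) = w l ᵥ* X ^ k := by
    intro k l
    induction k with
    | zero => simp
    | succ k ih => rw [← add_assoc, hw, ih, Matrix.vecMul_vecMul, pow_succ]
  intro l
  have hCH := Matrix.aeval_self_charpoly X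
  rw [Polynomial.aeval_eq_sum_range, Matrix.charpoly_natDegree_eq_dim, Fintype.card_fin] at hCH
  have h1 : ∑ a ∈ Finset.range (N + 1), X.charpolyRev.coeff a • w (l + N - a) =
      w l ᵥ* ∑ i ∈ Finset.range (N + 1), X.charpoly.coeff i • X ^ i := by
    rw [← Finset.sum_range_reflect, Matrix.vecMul_sum]
    refine Finset.sum_congr rfl fun a ha => ?_
    have := Finset.mem_range.1 ha
    rw [coeff_charpolyRev X _ (by omega), Matrix.vecMul_smul, ← hpow]
    congr 2 <;> omega
  rw [h1, hCH, Matrix.vecMul_zero]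

/-- Determinants built from a solution of the recurrence are proportional to Jacobi-Trudi
determinants. -/
theorem IsCharRec.det_eq [Nontrivial K] {X : Matrix (Fin N) (Fin N) K} {w : ℕ → Fin N → K}
    (hw : IsCharRec X w) (l : Fin N → ℕ) :
    (Matrix.of fun i => w (shiftedPart l i)).det =
      jacobiTrudi (psumMat X) l * (Matrix.of fun i : Fin N => w (N - 1 - i)).det := by
  set R0 : Matrix (Fin N) (Fin N) K := Matrix.of fun i => hrow (psumMat X) (N - 1 - i) with hR0
  set W0 : Matrix (Fin N) (Fin N) K := Matrix.of fun i => w (N - 1 - i) with hW0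
  have hdet : R0.det = 1 := by
    have := jacobiTrudi_eq_det_hrow (psumMat X) (fun _ : Fin N => 0)
    rw [jacobiTrudi_zero] at this
    rw [this]
    simp [hR0, shiftedPart]
  have hu : IsUnit R0.det := by rw [hdet]; exact isUnit_one
  have hwr : w = fun l => hrow (psumMat X) l ᵥ* (R0⁻¹ * W0) := by
    refine hw.ext ?_ ?_
    · intro l
      have h := congrArg (fun v => v ᵥ* (R0⁻¹ * W0)) (isCharRec_hrow X l)
      simp only [Matrix.zero_vecMul, Matrix.sum_vecMul, Matrix.smul_vecMul] at h
      exact h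
    · intro l hl
      have h1 : R0 * (R0⁻¹ * W0) = W0 := by
        rw [← Matrix.mul_assoc, Matrix.mul_nonsing_inv _ hu, Matrix.one_mul]
      have h2 := congrFun h1 ⟨N - 1 - l, by omega⟩
      have h3 : N - 1 - (N - 1 - l) = l := by omega
      rw [Matrix.mul_apply_eq_vecMul] at h2
      simp only [hR0, hW0] at h2
      change hrow (psumMat X) (N - 1 - (N - 1 - l)) ᵥ* _ = w (N - 1 - (N - 1 - l)) at h2
      rw [h3] at h2
      exact h2.symm
  have h4 : (Matrix.of fun i => w (shiftedPart l i)) =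
      (Matrix.of fun i => hrow (psumMat X) (shiftedPart l i)) * (R0⁻¹ * W0) := by
    ext i j
    rw [hwr]
    rfl
  rw [h4, Matrix.det_mul, Matrix.det_mul, ← jacobiTrudi_eq_det_hrow, Matrix.det_nonsing_inv, hdet]
  simp

/-- The companion matrix of `X`, advancing the rows `hrow` by one step. -/
def hCompanion (X : Matrix (Fin N) (Fin N) K) : Matrix (Fin N) (Fin N) K :=
  Matrix.of fun i j => (if (i : ℕ) = j + 1 then 1 else 0) -
    if (j : ℕ) + 1 = N then X.charpolyRev.coeff (N - i) else 0

theorem hrow_succ [Nontrivial K] (X : Matrix (Fin N) (Fin N) K) (l : ℕ) :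
    hrow (psumMat X) (l + 1) = hrow (psumMat X) l ᵥ* hCompanion X := by
  ext j
  simp only [Matrix.vecMul, dotProduct, hCompanion, Matrix.of_apply, mul_sub, mul_ite, mul_one,
    mul_zero, Finset.sum_sub_distrib]
  by_cases hj : (j : ℕ) + 1 = N
  · have h0 : ∑ i : Fin N, (if (i : ℕ) = j + 1 then hrow (psumMat X) l i else 0) = 0 :=
      Finset.sum_eq_zero fun i _ => by rw [if_neg]; have := i.2; omega
    rw [h0, zero_sub]
    simp only [hj, if_true]
    have h := sum_charpolyRev_mul_hseqZ X (l + 1) (by omega)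
    rw [Finset.sum_range_succ', charpolyRev_coeff_zero, ← Finset.sum_range_reflect, one_mul] at h
    rw [Finset.sum_range] at h
    rw [eq_neg_iff_add_eq_zero, add_comm, ← h]
    congr 1
    · refine Finset.sum_congr rfl fun i _ => ?_
      have := i.2
      rw [mul_comm, hrow]
      congr 2
      · omega
      · omega
    · rw [hrow]; congr 1; push_cast; omega
  · have hj' : (j : ℕ) + 1 < N := by have := j.2; omega
    simp only [if_neg hj, Finset.sum_const_zero, sub_zero]
    rw [Finset.sum_eq_single ⟨j + 1, hj'⟩]
    · simp [hrow]; congr 1; ring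
    · intro b _ hb
      rw [if_neg]
      intro h; apply hb; ext; exact h
    · simp

theorem trace_hCompanion (X : Matrix (Fin N) (Fin N) K) :
    (hCompanion X).trace = psumMat X 0 := by
  have h := newton_charpolyRev X 0
  simp only [Nat.cast_zero, zero_add, mul_one, Finset.range_one, Finset.sum_singleton,
    Nat.sub_self, charpolyRev_coeff_zero] at h
  have h2 : psumMat X 0 = - X.charpolyRev.coeff 1 := by rw [h, neg_neg]
  rw [h2]
  cases N with
  | zero => simp [Matrix.trace, Matrix.charpolyRev, Polynomial.coeff_one]
  | succ n =>
    rw [Matrix.trace, Finset.sum_eq_single (Fin.last n)]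
    · simp [hCompanion]
    · intro b _ hb
      have : (b : ℕ) ≠ n := fun h => hb (Fin.ext h)
      simp [hCompanion, this]
    · simp

theorem det_hCompanion [Nontrivial K] (X : Matrix (Fin N) (Fin N) K) :
    (hCompanion X).det = X.det := by
  cases N with
  | zero => simp
  | succ n =>
    rw [Matrix.det_succ_row_zero, Finset.sum_eq_single (Fin.last n)]
    · have h1 : ((hCompanion X).submatrix Fin.succ (Fin.last n).succAbove) = 1 := by
        ext i j
        have hj := j.2
        simp only [Matrix.submatrix_apply, hCompanion, Matrix.of_apply, Fin.val_succ,
          Fin.succAbove_last, Fin.val_castSucc, Nat.add_right_cancel_iff]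
        have hj' : (j : ℕ) ≠ n := by omega
        simp [hj', Matrix.one_apply, Fin.ext_iff]
      rw [h1, Matrix.det_one, mul_one, Matrix.det_eq_sign_charpoly_coeff]
      have h2 := coeff_charpolyRev X (n + 1) le_rfl
      have h3 : hCompanion X 0 (Fin.last n) = - X.charpoly.coeff 0 := by
        simp [hCompanion, h2]
      rw [h3, Fintype.card_fin, pow_succ, Fin.val_last]
      ring
    · intro b _ hb
      have : (b : ℕ) ≠ n := fun h => hb (Fin.ext h)
      simp [hCompanion, this]
    · simp

theorem of_rows_mul_apply (f : Fin N → Fin N → K) (T : Matrix (Fin N) (Fin N) K) (i : Fin N) :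
    (Matrix.of f * T) i = f i ᵥ* T := rfl

/-- The Pieri rule for `p_1`. -/
theorem pieri_psum [Nontrivial K] (X : Matrix (Fin N) (Fin N) K) (l : Fin N → ℕ) :
    ∑ i, jacobiTrudi (psumMat X) (Function.update l i (l i + 1)) =
      psumMat X 0 * jacobiTrudi (psumMat X) l := by
  rw [← trace_hCompanion, jacobiTrudi_eq_det_hrow, ← Matrix.sum_det_updateRow_mul]
  refine Finset.sum_congr rfl fun i _ => ?_
  rw [jacobiTrudi_eq_det_hrow]
  congr 1
  ext1 k j
  by_cases hk : k = i
  · subst hk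
    rw [Matrix.updateRow_self, of_rows_mul_apply, ← hrow_succ, Matrix.of_apply]
    simp only [shiftedPart, Function.update_self]
    congr 1; omega
  · rw [Matrix.updateRow_ne hk]
    simp [shiftedPart, hk]

theorem jacobiTrudi_add_const [Nontrivial K] (X : Matrix (Fin N) (Fin N) K) (l : Fin N → ℕ)
    (q : ℕ) :
    jacobiTrudi (psumMat X) (fun i => l i + q) = X.det ^ q * jacobiTrudi (psumMat X) l := by
  induction q with
  | zero => simp
  | succ q ih =>
    rw [pow_succ', mul_assoc, ← ih, ← det_hCompanion, jacobiTrudi_eq_det_hrow,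
      jacobiTrudi_eq_det_hrow, mul_comm, ← Matrix.det_mul]
    congr 1
    ext i j
    rw [of_rows_mul_apply, ← hrow_succ, Matrix.of_apply]
    simp only [shiftedPart]
    congr 1; omega

theorem jacobiTrudi_eq_zero_of_shiftedPart_eq (p : ℕ → K) (l : Fin N → ℕ) {i j : Fin N}
    (hij : i ≠ j) (h : shiftedPart l i = shiftedPart l j) : jacobiTrudi p l = 0 := by
  rw [jacobiTrudi_eq_det_hrow]
  exact Matrix.det_zero_of_row_eq hij (by ext; simp [h])

end Recurrence

section Partitions

variable {N : ℕ}

theorem charpolyRev_congr {K : Type*} [CommRing K] [Nontrivial K]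
    {X Y : Matrix (Fin N) (Fin N) K} (h : X.charpoly = Y.charpoly) :
    X.charpolyRev = Y.charpolyRev := by
  rw [← Matrix.reverse_charpoly, ← Matrix.reverse_charpoly, h]

theorem exists_diagonal_psumMat_eq (X : Matrix (Fin N) (Fin N) ℂ) :
    ∃ x : Fin N → ℂ, psumMat X = psumMat (Matrix.diagonal x) := by
  have hs := IsAlgClosed.splits X.charpoly
  have hcard : X.charpoly.roots.card = N := by
    rw [← hs.natDegree_eq_card_roots, Matrix.charpoly_natDegree_eq_dim, Fintype.card_fin]
  obtain ⟨L, hL⟩ := Quot.exists_rep X.charpoly.roots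
  have hlen : L.length = N := by rw [← hcard, ← hL]; rfl
  refine ⟨fun i => L.get (i.cast hlen.symm), psumMat_congr (charpolyRev_congr ?_)⟩
  rw [Matrix.charpoly_diagonal]
  subst hlen
  have h1 := hs.eq_prod_roots_of_monic (Matrix.charpoly_monic X)
  rw [h1, ← hL]
  simp only [Fin.cast_refl, id]
  change (Multiset.map _ (L : Multiset ℂ)).prod = _
  rw [Multiset.map_coe, Multiset.prod_coe]
  conv_lhs => rw [← List.ofFn_get L]
  rw [List.map_ofFn, List.prod_ofFn]
  rfl

/-- The falling factorials of `l`, in decreasing degree. -/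
def fallingRow (N l : ℕ) (j : Fin N) : ℂ := (l.descFactorial (N - 1 - j) : ℂ)

theorem fallingRow_eq (l : ℕ) :
    fallingRow N l = fun j => (l.factorial : ℂ) * hrow pInf l j := by
  ext j
  have hj := j.2
  rw [fallingRow, hrow]
  rcases le_or_gt (N - 1 - j) l with h | h
  · rw [show (l : ℤ) - ((N : ℤ) - 1) + j = ((l - (N - 1 - j) : ℕ) : ℤ) by omega, hseqZ_natCast,
      hseq_pInf, ← Nat.factorial_mul_descFactorial h]
    have : ((l - (N - 1 - j)).factorial : ℂ) ≠ 0 := by exact_mod_cast Nat.factorial_ne_zero _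
    push_cast
    field_simp
  · rw [hseqZ_neg _ (by omega), Nat.descFactorial_of_lt h]
    simp

def fallingStep (N : ℕ) : Matrix (Fin N) (Fin N) ℂ :=
  Matrix.of fun i j => if i = j then 1 else if (i : ℕ) = j + 1 then ((N - 1 - j : ℕ) : ℂ) else 0

theorem fallingRow_succ (l : ℕ) : fallingRow N (l + 1) = fallingRow N l ᵥ* fallingStep N := by
  ext j
  have hj := j.2
  simp only [Matrix.vecMul, dotProduct, fallingStep, Matrix.of_apply]
  by_cases h : (j : ℕ) + 1 < N
  · rw [← Finset.add_sum_erase _ _ (Finset.mem_univ j),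
      ← Finset.add_sum_erase _ _ (Finset.mem_erase.2 ⟨_, Finset.mem_univ (⟨j + 1, h⟩ : Fin N)⟩),
      Finset.sum_eq_zero]
    · obtain ⟨k, hk⟩ : ∃ k, N - 1 - j = k + 1 := ⟨N - 2 - j, by omega⟩
      simp only [fallingRow, hk, Nat.succ_descFactorial_succ, Fin.ext_iff,
        show N - 1 - (j + 1) = k by omega, Nat.descFactorial_succ]
      rcases le_or_gt k l with h2 | h2
      · simp [Nat.cast_sub h2]; ring
      · simp [Nat.descFactorial_of_lt h2]
    · intro x hx
      simp only [Finset.mem_erase, ne_eq, Fin.ext_iff] at hx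
      rw [if_neg (by rw [Fin.ext_iff]; exact hx.2.1), if_neg hx.1, mul_zero]
    · rw [ne_eq, Fin.ext_iff]; simp
  · rw [Finset.sum_eq_single j]
    · simp [fallingRow, show N - 1 - j = 0 by omega]
    · intro x _ hx
      have := x.2
      rw [if_neg hx, if_neg (by omega), mul_zero]
    · simp

theorem charpoly_fallingStep :
    (fallingStep N).charpoly = (1 : Matrix (Fin N) (Fin N) ℂ).charpoly := by
  rw [← Matrix.charpoly_transpose, Matrix.charpoly_of_isUpperTriangular, Matrix.charpoly_one]
  · simp [fallingStep]
  · intro i j hij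
    simp only [id] at hij
    have : (j : ℕ) < i := hij
    simp [fallingStep, Fin.ext_iff, show ¬ (j : ℕ) = i by omega,
      show ¬ (j : ℕ) = i + 1 by omega]

theorem det_fallingRow (l : Fin N → ℕ) :
    (Matrix.of fun i => fallingRow N (shiftedPart l i)).det =
      (∏ i, ((shiftedPart l i).factorial : ℂ)) * schurPInf l := by
  simp_rw [fallingRow_eq]
  rw [schurPInf_eq_jacobiTrudi, jacobiTrudi_eq_det_hrow, ← Matrix.det_mul_column]
  rfl

theorem schurPInf_zero : schurPInf (fun _ : Fin N => 0) = 1 := by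
  rw [schurPInf_eq_jacobiTrudi, jacobiTrudi_zero]

/-- The hook-content type ratio `s_λ(p_∞) / s_λ(1)`. -/
def schurRatio (l : Fin N → ℕ) : ℂ :=
  ∏ i : Fin N, ((N - 1 - i : ℕ).factorial : ℂ) / ((shiftedPart l i).factorial : ℂ)

theorem schurPInf_eq_schurRatio_mul (l : Fin N → ℕ) :
    schurPInf l = schurRatio l * schur l (1 : Matrix (Fin N) (Fin N) ℂ) := by
  have h := (isCharRec_of_vecMul _ _ (fallingRow_succ (N := N))).det_eq l
  have h0 : (Matrix.of fun i : Fin N => fallingRow N (N - 1 - i)).det =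
      ∏ i : Fin N, ((N - 1 - i : ℕ).factorial : ℂ) := by
    have := det_fallingRow (fun _ : Fin N => 0)
    simpa [shiftedPart, schurPInf_zero] using this
  rw [det_fallingRow, h0, psumMat_congr (charpolyRev_congr charpoly_fallingStep),
    ← schur_eq_jacobiTrudi] at h
  have h1 : (∏ i, ((shiftedPart l i).factorial : ℂ)) ≠ 0 :=
    Finset.prod_ne_zero_iff.2 fun i _ => by exact_mod_cast Nat.factorial_ne_zero _
  rw [schurRatio, Finset.prod_div_distrib, div_mul_eq_mul_div, eq_div_iff h1, mul_comm, h, mul_comm]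

theorem shiftedPart_injective {l : Fin N → ℕ} (hl : Antitone l) :
    Function.Injective (shiftedPart l) := by
  intro i j hij
  simp only [shiftedPart] at hij
  have hi := i.2
  have hj := j.2
  rcases lt_trichotomy i j with h | h | h
  · have := hl h.le
    have : (i : ℕ) < j := h
    omega
  · exact h
  · have := hl h.le
    have : (j : ℕ) < i := h
    omega

theorem schurPInf_ne_zero {l : Fin N → ℕ} (hl : Antitone l) : schurPInf l ≠ 0 := by
  have hv := Matrix.det_eval_matrixOfPolynomials_eq_det_vandermonde
    (fun i => (shiftedPart l i : ℂ)) (fun j : Fin N => descPochhammer ℂ j)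
    (fun i => descPochhammer_natDegree _ _) (fun i => monic_descPochhammer _ _)
  have hv0 : (Matrix.vandermonde fun i => (shiftedPart l i : ℂ)).det ≠ 0 :=
    Matrix.det_vandermonde_ne_zero_iff.2
      (Nat.cast_injective.comp (shiftedPart_injective hl))
  have h1 : (Matrix.of fun i => fallingRow N (shiftedPart l i)) =
      (Matrix.of fun i j : Fin N =>
        (descPochhammer ℂ j).eval (shiftedPart l i : ℂ)).submatrix id Fin.revPerm := by
    ext i j
    simp only [Matrix.submatrix_apply, Matrix.of_apply, id, fallingRow,
      descPochhammer_eval_eq_descFactorial, Fin.revPerm_apply, Fin.val_rev]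
    congr 2; omega
  have h2 := det_fallingRow l
  rw [h1, Matrix.det_permute', ← hv] at h2
  intro h0
  rw [h0, mul_zero] at h2
  rcases mul_eq_zero.1 h2 with h | h
  · rcases Int.units_eq_one_or (Equiv.Perm.sign (Fin.revPerm : Equiv.Perm (Fin N))) with h' | h' <;>
      rw [h'] at h <;> simp at h
  · exact hv0 h

theorem schur_one_ne_zero {l : Fin N → ℕ} (hl : Antitone l) :
    schur l (1 : Matrix (Fin N) (Fin N) ℂ) ≠ 0 := fun h =>
  schurPInf_ne_zero hl (by rw [schurPInf_eq_schurRatio_mul, h, mul_zero])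

theorem schurPInf_div_schur_one {l : Fin N → ℕ} (hl : Antitone l) :
    schurPInf l / schur l (1 : Matrix (Fin N) (Fin N) ℂ) = schurRatio l := by
  rw [schurPInf_eq_schurRatio_mul, mul_div_cancel_right₀ _ (schur_one_ne_zero hl)]

theorem schurRatio_update_succ (l : Fin N → ℕ) (i : Fin N) :
    (shiftedPart l i + 1) * schurRatio (Function.update l i (l i + 1)) = schurRatio l := by
  unfold schurRatio
  rw [← Finset.mul_prod_erase _ _ (Finset.mem_univ i),
    ← Finset.mul_prod_erase _ _ (Finset.mem_univ i),
    ← mul_assoc]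
  congr 1
  · have h1 : shiftedPart (Function.update l i (l i + 1)) i = shiftedPart l i + 1 := by
      simp only [shiftedPart, Function.update_self]; omega
    have h2 : ((shiftedPart l i).factorial : ℂ) ≠ 0 := by exact_mod_cast Nat.factorial_ne_zero _
    have h3 : (shiftedPart l i + 1 : ℂ) ≠ 0 := Nat.cast_add_one_ne_zero _
    rw [h1, Nat.factorial_succ]
    push_cast
    field_simp
  · refine Finset.prod_congr rfl fun j hj => ?_
    simp [shiftedPart, Finset.ne_of_mem_erase hj]

theorem schurRatio_zero : schurRatio (fun _ : Fin N => 0) = 1 := by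
  refine Finset.prod_eq_one fun i _ => ?_
  have : ((N - 1 - i : ℕ).factorial : ℂ) ≠ 0 := by exact_mod_cast Nat.factorial_ne_zero _
  simp [shiftedPart, this]

/-- Partitions of `n` with at most `N` parts. -/
def partsOf (N n : ℕ) : Finset (Fin N → ℕ) :=
  (Finset.Nat.antidiagonalTuple N n).filter Antitone

theorem mem_partsOf {n : ℕ} {l : Fin N → ℕ} : l ∈ partsOf N n ↔ wt l = n ∧ Antitone l := by
  simp [partsOf, wt, Finset.Nat.mem_antidiagonalTuple]

theorem wt_update_succ (l : Fin N → ℕ) (i : Fin N) :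
    wt (Function.update l i (l i + 1)) = wt l + 1 := by
  unfold wt
  rw [← Finset.add_sum_erase _ _ (Finset.mem_univ i),
    ← Finset.add_sum_erase _ l (Finset.mem_univ i)]
  rw [Function.update_self, Finset.sum_congr rfl (g := l)]
  · ring
  · intro j hj
    simp [Finset.ne_of_mem_erase hj]

theorem jacobiTrudi_update_succ_eq_zero {K : Type*} [CommRing K] [Algebra ℂ K] (p : ℕ → K)
    {l : Fin N → ℕ} (hl : Antitone l) (i : Fin N)
    (h : ¬ Antitone (Function.update l i (l i + 1))) :
    jacobiTrudi p (Function.update l i (l i + 1)) = 0 := by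
  simp only [Antitone, not_forall, not_le] at h
  obtain ⟨a, b, hab, hlt⟩ := h
  have hi := i.2
  have hab' : (a : ℕ) ≤ b := hab
  have hbi : b = i := by
    by_contra hb
    rw [Function.update_of_ne hb] at hlt
    have := hl hab
    by_cases ha : a = i
    · subst ha; rw [Function.update_self] at hlt; omega
    · rw [Function.update_of_ne ha] at hlt; omega
  subst hbi
  have hne : a ≠ b := by rintro rfl; simp at hlt
  have hne' : (a : ℕ) ≠ b := fun h => hne (Fin.ext h)
  rw [Function.update_self, Function.update_of_ne hne] at hlt
  let c : Fin N := ⟨b - 1, by omega⟩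
  have hcb : c ≠ b := by intro h; have := congrArg Fin.val h; simp [c] at this; omega
  have h1 : l a ≥ l c := hl (show (a : ℕ) ≤ b - 1 by omega)
  have h2 : l c ≥ l b := hl (show b - 1 ≤ (b : ℕ) by omega)
  refine jacobiTrudi_eq_zero_of_shiftedPart_eq p _ hcb ?_
  simp only [shiftedPart, Function.update_self, Function.update_of_ne hcb]
  simp only [c] at *
  omega

theorem jacobiTrudi_update_pred_eq_zero {K : Type*} [CommRing K] [Algebra ℂ K] (p : ℕ → K)
    {l : Fin N → ℕ} (hl : Antitone l) (i : Fin N) (h0 : l i ≠ 0)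
    (h : ¬ Antitone (Function.update l i (l i - 1))) :
    jacobiTrudi p (Function.update l i (l i - 1)) = 0 := by
  simp only [Antitone, not_forall, not_le] at h
  obtain ⟨a, b, hab, hlt⟩ := h
  have hab' : (a : ℕ) ≤ b := hab
  have hai : a = i := by
    by_contra ha
    rw [Function.update_of_ne ha] at hlt
    have := hl hab
    by_cases hb : b = i
    · subst hb; rw [Function.update_self] at hlt; omega
    · rw [Function.update_of_ne hb] at hlt; omega
  subst hai
  have hne : b ≠ a := by rintro rfl; simp at hlt
  have hne' : (a : ℕ) ≠ b := fun h => hne (Fin.ext h.symm)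
  have hbN := b.2
  rw [Function.update_self, Function.update_of_ne hne] at hlt
  let c : Fin N := ⟨a + 1, by omega⟩
  have hca : c ≠ a := by intro h; have := congrArg Fin.val h; simp [c] at this
  have h1 : l c ≥ l b := hl (show (a : ℕ) + 1 ≤ b by omega)
  have h2 : l a ≥ l c := hl (show (a : ℕ) ≤ a + 1 by omega)
  refine jacobiTrudi_eq_zero_of_shiftedPart_eq p _ hca ?_
  simp only [shiftedPart, Function.update_self, Function.update_of_ne hca]
  simp only [c] at *
  omega

theorem int_mul_hseqZ_pInf (k : ℤ) : (k : ℂ) * hseqZ pInf k = hseqZ pInf (k - 1) := by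
  rcases lt_trichotomy k 0 with h | h | h
  · rw [hseqZ_neg _ h, hseqZ_neg _ (by omega), mul_zero]
  · subst h; rw [hseqZ_neg pInf (by omega : (0 : ℤ) - 1 < 0)]; simp
  · obtain ⟨n, rfl⟩ : ∃ n : ℕ, k = n + 1 := ⟨(k - 1).toNat, by omega⟩
    rw [add_sub_cancel_right, hseqZ_natCast, ← Nat.cast_succ, hseqZ_natCast, hseq_pInf, hseq_pInf,
      Nat.factorial_succ]
    have h2 : (n.factorial : ℂ) ≠ 0 := by exact_mod_cast Nat.factorial_ne_zero _
    have h3 : (n + 1 : ℂ) ≠ 0 := Nat.cast_add_one_ne_zero _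
    push_cast
    field_simp

/-- The branching rule for the dimensions `s_λ(p_∞)`. -/
theorem sum_schurPInf_update_pred {l : Fin N → ℕ} (hl : Antitone l) :
    ∑ i, (if l i = 0 then 0 else schurPInf (Function.update l i (l i - 1))) =
      wt l * schurPInf l := by
  have h := Matrix.sum_det_updateRow_scale
    (Matrix.of fun i j : Fin N => hseqZ pInf ((l i : ℤ) - i + j))
    (fun i => ((l i : ℂ) - i)) (fun j => (j : ℂ))
  have hw : (∑ i : Fin N, ((l i : ℂ) - i) + ∑ j : Fin N, (j : ℂ)) = wt l := by
    rw [Finset.sum_sub_distrib, sub_add_cancel, wt, Nat.cast_sum]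
  rw [hw] at h
  rw [schurPInf_eq_jacobiTrudi, jacobiTrudi, ← h]
  refine Finset.sum_congr rfl fun i _ => ?_
  have hrow : (fun j : Fin N => ((l i : ℂ) - i + j) *
      (Matrix.of fun i j : Fin N => hseqZ pInf ((l i : ℤ) - i + j)) i j) =
      fun j : Fin N => hseqZ pInf ((l i : ℤ) - i + (j : ℤ) - 1) := by
    ext j
    rw [← int_mul_hseqZ_pInf, Matrix.of_apply]
    push_cast; rfl
  rw [hrow]
  split_ifs with h0
  · symm
    by_cases hi : (i : ℕ) + 1 < N
    · refine Matrix.det_zero_of_row_eq (i := i) (j := ⟨i + 1, hi⟩) ?_ ?_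
      · intro h; have := congrArg Fin.val h; simp at this
      · ext j
        have h2 : l ⟨i + 1, hi⟩ ≤ l i := hl (show (i : ℕ) ≤ i + 1 by omega)
        rw [Matrix.updateRow_self, Matrix.updateRow_ne]
        · simp only [Matrix.of_apply]; congr 1; push_cast; omega
        · intro h; have := congrArg Fin.val h; simp at this
    · refine Matrix.det_eq_zero_of_row_eq_zero i fun j => ?_
      have := j.2
      rw [Matrix.updateRow_self, hseqZ_neg _ (by omega)]
  · rw [schurPInf_eq_jacobiTrudi, jacobiTrudi]
    congr 1
    ext k j
    by_cases hk : k = i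
    · subst hk
      rw [Matrix.updateRow_self, Matrix.of_apply, Function.update_self]
      congr 1; omega
    · rw [Matrix.updateRow_ne hk, Matrix.of_apply, Function.update_of_ne hk, Matrix.of_apply]

/-- Moving a box between consecutive levels of Young's lattice. -/
theorem sum_partsOf_update_succ {M : Type*} [AddCommMonoid M] (n : ℕ)
    (F : (Fin N → ℕ) → Fin N → M) :
    ∑ l ∈ partsOf N n, ∑ i, (if Antitone (Function.update l i (l i + 1)) then F l i else 0) =
    ∑ m ∈ partsOf N (n + 1), ∑ i,
      (if m i ≠ 0 ∧ Antitone (Function.update m i (m i - 1)) then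
        F (Function.update m i (m i - 1)) i else 0) := by
  rw [← Finset.sum_product', ← Finset.sum_product', ← Finset.sum_filter, ← Finset.sum_filter]
  refine Finset.sum_bij' (fun x _ => (Function.update x.1 x.2 (x.1 x.2 + 1), x.2))
    (fun x _ => (Function.update x.1 x.2 (x.1 x.2 - 1), x.2)) ?_ ?_ ?_ ?_ ?_
  · rintro ⟨l, i⟩ h
    simp only [Finset.mem_filter, Finset.mem_product, mem_partsOf, Finset.mem_univ, and_true] at h ⊢
    refine ⟨⟨by rw [wt_update_succ, h.1.1], h.2⟩, by simp, ?_⟩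
    simpa using h.1.2
  · rintro ⟨l, i⟩ h
    simp only [Finset.mem_filter, Finset.mem_product, mem_partsOf, Finset.mem_univ, and_true] at h ⊢
    have h1 := wt_update_succ (Function.update l i (l i - 1)) i
    have h2 : l i - 1 + 1 = l i := by omega
    simp only [Function.update_self, Function.update_idem, h2, Function.update_eq_self] at h1 ⊢
    exact ⟨⟨by omega, h.2.2⟩, h.1.2⟩
  · rintro ⟨l, i⟩ h
    simp
  · rintro ⟨l, i⟩ h
    simp only [Finset.mem_filter] at h
    have h2 : l i - 1 + 1 = l i := by omega
    simp [h2]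
  · rintro ⟨l, i⟩ h
    simp

theorem psumMat_pow_eq_sum (X : Matrix (Fin N) (Fin N) ℂ) (n : ℕ) :
    psumMat X 0 ^ n / n.factorial = ∑ l ∈ partsOf N n, schurPInf l * schur l X := by
  induction n with
  | zero =>
    rw [Finset.sum_eq_single (fun _ => 0)]
    · rw [schurPInf_zero, schur_eq_jacobiTrudi, jacobiTrudi_zero]; simp
    · intro l hl h0
      rw [mem_partsOf] at hl
      refine absurd ?_ h0
      ext i
      exact (Finset.sum_eq_zero_iff.1 hl.1) i (Finset.mem_univ i)
    · intro h
      refine absurd ?_ h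
      rw [mem_partsOf]
      exact ⟨by simp [wt], fun _ _ _ => le_rfl⟩
  | succ n ih =>
    have hn : ((n : ℂ) + 1) ≠ 0 := Nat.cast_add_one_ne_zero n
    have h1 : psumMat X 0 ^ (n + 1) / (n + 1).factorial =
        ((n : ℂ) + 1)⁻¹ * (psumMat X 0 * (psumMat X 0 ^ n / n.factorial)) := by
      rw [Nat.factorial_succ, pow_succ]
      push_cast
      field_simp
    have h2 : psumMat X 0 * (psumMat X 0 ^ n / n.factorial) =
        ∑ l ∈ partsOf N n, ∑ i, if Antitone (Function.update l i (l i + 1)) then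
          schurPInf l * schur (Function.update l i (l i + 1)) X else 0 := by
      rw [ih, Finset.mul_sum]
      refine Finset.sum_congr rfl fun l hl => ?_
      rw [mul_left_comm, schur_eq_jacobiTrudi, ← pieri_psum, Finset.mul_sum]
      refine Finset.sum_congr rfl fun i _ => ?_
      rw [schur_eq_jacobiTrudi]
      split_ifs with h
      · rfl
      · rw [jacobiTrudi_update_succ_eq_zero _ (mem_partsOf.1 hl).2 i h, mul_zero]
    rw [h1, h2, sum_partsOf_update_succ n
      (fun l i => schurPInf l * schur (Function.update l i (l i + 1)) X), inv_mul_eq_iff_eq_mul₀ hn,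
      Finset.mul_sum]
    refine Finset.sum_congr rfl fun m hm => ?_
    obtain ⟨hm1, hm2⟩ := mem_partsOf.1 hm
    have h3 := sum_schurPInf_update_pred hm2
    rw [hm1] at h3
    push_cast at h3
    rw [← mul_assoc, ← h3, Finset.sum_mul]
    refine Finset.sum_congr rfl fun i _ => ?_
    by_cases h0 : m i = 0
    · simp [h0]
    · have h4 : m i - 1 + 1 = m i := by omega
      by_cases ha : Antitone (Function.update m i (m i - 1))
      · simp [h0, ha, h4]
      · simp [h0, ha, schurPInf_eq_jacobiTrudi, jacobiTrudi_update_pred_eq_zero _ hm2 i h0 ha]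

end Partitions

section CasimirMatrix

variable {K : Type*} [CommRing K] [Algebra ℂ K] {N : ℕ}

/-- `E i j` acts on the matrix `X` as left multiplication by the elementary matrix `e_ij`. -/
def IsLeftAction (E : Fin N → Fin N → Derivation ℂ K K) (X : Matrix (Fin N) (Fin N) K) : Prop :=
  ∀ i j a b, E i j (X a b) = if a = i then X j b else 0

variable {E : Fin N → Fin N → Derivation ℂ K K} {X : Matrix (Fin N) (Fin N) K}

theorem IsLeftAction.apply_pow (hE : IsLeftAction E X) (i j a b : Fin N) (m : ℕ) :
    E i j ((X ^ m) a b) = ∑ c ∈ Finset.range m, (X ^ c) a i * (X ^ (m - c)) j b := by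
  have hE' : ∀ i j a b, E i j (X a b) = if a = i then X j b else 0 := hE
  induction m generalizing a b with
  | zero =>
    by_cases h : a = b <;> simp [Matrix.one_apply, h]
  | succ m ih =>
    have h1 : (X ^ (m + 1)) a b = ∑ d, X a d * (X ^ m) d b := by rw [pow_succ', Matrix.mul_apply]
    rw [h1, map_sum]
    simp only [Derivation.leibniz, hE', ih, smul_eq_mul]
    rw [Finset.sum_add_distrib, Finset.sum_range_succ']
    congr 1
    · simp_rw [Finset.mul_sum]
      rw [Finset.sum_comm]
      refine Finset.sum_congr rfl fun c _ => ?_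
      rw [pow_succ' X c, Matrix.mul_apply, Finset.sum_mul, Nat.add_sub_add_right]
      exact Finset.sum_congr rfl fun d _ => by ring
    · rw [pow_zero, Nat.sub_zero, Matrix.one_apply]
      split_ifs
      · rw [one_mul, pow_succ', Matrix.mul_apply]
        exact Finset.sum_congr rfl fun d _ => by ring
      · simp

theorem IsLeftAction.apply_trace (hE : IsLeftAction E X) (i j : Fin N) (m : ℕ) :
    E i j ((X ^ m).trace) = m * (X ^ m) j i := by
  rw [Matrix.trace, map_sum]
  simp only [Matrix.diag_apply, hE.apply_pow]
  rw [Finset.sum_comm]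
  calc _ = ∑ c ∈ Finset.range m, (X ^ m) j i := by
        refine Finset.sum_congr rfl fun c hc => ?_
        have : m = (m - c) + c := by have := Finset.mem_range.1 hc; omega
        conv_rhs => rw [this, pow_add, Matrix.mul_apply]
        exact Finset.sum_congr rfl fun d _ => by ring
    _ = _ := by simp

/-- The Casimir operator. -/
def casimir (E : Fin N → Fin N → Derivation ℂ K K) (f : K) : K := ∑ i, ∑ j, E i j (E j i f)

/-- The bilinear form attached to the Casimir operator. -/
def casimirForm (E : Fin N → Fin N → Derivation ℂ K K) (f g : K) : K :=
  ∑ i, ∑ j, E i j f * E j i g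

theorem casimirForm_comm (f g : K) : casimirForm E f g = casimirForm E g f := by
  unfold casimirForm
  rw [Finset.sum_comm]
  exact Finset.sum_congr rfl fun i _ => Finset.sum_congr rfl fun j _ => mul_comm _ _

theorem casimirForm_add_left (f f' g : K) :
    casimirForm E (f + f') g = casimirForm E f g + casimirForm E f' g := by
  simp [casimirForm, add_mul, Finset.sum_add_distrib]

theorem casimirForm_mul_left (f f' g : K) :
    casimirForm E (f * f') g = f * casimirForm E f' g + f' * casimirForm E f g := by
  simp only [casimirForm, Finset.mul_sum, ← Finset.sum_add_distrib]
  refine Finset.sum_congr rfl fun i _ => Finset.sum_congr rfl fun j _ => ?_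
  rw [Derivation.leibniz, smul_eq_mul, smul_eq_mul]
  ring

theorem casimir_add (f g : K) : casimir E (f + g) = casimir E f + casimir E g := by
  simp [casimir, Finset.sum_add_distrib]

theorem casimir_mul (f g : K) :
    casimir E (f * g) = casimir E f * g + f * casimir E g + 2 * casimirForm E f g := by
  have h : casimir E (f * g) = casimir E f * g + f * casimir E g +
      (casimirForm E f g + casimirForm E g f) := by
    simp only [casimir, casimirForm, Finset.mul_sum, Finset.sum_mul, ← Finset.sum_add_distrib]
    refine Finset.sum_congr rfl fun i _ => Finset.sum_congr rfl fun j _ => ?_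
    simp only [Derivation.leibniz, map_add, smul_eq_mul]
    ring
  rw [h, casimirForm_comm g f]
  ring

theorem IsLeftAction.casimir_trace (hE : IsLeftAction E X) (m : ℕ) :
    casimir E ((X ^ m).trace) =
      m * ∑ c ∈ Finset.range m, (X ^ c).trace * (X ^ (m - c)).trace := by
  have h : ∀ i j, E i j (E j i ((X ^ m).trace)) =
      m * ∑ c ∈ Finset.range m, (X ^ c) i i * (X ^ (m - c)) j j := by
    intro i j
    rw [hE.apply_trace, Derivation.leibniz, hE.apply_pow]
    simp
  simp only [casimir, h, ← Finset.mul_sum]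
  congr 1
  simp_rw [Finset.sum_comm (t := Finset.range m)]
  refine Finset.sum_congr rfl fun c _ => ?_
  simp only [Matrix.trace, Matrix.diag_apply, Finset.sum_mul_sum]

theorem IsLeftAction.casimirForm_trace (hE : IsLeftAction E X) (m n : ℕ) :
    casimirForm E ((X ^ m).trace) ((X ^ n).trace) = m * n * (X ^ (m + n)).trace := by
  have h : ∀ i j, E i j ((X ^ m).trace) * E j i ((X ^ n).trace) =
      m * n * ((X ^ n) i j * (X ^ m) j i) := by
    intro i j
    rw [hE.apply_trace, hE.apply_trace]
    ring
  simp only [casimirForm, h, ← Finset.mul_sum]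
  rw [add_comm m n, pow_add, Matrix.trace]
  simp only [Matrix.diag_apply, Matrix.mul_apply]

end CasimirMatrix

section CasimirEigenvalues

open MvPolynomial

variable (N : ℕ)

/-- Euler derivations `x_i ∂_i`. -/
def eulerD (i : Fin N) : Derivation ℂ (MvPolynomial (Fin N) ℂ) (MvPolynomial (Fin N) ℂ) :=
  (X i : MvPolynomial (Fin N) ℂ) • pderiv i

/-- The diagonal matrix of variables. -/
def diagX : Matrix (Fin N) (Fin N) (MvPolynomial (Fin N) ℂ) := Matrix.diagonal X

/-- The alternant with exponents `L`. -/
def alternant {N : ℕ} (L : Fin N → ℕ) : MvPolynomial (Fin N) ℂ :=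
  (Matrix.of fun i j => (X j : MvPolynomial (Fin N) ℂ) ^ L i).det

variable {N}

theorem trace_diagX_pow (m : ℕ) : ((diagX N) ^ m).trace = ∑ i, X i ^ m := by
  simp [diagX, Matrix.diagonal_pow, Matrix.trace]

theorem eulerD_X (i j : Fin N) : eulerD N i (X j) = if j = i then X j else 0 := by
  by_cases h : j = i
  · subst h; simp [eulerD]
  · simp [eulerD, pderiv_X_of_ne h, h]

theorem eulerD_X_pow (i j : Fin N) (m : ℕ) :
    eulerD N i (X j ^ m) = if j = i then (m : MvPolynomial (Fin N) ℂ) * X j ^ m else 0 := by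
  rw [Derivation.leibniz_pow, eulerD_X]
  split_ifs
  · cases m with
    | zero => simp
    | succ m => simp only [Nat.add_sub_cancel, smul_eq_mul, nsmul_eq_mul, pow_succ]
  · simp

theorem eulerD_prod_pow (i : Fin N) (a : Fin N → ℕ) :
    eulerD N i (∏ j, X j ^ a j) = (a i : MvPolynomial (Fin N) ℂ) * ∏ j, X j ^ a j := by
  rw [Derivation.leibniz_finset_prod, Finset.sum_eq_single i]
  · rw [eulerD_X_pow, if_pos rfl, ← Finset.mul_prod_erase _ _ (Finset.mem_univ i)]
    ring
  · intro b _ hb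
    rw [eulerD_X_pow, if_neg hb, mul_zero]
  · simp

theorem alternant_eq_sum (L : Fin N → ℕ) : alternant L =
    ∑ σ : Equiv.Perm (Fin N), (Equiv.Perm.sign σ : ℤ) •
      ∏ j, (X j : MvPolynomial (Fin N) ℂ) ^ L (σ j) := by
  rw [alternant, Matrix.det_apply]
  rfl

/-- The radial part of the Casimir operator conjugated by the Vandermonde determinant. -/
def radialCasimir (f : MvPolynomial (Fin N) ℂ) : MvPolynomial (Fin N) ℂ :=
  ∑ i, (eulerD N i (eulerD N i f) - ((N : MvPolynomial (Fin N) ℂ) - 1) * eulerD N i f)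

theorem radialCasimir_alternant (L : Fin N → ℕ) : radialCasimir (alternant L) =
    (∑ i, (L i : MvPolynomial (Fin N) ℂ) * (L i - (N - 1))) * alternant L := by
  rw [alternant_eq_sum, radialCasimir]
  simp only [map_sum, map_zsmul, Finset.mul_sum, ← Finset.sum_sub_distrib]
  rw [Finset.sum_comm]
  refine Finset.sum_congr rfl fun σ _ => ?_
  rw [mul_smul_comm, Finset.sum_mul, Finset.smul_sum]
  conv_rhs => rw [← Equiv.sum_comp σ]
  refine Finset.sum_congr rfl fun i _ => ?_
  rw [mul_smul_comm, ← smul_sub, eulerD_prod_pow i (fun j => L (σ j)), Derivation.leibniz,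
    eulerD_prod_pow i (fun j => L (σ j))]
  congr 1
  simp only [smul_eq_mul, Derivation.map_natCast]
  ring

/-- The Vandermonde alternant. -/
def alternantZero (N : ℕ) : MvPolynomial (Fin N) ℂ := alternant fun i : Fin N => N - 1 - i

theorem alternant_shiftedPart (l : Fin N → ℕ) : alternant (shiftedPart l) =
    jacobiTrudi (psumMat (diagX N)) l * alternantZero N := by
  have h : IsCharRec (diagX N) (fun (k : ℕ) (j : Fin N) => (X j : MvPolynomial (Fin N) ℂ) ^ k) := by
    refine isCharRec_of_vecMul _ _ fun k => ?_
    ext1 j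
    rw [diagX, Matrix.vecMul_diagonal, pow_succ]
  exact h.det_eq l

theorem alternantZero_eq : ∃ ε : ℤ, ε ≠ 0 ∧ alternantZero N =
    (ε : MvPolynomial (Fin N) ℂ) *
      ∏ i : Fin N, ∏ j ∈ Finset.Ioi i, ((X j : MvPolynomial (Fin N) ℂ) - X i) := by
  refine ⟨Equiv.Perm.sign (Fin.revPerm : Equiv.Perm (Fin N)), by simp, ?_⟩
  rw [← Matrix.det_vandermonde, ← Matrix.det_permute', ← Matrix.det_transpose, alternantZero,
    alternant]
  congr 1
  ext1 i j
  simp only [Matrix.of_apply, Matrix.transpose_apply, Matrix.submatrix_apply,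
    Matrix.vandermonde_apply, id, Fin.revPerm_apply, Fin.val_rev]
  congr 1; omega

theorem alternantZero_ne_zero : alternantZero N ≠ 0 := by
  obtain ⟨ε, hε, h⟩ := alternantZero_eq (N := N)
  rw [h]
  refine mul_ne_zero (by exact_mod_cast hε) ?_
  refine Finset.prod_ne_zero_iff.2 fun i _ => Finset.prod_ne_zero_iff.2 fun j hj => ?_
  rw [sub_ne_zero]
  intro h
  exact (Finset.mem_Ioi.1 hj).ne' (X_injective h)

theorem sum_pow_mul_eulerD_alternantZero (m : ℕ) :
    2 * ∑ i, X i ^ m * eulerD N i (alternantZero N) =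
      alternantZero N * (∑ r ∈ Finset.range (m + 1),
        ((diagX N) ^ r).trace * ((diagX N) ^ (m - r)).trace -
          (m + 1) * ((diagX N) ^ m).trace) := by
  obtain ⟨ε, hε, h⟩ := alternantZero_eq (N := N)
  let W : Derivation ℂ (MvPolynomial (Fin N) ℂ) (MvPolynomial (Fin N) ℂ) :=
    ∑ i, (X i ^ m : MvPolynomial (Fin N) ℂ) • eulerD N i
  have hW : ∀ f, W f = ∑ i, X i ^ m * eulerD N i f := by
    intro f
    simp only [W]
    rw [← Derivation.coeFnAddMonoidHom_apply, map_sum, Finset.sum_apply]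
    rfl
  have hWX : ∀ j, W (X j) = X j ^ (m + 1) := by
    intro j
    rw [hW, Finset.sum_eq_single j]
    · rw [eulerD_X, if_pos rfl, pow_succ]
    · intro b _ hb; rw [eulerD_X, if_neg hb.symm, mul_zero]
    · simp
  let g : Fin N → Fin N → MvPolynomial (Fin N) ℂ := fun i j =>
    ∑ r ∈ Finset.range (m + 1), X j ^ r * X i ^ (m - r)
  have hg : ∀ i j, W (X j - X i) = (X j - X i) * g i j := by
    intro i j
    rw [map_sub, hWX, hWX, mul_comm]
    have := (Commute.all (X j : MvPolynomial (Fin N) ℂ) (X i)).geom_sum₂_mul (m + 1)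
    rw [← this]
    simp only [g, Nat.add_sub_cancel]
  have hprod : ∀ {ι : Type} (s : Finset ι) (f u : ι → MvPolynomial (Fin N) ℂ),
      (∀ i ∈ s, W (f i) = f i * u i) → W (∏ i ∈ s, f i) = (∏ i ∈ s, f i) * ∑ i ∈ s, u i := by
    intro ι s f u hfu
    rw [Derivation.leibniz_finset_prod, Finset.mul_sum]
    refine Finset.sum_congr rfl fun i hi => ?_
    rw [hfu i hi, ← Finset.mul_prod_erase _ _ hi]
    ring
  have hWV : W (alternantZero N) = alternantZero N * ∑ i, ∑ j ∈ Finset.Ioi i, g i j := by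
    rw [h, Derivation.leibniz, Derivation.map_intCast, smul_zero, add_zero, smul_eq_mul, mul_assoc]
    congr 1
    refine hprod _ _ _ fun i _ => hprod _ _ _ fun j _ => hg i j
  have hsymm : ∀ i j, g i j = g j i := by
    intro i j
    simp only [g]
    rw [← Finset.sum_range_reflect]
    refine Finset.sum_congr rfl fun r hr => ?_
    have := Finset.mem_range.1 hr
    rw [mul_comm]
    congr 2 <;> omega
  have hsum : ∑ i, ∑ j, g i j = 2 * ∑ i, ∑ j ∈ Finset.Ioi i, g i j + ∑ i, g i i := by
    have h1 : ∀ i, ∑ j, g i j = ∑ j ∈ Finset.Ioi i, g i j + ∑ j ∈ Finset.Iio i, g i j + g i i := by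
      intro i
      have : (Finset.univ : Finset (Fin N)) = insert i (Finset.Ioi i ∪ Finset.Iio i) := by
        ext j; simp only [Finset.mem_univ, Finset.mem_insert, Finset.mem_union, Finset.mem_Ioi,
          Finset.mem_Iio, true_iff]
        rcases lt_trichotomy i j with h | h | h <;> simp [h]
      rw [this, Finset.sum_insert (by simp), Finset.sum_union]
      · ring
      · rw [Finset.disjoint_left]; intro j; simp only [Finset.mem_Ioi, Finset.mem_Iio]
        exact fun h => not_lt.2 h.le
    have h2 : ∑ i, ∑ j ∈ Finset.Iio i, g i j = ∑ i, ∑ j ∈ Finset.Ioi i, g i j := by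
      rw [Finset.sum_comm' (t' := Finset.univ) (s' := fun j => Finset.Ioi j)]
      · exact Finset.sum_congr rfl fun i _ => Finset.sum_congr rfl fun j _ => hsymm _ _
      · intro x y; simp
    simp_rw [h1, Finset.sum_add_distrib]
    rw [h2]
    ring
  rw [← hW, hWV]
  have h3 : ∑ i, ∑ j, g i j = ∑ r ∈ Finset.range (m + 1),
        ((diagX N) ^ r).trace * ((diagX N) ^ (m - r)).trace := by
    simp_rw [g, Finset.sum_comm (t := Finset.range (m + 1)), trace_diagX_pow]
    refine Finset.sum_congr rfl fun r _ => ?_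
    rw [Finset.sum_mul_sum, Finset.sum_comm]
  have h4 : ∑ i, g i i = (m + 1) * ((diagX N) ^ m).trace := by
    rw [trace_diagX_pow, Finset.mul_sum]
    refine Finset.sum_congr rfl fun i _ => ?_
    have : ∀ r ∈ Finset.range (m + 1),
        (X i : MvPolynomial (Fin N) ℂ) ^ r * X i ^ (m - r) = X i ^ m := by
      intro r hr
      rw [← pow_add]; congr 1; have := Finset.mem_range.1 hr; omega
    simp only [g]
    rw [Finset.sum_congr rfl this]
    simp
  rw [← h3, ← h4, hsum]
  ring

end CasimirEigenvalues

section CasimirTransfer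

open MvPolynomial

variable {K : Type*} [CommRing K] [Algebra ℂ K] {N : ℕ}

/-- Evaluation of polynomials in abstract power sums at the power sums of a matrix. -/
def psumEval (Y : Matrix (Fin N) (Fin N) K) : MvPolynomial ℕ ℂ →ₐ[ℂ] K := aeval (psumMat Y)

/-- The abstract power sum of degree `m`. -/
def absPsum (N m : ℕ) : MvPolynomial ℕ ℂ := if m = 0 then (N : MvPolynomial ℕ ℂ) else X (m - 1)

theorem psumEval_X (Y : Matrix (Fin N) (Fin N) K) (n : ℕ) :
    psumEval Y (X n) = (Y ^ (n + 1)).trace := by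
  simp [psumEval, psumMat]

theorem psumEval_absPsum (Y : Matrix (Fin N) (Fin N) K) (m : ℕ) :
    psumEval Y (absPsum N m) = (Y ^ m).trace := by
  cases m with
  | zero => simp [absPsum]
  | succ m => simp [absPsum, psumEval_X]

/-- The derivation of abstract power sums giving the symbol of the Casimir operator. -/
def absForm (N n : ℕ) : Derivation ℂ (MvPolynomial ℕ ℂ) (MvPolynomial ℕ ℂ) :=
  mkDerivation ℂ fun k => ((k : MvPolynomial ℕ ℂ) + 1) * (n + 1) * absPsum N (k + 1 + (n + 1))

theorem casimirForm_psumEval {E : Fin N → Fin N → Derivation ℂ K K} {Y : Matrix (Fin N) (Fin N) K}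
    (hE : IsLeftAction E Y) (n : ℕ) (f : MvPolynomial ℕ ℂ) :
    casimirForm E (psumEval Y f) ((Y ^ (n + 1)).trace) = psumEval Y (absForm N n f) := by
  induction f using MvPolynomial.induction_on with
  | C a =>
    have h : psumEval Y (C a) = algebraMap ℂ K a := by simp [psumEval]
    rw [h, MvPolynomial.derivation_C, map_zero]
    simp [casimirForm]
  | add f g hf hg => rw [map_add, casimirForm_add_left, hf, hg, map_add, map_add]
  | mul_X f k hf =>
    rw [map_mul, casimirForm_mul_left, hf, psumEval_X, hE.casimirForm_trace, Derivation.leibniz,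
      map_add, smul_eq_mul, smul_eq_mul, map_mul, map_mul, psumEval_X, absForm, mkDerivation_X,
      map_mul, psumEval_absPsum]
    simp

theorem eulerForm_psumEval (n : ℕ) (f : MvPolynomial ℕ ℂ) :
    ∑ i, eulerD N i (psumEval (diagX N) f) * eulerD N i (((diagX N) ^ (n + 1)).trace) =
      psumEval (diagX N) (absForm N n f) := by
  have hq : ∀ (m : ℕ) (i : Fin N), eulerD N i (((diagX N) ^ m).trace) =
      (m : MvPolynomial (Fin N) ℂ) * X i ^ m := by
    intro m i
    rw [trace_diagX_pow, map_sum, Finset.sum_eq_single i]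
    · rw [eulerD_X_pow, if_pos rfl]
    · intro b _ hb; rw [eulerD_X_pow, if_neg hb]
    · simp
  induction f using MvPolynomial.induction_on with
  | C a =>
    have h : psumEval (diagX N) (C a) = algebraMap ℂ (MvPolynomial (Fin N) ℂ) a := by
      simp [psumEval]
    rw [h, MvPolynomial.derivation_C, map_zero]
    simp
  | add f g hf hg =>
    simp only [map_add, add_mul, Finset.sum_add_distrib, hf, hg]
  | mul_X f k hf =>
    simp only [map_mul, Derivation.leibniz, psumEval_X, smul_eq_mul, add_mul,
      Finset.sum_add_distrib, map_add]
    have h1 : psumEval (diagX N) (((k : MvPolynomial ℕ ℂ) + 1) * (n + 1)) =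
        ((k : MvPolynomial (Fin N) ℂ) + 1) * (n + 1) := by simp
    have h2 : ∀ i : Fin N, eulerD N i (((diagX N) ^ (k + 1)).trace) *
        eulerD N i (((diagX N) ^ (n + 1)).trace) =
          ((k : MvPolynomial (Fin N) ℂ) + 1) * ((n : MvPolynomial (Fin N) ℂ) + 1) *
            X i ^ (k + 1 + (n + 1)) := by
      intro i
      rw [hq, hq, pow_add]
      push_cast
      ring
    rw [← hf, absForm, mkDerivation_X, map_mul, psumEval_absPsum, h1,
      trace_diagX_pow (k + 1 + (n + 1))]
    simp only [mul_assoc, ← Finset.mul_sum] at h2 ⊢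
    simp only [h2, ← Finset.mul_sum]

/-- The eigenvalue of the radial Casimir operator on an alternant. -/
def alternantEigenvalue (L : Fin N → ℕ) : ℂ := ∑ i, (L i : ℂ) * (L i - (N - 1))

theorem radialCasimir_alternant' (L : Fin N → ℕ) :
    radialCasimir (alternant L) = C (alternantEigenvalue L) * alternant L := by
  rw [radialCasimir_alternant]
  simp [alternantEigenvalue]

theorem radialCasimir_mul (Δ f : MvPolynomial (Fin N) ℂ) :
    radialCasimir (Δ * f) = radialCasimir Δ * f + Δ * radialCasimir f +
      2 * ∑ i, eulerD N i Δ * eulerD N i f := by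
  simp only [radialCasimir, Finset.mul_sum, Finset.sum_mul, ← Finset.sum_add_distrib]
  refine Finset.sum_congr rfl fun i _ => ?_
  simp only [Derivation.leibniz, map_add, smul_eq_mul]
  ring

theorem radialCasimir_alternantZero_mul (m : ℕ) :
    radialCasimir (alternantZero N * ((diagX N) ^ m).trace) =
      alternantZero N * ((m : MvPolynomial (Fin N) ℂ) * ∑ c ∈ Finset.range m,
        ((diagX N) ^ c).trace * ((diagX N) ^ (m - c)).trace) +
      C (alternantEigenvalue fun i : Fin N => N - 1 - i) *
        (alternantZero N * ((diagX N) ^ m).trace) := by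
  have hq : ∀ i, eulerD N i (((diagX N) ^ m).trace) = (m : MvPolynomial (Fin N) ℂ) * X i ^ m := by
    intro i
    rw [trace_diagX_pow, map_sum, Finset.sum_eq_single i]
    · rw [eulerD_X_pow, if_pos rfl]
    · intro b _ hb; rw [eulerD_X_pow, if_neg hb]
    · simp
  have hq2 : ∀ i, eulerD N i ((m : MvPolynomial (Fin N) ℂ) * X i ^ m) =
      (m : MvPolynomial (Fin N) ℂ) * ((m : MvPolynomial (Fin N) ℂ) * X i ^ m) := by
    intro i
    rw [Derivation.leibniz, Derivation.map_natCast, eulerD_X_pow, if_pos rfl]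
    simp
  have h1 := sum_pow_mul_eulerD_alternantZero (N := N) m
  rw [Finset.sum_range_succ, Nat.sub_self, pow_zero, Matrix.trace_one, Fintype.card_fin] at h1
  rw [radialCasimir_mul, alternantZero, radialCasimir_alternant', ← alternantZero]
  have h2 : radialCasimir (((diagX N) ^ m).trace) =
      (m : MvPolynomial (Fin N) ℂ) * (m - (N - 1)) * ((diagX N) ^ m).trace := by
    simp only [radialCasimir, hq, hq2]
    rw [trace_diagX_pow, Finset.mul_sum]
    exact Finset.sum_congr rfl fun i _ => by ring
  have h3 : 2 * ∑ i, eulerD N i (alternantZero N) * eulerD N i (((diagX N) ^ m).trace) =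
      (m : MvPolynomial (Fin N) ℂ) * (2 * ∑ i, X i ^ m * eulerD N i (alternantZero N)) := by
    simp only [hq, Finset.mul_sum]
    exact Finset.sum_congr rfl fun i _ => by ring
  rw [h2, h3, h1]
  ring

/-- The Casimir operator of `gl_N` and its radial part agree on polynomials in power sums. -/
theorem exists_casimir_psumEval {E : Fin N → Fin N → Derivation ℂ K K}
    {Y : Matrix (Fin N) (Fin N) K} (hE : IsLeftAction E Y) (f : MvPolynomial ℕ ℂ) :
    ∃ g, casimir E (psumEval Y f) = psumEval Y g ∧
      radialCasimir (alternantZero N * psumEval (diagX N) f) =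
        alternantZero N * psumEval (diagX N) g +
        C (alternantEigenvalue fun i : Fin N => N - 1 - i) *
          (alternantZero N * psumEval (diagX N) f) := by
  induction f using MvPolynomial.induction_on with
  | C a =>
    refine ⟨0, ?_, ?_⟩
    · have h : psumEval Y (C a) = algebraMap ℂ K a := by simp [psumEval]
      rw [h, map_zero]
      simp [casimir]
    · have h : psumEval (diagX N) (C a) = C a := by simp [psumEval]
      rw [h, radialCasimir_mul, alternantZero, radialCasimir_alternant', ← alternantZero]
      simp [radialCasimir]
      ring
  | add f g hf hg =>
    obtain ⟨f', hf1, hf2⟩ := hf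
    obtain ⟨g', hg1, hg2⟩ := hg
    refine ⟨f' + g', ?_, ?_⟩
    · rw [map_add, casimir_add, hf1, hg1, map_add]
    · have hadd : ∀ a b : MvPolynomial (Fin N) ℂ,
          radialCasimir (a + b) = radialCasimir a + radialCasimir b := by
        intro a b
        simp only [radialCasimir, ← Finset.sum_add_distrib, map_add]
        exact Finset.sum_congr rfl fun i _ => by ring
      rw [map_add, mul_add, hadd, hf2, hg2, map_add]
      ring
  | mul_X f n hf =>
    obtain ⟨f', hf1, hf2⟩ := hf
    let G : MvPolynomial ℕ ℂ := ((n + 1 : ℕ) : MvPolynomial ℕ ℂ) *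
      ∑ c ∈ Finset.range (n + 1), absPsum N c * absPsum N (n + 1 - c)
    refine ⟨f' * X n + f * G + 2 * absForm N n f, ?_, ?_⟩
    · have hG' : psumEval Y G = ((n + 1 : ℕ) : K) * ∑ c ∈ Finset.range (n + 1),
          (Y ^ c).trace * (Y ^ (n + 1 - c)).trace := by
        simp only [G, map_mul, map_sum, psumEval_absPsum, map_natCast]
      rw [map_mul, casimir_mul, hf1, psumEval_X, hE.casimir_trace, casimirForm_psumEval hE]
      simp only [map_add, map_mul, map_ofNat, psumEval_X, hG']
    · have h1 := radialCasimir_alternantZero_mul (N := N) (n + 1)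
      have hG' : psumEval (diagX N) G = ((n + 1 : ℕ) : MvPolynomial (Fin N) ℂ) *
          ∑ c ∈ Finset.range (n + 1), ((diagX N) ^ c).trace * ((diagX N) ^ (n + 1 - c)).trace := by
        simp only [G, map_mul, map_sum, psumEval_absPsum, map_natCast]
      rw [← hG'] at h1
      have h2 := eulerForm_psumEval (N := N) n f
      set F := psumEval (diagX N) f
      set q := ((diagX N) ^ (n + 1)).trace
      set Δ := alternantZero N
      have key : radialCasimir (Δ * (F * q)) = radialCasimir (Δ * F) * q +
          F * radialCasimir (Δ * q) - radialCasimir Δ * F * q +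
          2 * Δ * ∑ i, eulerD N i F * eulerD N i q := by
        rw [radialCasimir_mul, radialCasimir_mul, radialCasimir_mul, radialCasimir_mul]
        have : ∑ i, eulerD N i Δ * eulerD N i (F * q) =
            F * ∑ i, eulerD N i Δ * eulerD N i q + q * ∑ i, eulerD N i Δ * eulerD N i F := by
          rw [Finset.mul_sum, Finset.mul_sum, ← Finset.sum_add_distrib]
          refine Finset.sum_congr rfl fun i _ => ?_
          rw [Derivation.leibniz, smul_eq_mul, smul_eq_mul]
          ring
        rw [this]
        ring
      have hΔ : radialCasimir Δ = C (alternantEigenvalue fun i : Fin N => N - 1 - i) * Δ :=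
        radialCasimir_alternant' _
      rw [map_mul, psumEval_X, key, hf2, h1, h2, hΔ]
      simp only [map_add, map_mul, map_ofNat, psumEval_X]
      ring

/-- The eigenvalue of the Casimir operator on the Schur polynomial `s_λ`. -/
def casimirEigenvalue (l : Fin N → ℕ) : ℂ :=
  alternantEigenvalue (shiftedPart l) - alternantEigenvalue fun i : Fin N => N - 1 - i

theorem aeval_psumEval {τ : Type*} (Y : Matrix (Fin N) (Fin N) (MvPolynomial τ ℂ)) (w : τ → ℂ)
    (h : MvPolynomial ℕ ℂ) :
    aeval w (psumEval Y h) = aeval (psumMat (Y.map (aeval (R := ℂ) w))) h := by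
  have h1 : psumMat (Y.map (aeval (R := ℂ) w)) = fun m => aeval (R := ℂ) w (psumMat Y m) := by
    ext m
    exact (map_psumMat (aeval (R := ℂ) w).toRingHom Y m).symm
  rw [h1, psumEval, ← comp_aeval]
  rfl

theorem psumEval_eq_zero {τ : Type*} (Y : Matrix (Fin N) (Fin N) (MvPolynomial τ ℂ))
    {h : MvPolynomial ℕ ℂ} (h0 : psumEval (diagX N) h = 0) : psumEval Y h = 0 := by
  apply MvPolynomial.funext
  intro v
  rw [map_zero, ← coe_aeval_eq_eval]
  obtain ⟨x, hx⟩ := exists_diagonal_psumMat_eq (Y.map (aeval (R := ℂ) v))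
  have h2 := congrArg (aeval (R := ℂ) x) h0
  rw [aeval_psumEval, map_zero] at h2
  change aeval v (psumEval Y h) = 0
  rw [aeval_psumEval, hx, ← h2]
  congr 3
  ext i j
  by_cases hij : i = j <;> simp [diagX, hij]

theorem psumEval_jacobiTrudi (Y : Matrix (Fin N) (Fin N) K) (l : Fin N → ℕ) :
    psumEval Y (jacobiTrudi X l) = jacobiTrudi (psumMat Y) l := by
  rw [map_jacobiTrudi]
  simp only [psumEval, aeval_X]

/-- Schur polynomials are eigenvectors of the Casimir operator. -/
theorem casimir_jacobiTrudi {τ : Type*}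
    {E : Fin N → Fin N → Derivation ℂ (MvPolynomial τ ℂ) (MvPolynomial τ ℂ)}
    {Y : Matrix (Fin N) (Fin N) (MvPolynomial τ ℂ)} (hE : IsLeftAction E Y) (l : Fin N → ℕ) :
    casimir E (jacobiTrudi (psumMat Y) l) =
      C (casimirEigenvalue l) * jacobiTrudi (psumMat Y) l := by
  obtain ⟨g, hg1, hg2⟩ := exists_casimir_psumEval hE (jacobiTrudi X l)
  rw [← psumEval_jacobiTrudi, hg1]
  rw [psumEval_jacobiTrudi, mul_comm (alternantZero N) (jacobiTrudi _ _), ← alternant_shiftedPart,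
    radialCasimir_alternant', alternant_shiftedPart] at hg2
  have h0 : psumEval (diagX N) (g - C (casimirEigenvalue l) * jacobiTrudi X l) = 0 := by
    have h1 : psumEval (diagX N) (C (casimirEigenvalue l)) = C (casimirEigenvalue l) := by
      simp [psumEval]
    rw [map_sub, map_mul, h1, psumEval_jacobiTrudi, casimirEigenvalue, map_sub]
    refine (mul_eq_zero.1 ?_).resolve_left alternantZero_ne_zero
    linear_combination -hg2
  have h2 := psumEval_eq_zero Y h0
  rw [map_sub, map_mul, sub_eq_zero] at h2
  rw [h2]
  simp [psumEval]

theorem casimirEigenvalue_update_succ (l : Fin N → ℕ) (i : Fin N) :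
    casimirEigenvalue (Function.update l i (l i + 1)) - casimirEigenvalue l =
      2 * shiftedPart l i + 2 - N := by
  have h : ∀ m : Fin N → ℕ, alternantEigenvalue m = (m i : ℂ) * (m i - (N - 1)) +
      ∑ j ∈ Finset.univ.erase i, (m j : ℂ) * (m j - (N - 1)) := fun m =>
    (Finset.add_sum_erase _ _ (Finset.mem_univ i)).symm
  have h1 : shiftedPart (Function.update l i (l i + 1)) i = shiftedPart l i + 1 := by
    simp only [shiftedPart, Function.update_self]; omega
  rw [casimirEigenvalue, casimirEigenvalue, h, h (shiftedPart l), h1,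
    Finset.sum_congr rfl (g := fun j => (shiftedPart l j : ℂ) * (shiftedPart l j - (N - 1)))]
  · push_cast; ring
  · intro j hj
    simp [shiftedPart, Finset.ne_of_mem_erase hj]

end CasimirTransfer

section Euler

variable {K : Type*} [CommRing K] [Algebra ℂ K] {N : ℕ}

theorem derivation_hseq (D : Derivation ℂ K K) {p : ℕ → K} {c : ℂ}
    (hp : ∀ m, D (p m) = (c * (m + 1)) • p m) (k : ℕ) : D (hseq p k) = (c * k) • hseq p k := by
  induction k using Nat.strong_induction_on with
  | _ k ih =>
    cases k with
    | zero => simp [hseq_zero]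
    | succ k =>
      have h1 : ((k : ℂ) + 1) • D (hseq p (k + 1)) =
          ((k : ℂ) + 1) • (c * ((k + 1 : ℕ) : ℂ)) • hseq p (k + 1) := by
        rw [← Derivation.map_smul, smul_comm, hseq_succ, map_sum, Finset.smul_sum]
        refine Finset.sum_congr rfl fun m hm => ?_
        have hm' : m ≤ k := Nat.lt_succ_iff.1 (Finset.mem_range.1 hm)
        rw [Derivation.leibniz, hp, ih (k - m) (by omega), smul_eq_mul, smul_eq_mul,
          mul_smul_comm, mul_smul_comm, mul_comm (hseq p _), ← add_smul]
        congr 1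
        push_cast [Nat.cast_sub hm']
        ring
      have h2 := congrArg (fun x => ((k : ℂ) + 1)⁻¹ • x) h1
      simpa [smul_smul, inv_mul_cancel_left₀ (Nat.cast_add_one_ne_zero (R := ℂ) k),
        inv_mul_cancel₀ (Nat.cast_add_one_ne_zero (R := ℂ) k)] using h2

theorem derivation_hseqZ (D : Derivation ℂ K K) {p : ℕ → K} {c : ℂ}
    (hp : ∀ m, D (p m) = (c * (m + 1)) • p m) (k : ℤ) : D (hseqZ p k) = (c * k) • hseqZ p k := by
  rcases lt_or_ge k 0 with hk | hk
  · simp [hseqZ_neg p hk]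
  · lift k to ℕ using hk
    rw [hseqZ_natCast, derivation_hseq D hp, Int.cast_natCast]

/-- A derivation that scales power sums according to their degree scales Schur functions. -/
theorem derivation_jacobiTrudi (D : Derivation ℂ K K) {p : ℕ → K} {c : ℂ}
    (hp : ∀ m, D (p m) = (c * (m + 1)) • p m) (l : Fin N → ℕ) :
    D (jacobiTrudi p l) = (c * wt l) • jacobiTrudi p l := by
  rw [jacobiTrudi, Derivation.map_matrix_det]
  have h := Matrix.sum_det_updateRow_scale
    (Matrix.of fun i j : Fin N => hseqZ p ((l i : ℤ) - (i : ℤ) + (j : ℤ)))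
    (fun i => algebraMap ℂ K (c * (l i - i))) (fun j => algebraMap ℂ K (c * j))
  have h2 : ∑ i : Fin N, algebraMap ℂ K (c * (l i - i)) + ∑ j : Fin N, algebraMap ℂ K (c * j) =
      algebraMap ℂ K (c * wt l) := by
    rw [← map_sum, ← map_sum, ← map_add, ← Finset.sum_add_distrib, wt]
    push_cast
    simp only [← map_mul, ← map_natCast (algebraMap ℂ K), ← map_sub, ← map_add, ← map_sum,
      Finset.mul_sum]
    congr 1
    exact Finset.sum_congr rfl fun i _ => by ring
  rw [h2, ← Algebra.smul_def] at h
  rw [← h]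
  refine Finset.sum_congr rfl fun i _ => ?_
  congr 2
  ext j
  rw [Matrix.of_apply, derivation_hseqZ D hp, ← map_add, ← Algebra.smul_def]
  congr 1
  push_cast
  ring

theorem IsLeftAction.sum_diag_psumMat {E : Fin N → Fin N → Derivation ℂ K K}
    {X : Matrix (Fin N) (Fin N) K} (hE : IsLeftAction E X) (m : ℕ) :
    (∑ i, E i i) (psumMat X m) = ((1 : ℂ) * (m + 1)) • psumMat X m := by
  rw [← Derivation.coeFnAddMonoidHom_apply, map_sum, Finset.sum_apply, psumMat]
  simp only [Derivation.coeFnAddMonoidHom_apply, hE.apply_trace]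
  rw [← Finset.mul_sum, Algebra.smul_def]
  simp [Matrix.trace]

end Euler

section LinearPath

open MvPolynomial

variable {τ : Type*} [Fintype τ]

/-- Linear substitution of variables. -/
def linSubst (M : Matrix τ τ ℂ) : MvPolynomial τ ℂ →ₐ[ℂ] MvPolynomial τ ℂ :=
  aeval fun i => ∑ j, C (M i j) * X j

/-- The infinitesimal linear substitution of variables. -/
def linDer (M : Matrix τ τ ℂ) : Derivation ℂ (MvPolynomial τ ℂ) (MvPolynomial τ ℂ) :=
  mkDerivation ℂ fun i => ∑ j, C (M i j) * X j

theorem linDer_X (M : Matrix τ τ ℂ) (i : τ) : linDer M (X i) = ∑ j, C (M i j) * X j :=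
  mkDerivation_X _ _ _

theorem linSubst_one [DecidableEq τ] (f : MvPolynomial τ ℂ) :
    linSubst (1 : Matrix τ τ ℂ) f = f := by
  have : linSubst (1 : Matrix τ τ ℂ) = AlgHom.id ℂ (MvPolynomial τ ℂ) := by
    apply MvPolynomial.algHom_ext
    intro i
    simp [linSubst, Matrix.one_apply]
  rw [this]; rfl

theorem hasDerivAt_linSubst [DecidableEq τ] {M : ℝ → Matrix τ τ ℂ} {m : Matrix τ τ ℂ}
    (hM : ∀ i j, HasDerivAt (fun t => M t i j) (m i j) 0) (hM0 : M 0 = 1)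
    (f : MvPolynomial τ ℂ) (ℓ : MvPolynomial τ ℂ →ₗ[ℂ] ℂ) :
    HasDerivAt (fun t => ℓ (linSubst (M t) f)) (ℓ (linDer m f)) 0 := by
  induction f using MvPolynomial.induction_on generalizing ℓ with
  | C a =>
    simp only [linSubst, aeval_C, derivation_C, map_zero]
    exact hasDerivAt_const _ _
  | add f g hf hg =>
    simp only [map_add]
    exact (hf ℓ).add (hg ℓ)
  | mul_X f i hf =>
    have h1 : ∀ (M : Matrix τ τ ℂ) (g : MvPolynomial τ ℂ), ℓ (g * ∑ j, C (M i j) * X j) =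
        ∑ j, M i j * (ℓ ∘ₗ LinearMap.mulRight ℂ (X j)) g := by
      intro M g
      rw [Finset.mul_sum, map_sum]
      refine Finset.sum_congr rfl fun j _ => ?_
      rw [LinearMap.comp_apply, LinearMap.mulRight_apply, mul_left_comm,
        ← MvPolynomial.smul_eq_C_mul, map_smul, smul_eq_mul]
    have h2 : ∀ t, ℓ (linSubst (M t) (f * X i)) =
        ∑ j, M t i j * (ℓ ∘ₗ LinearMap.mulRight ℂ (X j)) (linSubst (M t) f) := by
      intro t
      rw [← h1, map_mul]
      simp [linSubst]
    have h3 : ℓ (linDer m (f * X i)) = ∑ j, (m i j * (ℓ ∘ₗ LinearMap.mulRight ℂ (X j)) f +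
        M 0 i j * (ℓ ∘ₗ LinearMap.mulRight ℂ (X j)) (linDer m f)) := by
      rw [Finset.sum_add_distrib, ← h1, ← h1, hM0, Derivation.leibniz, map_add, linDer_X]
      congr 2
      rw [smul_eq_mul, mul_comm]
      congr 1
      simp [Matrix.one_apply]
    simp only [h2, h3]
    refine HasDerivAt.fun_sum fun j _ => ?_
    have h4 := (hM i j).mul (hf (ℓ ∘ₗ LinearMap.mulRight ℂ (X j)))
    rwa [hM0, linSubst_one, ← hM0] at h4

end LinearPath

section HaarFunctional

open MvPolynomial

variable {N : ℕ}

instance instBorelSpaceSUN (N : ℕ) : BorelSpace (SUN N) := ⟨rfl⟩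

/-- The underlying matrix of an element of `SU(N)`. -/
def sunMat (V : SUN N) : Matrix (Fin N) (Fin N) ℂ := ((V : UN N) : Matrix (Fin N) (Fin N) ℂ)

theorem continuous_sunMat : Continuous (sunMat : SUN N → Matrix (Fin N) (Fin N) ℂ) :=
  continuous_subtype_val.comp continuous_subtype_val

theorem sunMat_mul (V W : SUN N) : sunMat (V * W) = sunMat V * sunMat W := rfl

theorem sunMat_mem (V : SUN N) : (sunMat V) ∈ Matrix.unitaryGroup (Fin N) ℂ := (V : UN N).2

theorem det_sunMat (V : SUN N) : (sunMat V).det = 1 := V.2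

theorem star_sunMat_mul (V : SUN N) : star (sunMat V) * (sunMat V) = 1 :=
  (Matrix.mem_unitaryGroup_iff').1 (sunMat_mem V)

/-- The element of `SU(N)` with the given underlying matrix. -/
def sunMk (g : Matrix (Fin N) (Fin N) ℂ) (hg : g ∈ Matrix.unitaryGroup (Fin N) ℂ)
    (hdet : g.det = 1) : SUN N := ⟨⟨g, hg⟩, hdet⟩

theorem norm_sunMat_le (V : SUN N) (i j : Fin N) : ‖(sunMat V) i j‖ ≤ 1 :=
  entry_norm_bound_of_unitary (sunMat_mem V) i j

/-- Variables: the entries of three matrices of size `N`. -/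
abbrev TripleVar (N : ℕ) := (Fin N × Fin N) × Fin 3

/-- The values of the variables given by three matrices. -/
def triplePoint (U V B : Matrix (Fin N) (Fin N) ℂ) : TripleVar N → ℂ :=
  fun x => ![U, V, B] x.2 x.1.1 x.1.2

/-- The matrices of variables. -/
def varMat (N : ℕ) (k : Fin 3) : Matrix (Fin N) (Fin N) (MvPolynomial (TripleVar N) ℂ) :=
  Matrix.of fun i j => X ((i, j), k)

theorem continuous_aeval_sunMat (B : Matrix (Fin N) (Fin N) ℂ) (f : MvPolynomial (TripleVar N) ℂ) :
    Continuous fun V : SUN N => aeval (triplePoint (sunMat V) (star (sunMat V)) B) f := by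
  induction f using MvPolynomial.induction_on with
  | C a => simpa using continuous_const
  | add f g hf hg =>
    simp only [map_add]
    exact hf.add hg
  | mul_X f x hf =>
    simp only [map_mul, aeval_X]
    refine hf.mul ?_
    obtain ⟨⟨i, j⟩, k⟩ := x
    have h := continuous_sunMat (N := N)
    fin_cases k
    · exact h.matrix_elem i j
    · exact h.matrix_conjTranspose.matrix_elem i j
    · exact continuous_const

theorem exists_norm_aeval_sunMat_le (B : Matrix (Fin N) (Fin N) ℂ)
    (f : MvPolynomial (TripleVar N) ℂ) :
    ∃ c, ∀ V : SUN N, ‖aeval (triplePoint (sunMat V) (star (sunMat V)) B) f‖ ≤ c := by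
  induction f using MvPolynomial.induction_on with
  | C a => exact ⟨‖a‖, fun V => by simp⟩
  | add f g hf hg =>
    obtain ⟨c, hc⟩ := hf
    obtain ⟨d, hd⟩ := hg
    exact ⟨c + d, fun V => by
      rw [map_add]; exact (norm_add_le _ _).trans (add_le_add (hc V) (hd V))⟩
  | mul_X f x hf =>
    obtain ⟨c, hc⟩ := hf
    obtain ⟨⟨i, j⟩, k⟩ := x
    have hc0 : 0 ≤ c := (norm_nonneg _).trans (hc 1)
    refine ⟨c * (1 + ‖B i j‖), fun V => ?_⟩
    rw [map_mul, norm_mul, aeval_X]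
    refine mul_le_mul (hc V) ?_ (norm_nonneg _) hc0
    have h1 := norm_nonneg (B i j)
    fin_cases k
    · exact (norm_sunMat_le V i j).trans (by linarith)
    · refine le_trans ?_ (le_add_of_nonneg_right h1)
      change ‖star ((sunMat V) j i)‖ ≤ 1
      rw [norm_star]
      exact norm_sunMat_le V j i
    · change ‖B i j‖ ≤ _
      linarith

variable (μ : Measure (SUN N)) [IsProbabilityMeasure μ]

theorem integrable_aeval_sunMat (B : Matrix (Fin N) (Fin N) ℂ) (f : MvPolynomial (TripleVar N) ℂ) :
    Integrable (fun V : SUN N => aeval (triplePoint (sunMat V) (star (sunMat V)) B) f) μ := by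
  obtain ⟨c, hc⟩ := exists_norm_aeval_sunMat_le B f
  exact Integrable.of_bound (continuous_aeval_sunMat B f).aestronglyMeasurable c
    (Filter.Eventually.of_forall hc)

/-- Integration over `SU(N)` of polynomials in the entries of `U`, `U†` and `B`. -/
def haarFunctional (B : Matrix (Fin N) (Fin N) ℂ) : MvPolynomial (TripleVar N) ℂ →ₗ[ℂ] ℂ where
  toFun f := ∫ V : SUN N, aeval (triplePoint (sunMat V) (star (sunMat V)) B) f ∂μ
  map_add' f g := by
    simp only [map_add]
    exact integral_add (integrable_aeval_sunMat μ B f) (integrable_aeval_sunMat μ B g)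
  map_smul' c f := by
    simp only [map_smul, RingHom.id_apply]
    exact integral_smul _ _

/-- The matrix of the substitution `(u, v, b) ↦ (Pu, vQ, Rb)`. -/
def tripleMat (P Q R : Matrix (Fin N) (Fin N) ℂ) : Matrix (TripleVar N) (TripleVar N) ℂ :=
  fun x y => if x.2 = y.2 then
    ![P x.1.1 y.1.1 * (if x.1.2 = y.1.2 then 1 else 0),
      Q y.1.2 x.1.2 * (if x.1.1 = y.1.1 then 1 else 0),
      R x.1.1 y.1.1 * (if x.1.2 = y.1.2 then 1 else 0)] x.2 else 0

theorem tripleMat_one : tripleMat (1 : Matrix (Fin N) (Fin N) ℂ) 1 1 = 1 := by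
  ext ⟨⟨i, j⟩, k⟩ ⟨⟨i', j'⟩, k'⟩
  by_cases hk : k = k'
  · subst hk
    have h : (1 : Matrix (TripleVar N) (TripleVar N) ℂ) ((i, j), k) ((i', j'), k) =
        if i = i' ∧ j = j' then 1 else 0 := by simp [Matrix.one_apply]
    rw [h]
    have h0 : tripleMat (1 : Matrix (Fin N) (Fin N) ℂ) 1 1 ((i, j), k) ((i', j'), k) =
      ![(1 : Matrix (Fin N) (Fin N) ℂ) i i' * (if j = j' then 1 else 0),
        (1 : Matrix (Fin N) (Fin N) ℂ) j' j * (if i = i' then 1 else 0),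
        (1 : Matrix (Fin N) (Fin N) ℂ) i i' * (if j = j' then 1 else 0)] k := if_pos rfl
    rw [h0, Matrix.one_apply, Matrix.one_apply, ite_and]
    have h1 : (j' = j) = (j = j') := propext eq_comm
    fin_cases k
    · change (if i = i' then (1 : ℂ) else 0) * _ = _
      split_ifs <;> simp
    · change (if j' = j then (1 : ℂ) else 0) * _ = _
      simp only [h1]
      split_ifs <;> simp
    · change (if i = i' then (1 : ℂ) else 0) * _ = _
      split_ifs <;> simp
  · simp [tripleMat, hk]

theorem sum_tripleMat {S : Type*} [CommSemiring S] [Algebra ℂ S] (P Q R : Matrix (Fin N) (Fin N) ℂ)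
    (F : TripleVar N → S) (x : TripleVar N) :
    ∑ y, algebraMap ℂ S (tripleMat P Q R x y) * F y =
      ![∑ a, algebraMap ℂ S (P x.1.1 a) * F ((a, x.1.2), 0),
        ∑ a, F ((x.1.1, a), 1) * algebraMap ℂ S (Q a x.1.2),
        ∑ a, algebraMap ℂ S (R x.1.1 a) * F ((a, x.1.2), 2)] x.2 := by
  obtain ⟨⟨i, j⟩, k⟩ := x
  rw [Fintype.sum_prod_type, Finset.sum_comm, Finset.sum_eq_single k, Fintype.sum_prod_type]
  · fin_cases k
    · have h : ∀ a c, tripleMat P Q R ((i, j), 0) ((a, c), 0) = if j = c then P i a else 0 := by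
        intro a c; simp [tripleMat]
      change ∑ a, ∑ c, algebraMap ℂ S (tripleMat P Q R ((i, j), 0) ((a, c), 0)) * F ((a, c), 0) =
        ∑ a, algebraMap ℂ S (P i a) * F ((a, j), 0)
      refine Finset.sum_congr rfl fun a _ => ?_
      rw [Finset.sum_eq_single j (fun c _ hc => by rw [h, if_neg hc.symm, map_zero, zero_mul])
        (fun h => absurd (Finset.mem_univ _) h), h, if_pos rfl]
    · have h : ∀ a c, tripleMat P Q R ((i, j), 1) ((a, c), 1) = if i = a then Q c j else 0 := by
        intro a c; simp [tripleMat]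
      change ∑ a, ∑ c, algebraMap ℂ S (tripleMat P Q R ((i, j), 1) ((a, c), 1)) * F ((a, c), 1) =
        ∑ a, F ((i, a), 1) * algebraMap ℂ S (Q a j)
      rw [Finset.sum_comm]
      refine Finset.sum_congr rfl fun a _ => ?_
      rw [Finset.sum_eq_single i (fun c _ hc => by rw [h, if_neg hc.symm, map_zero, zero_mul])
        (fun h => absurd (Finset.mem_univ _) h), h, if_pos rfl, mul_comm]
    · have h : ∀ a c, tripleMat P Q R ((i, j), 2) ((a, c), 2) = if j = c then R i a else 0 := by
        intro a c; simp [tripleMat]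
      change ∑ a, ∑ c, algebraMap ℂ S (tripleMat P Q R ((i, j), 2) ((a, c), 2)) * F ((a, c), 2) =
        ∑ a, algebraMap ℂ S (R i a) * F ((a, j), 2)
      refine Finset.sum_congr rfl fun a _ => ?_
      rw [Finset.sum_eq_single j (fun c _ hc => by rw [h, if_neg hc.symm, map_zero, zero_mul])
        (fun h => absurd (Finset.mem_univ _) h), h, if_pos rfl]
  · intro k' _ hk'
    simp [tripleMat, hk'.symm]
  · simp

theorem aeval_linSubst_tripleMat (P Q R U V B : Matrix (Fin N) (Fin N) ℂ)
    (f : MvPolynomial (TripleVar N) ℂ) :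
    aeval (triplePoint U V B) (linSubst (tripleMat P Q R) f) =
      aeval (triplePoint (P * U) (V * Q) (R * B)) f := by
  rw [linSubst, ← AlgHom.comp_apply, comp_aeval]
  congr 2
  ext x
  have h := sum_tripleMat P Q R (triplePoint U V B) x
  simp only [map_sum, map_mul, aeval_X, aeval_C]
  rw [h]
  obtain ⟨⟨i, j⟩, k⟩ := x
  fin_cases k <;> rfl

/-- The derivation `u ↦ Pu, v ↦ vQ, b ↦ Rb`. -/
def tripleDer (P Q R : Matrix (Fin N) (Fin N) ℂ) :
    Derivation ℂ (MvPolynomial (TripleVar N) ℂ) (MvPolynomial (TripleVar N) ℂ) :=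
  linDer (tripleMat P Q R)

theorem tripleDer_X (P Q R : Matrix (Fin N) (Fin N) ℂ) (x : TripleVar N) :
    tripleDer P Q R (X x) =
      ![∑ a, C (P x.1.1 a) * varMat N 0 a x.1.2, ∑ a, varMat N 1 x.1.1 a * C (Q a x.1.2),
        ∑ a, C (R x.1.1 a) * varMat N 2 a x.1.2] x.2 := by
  rw [tripleDer, linDer_X]
  exact sum_tripleMat P Q R X x

end HaarFunctional

section Invariance

open MvPolynomial

variable {N : ℕ} 

theorem hasDerivAt_tripleMat {P Q R : ℝ → Matrix (Fin N) (Fin N) ℂ}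
    {P' Q' R' : Matrix (Fin N) (Fin N) ℂ} (hP : ∀ i j, HasDerivAt (fun t => P t i j) (P' i j) 0)
    (hQ : ∀ i j, HasDerivAt (fun t => Q t i j) (Q' i j) 0)
    (hR : ∀ i j, HasDerivAt (fun t => R t i j) (R' i j) 0) (x y : TripleVar N) :
    HasDerivAt (fun t => tripleMat (P t) (Q t) (R t) x y) (tripleMat P' Q' R' x y) 0 := by
  by_cases h : x.2 = y.2
  · simp only [tripleMat, h, if_true]
    generalize y.2 = k
    fin_cases k
    · exact (hP _ _).mul_const _
    · exact (hQ _ _).mul_const _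
    · exact (hR _ _).mul_const _
  · simp only [tripleMat, h, if_false]
    exact hasDerivAt_const _ _

theorem tripleMat_add (P Q R P' Q' R' : Matrix (Fin N) (Fin N) ℂ) :
    tripleMat (P + P') (Q + Q') (R + R') = tripleMat P Q R + tripleMat P' Q' R' := by
  ext x y
  by_cases h : x.2 = y.2
  · simp only [tripleMat, h, if_true, Matrix.add_apply, add_mul]
    generalize y.2 = k
    fin_cases k <;> rfl
  · simp [tripleMat, h]

theorem tripleMat_smul (c : ℂ) (P Q R : Matrix (Fin N) (Fin N) ℂ) :
    tripleMat (c • P) (c • Q) (c • R) = c • tripleMat P Q R := by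
  ext x y
  by_cases h : x.2 = y.2
  · simp only [tripleMat, h, if_true, Matrix.smul_apply, smul_eq_mul, mul_assoc]
    generalize y.2 = k
    fin_cases k <;> rfl
  · simp [tripleMat, h]

theorem linDer_add {τ : Type*} [Fintype τ] (M M' : Matrix τ τ ℂ) :
    linDer (M + M') = linDer M + linDer M' := by
  apply MvPolynomial.derivation_ext
  intro i
  simp [linDer_X, add_mul, Finset.sum_add_distrib]

theorem linDer_smul {τ : Type*} [Fintype τ] (c : ℂ) (M : Matrix τ τ ℂ) :
    linDer (c • M) = c • linDer M := by
  apply MvPolynomial.derivation_ext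
  intro i
  simp [linDer_X, Finset.smul_sum, mul_assoc, MvPolynomial.smul_eq_C_mul]

/-- The infinitesimal left translation by `Y`. -/
def leftDer : Matrix (Fin N) (Fin N) ℂ →ₗ[ℂ]
    Derivation ℂ (MvPolynomial (TripleVar N) ℂ) (MvPolynomial (TripleVar N) ℂ) where
  toFun Y := tripleDer Y (-Y) 0
  map_add' Y Z := by
    rw [tripleDer, tripleDer, tripleDer, ← linDer_add, ← tripleMat_add, neg_add, add_zero]
  map_smul' c Y := by
    rw [tripleDer, tripleDer, RingHom.id_apply, ← linDer_smul, ← tripleMat_smul, smul_neg,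
      smul_zero]

/-- The infinitesimal left multiplication of the parameter matrix by `Y`. -/
def paramDer (Y : Matrix (Fin N) (Fin N) ℂ) :
    Derivation ℂ (MvPolynomial (TripleVar N) ℂ) (MvPolynomial (TripleVar N) ℂ) :=
  tripleDer 0 0 Y

variable (μ : Measure (SUN N)) [IsProbabilityMeasure μ]

theorem haarFunctional_linSubst_param (R B : Matrix (Fin N) (Fin N) ℂ)
    (f : MvPolynomial (TripleVar N) ℂ) :
    haarFunctional μ B (linSubst (tripleMat 1 1 R) f) = haarFunctional μ (R * B) f := by
  change ∫ V : SUN N, _ ∂μ = ∫ V : SUN N, _ ∂μ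
  simp only [aeval_linSubst_tripleMat, Matrix.one_mul, Matrix.mul_one]

theorem haarFunctional_paramDer_eq_zero {f : MvPolynomial (TripleVar N) ℂ}
    (hf : ∀ B, haarFunctional μ B f = 0) (Y B : Matrix (Fin N) (Fin N) ℂ) :
    haarFunctional μ B (paramDer Y f) = 0 := by
  have h1 : ∀ i j : Fin N, HasDerivAt (fun t : ℝ => (1 + (t : ℂ) • Y) i j) (Y i j) 0 := by
    intro i j
    have h := ((hasDerivAt_id (0 : ℝ)).ofReal_comp.mul_const (Y i j)).const_add
      ((1 : Matrix (Fin N) (Fin N) ℂ) i j)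
    simpa using h
  have h0 : ∀ (M : Matrix (Fin N) (Fin N) ℂ) (i j : Fin N), HasDerivAt (fun _ : ℝ => M i j)
      ((0 : Matrix (Fin N) (Fin N) ℂ) i j) 0 := fun M i j => hasDerivAt_const _ _
  have h2 := hasDerivAt_linSubst (hasDerivAt_tripleMat (h0 1) (h0 1) h1)
    (by simp [tripleMat_one]) f (haarFunctional μ B)
  simp only [haarFunctional_linSubst_param, hf] at h2
  exact h2.unique (hasDerivAt_const _ _)

variable [μ.IsMulLeftInvariant]

theorem haarFunctional_linSubst_left (g : SUN N) (B : Matrix (Fin N) (Fin N) ℂ)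
    (f : MvPolynomial (TripleVar N) ℂ) :
    haarFunctional μ B (linSubst (tripleMat (sunMat g) (star (sunMat g)) 1) f) =
      haarFunctional μ B f := by
  change ∫ V : SUN N, _ ∂μ = ∫ V : SUN N, _ ∂μ
  rw [← integral_mul_left_eq_self
    (fun V : SUN N => aeval (triplePoint (sunMat V) (star (sunMat V)) B) f) g]
  simp only [aeval_linSubst_tripleMat, Matrix.one_mul, sunMat_mul, star_mul]

theorem haarFunctional_leftDer_of_isHermitian {H : Matrix (Fin N) (Fin N) ℂ} (hH : H.IsHermitian)
    (htr : H.trace = 0) (B : Matrix (Fin N) (Fin N) ℂ) (f : MvPolynomial (TripleVar N) ℂ) :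
    haarFunctional μ B (leftDer H f) = 0 := by
  let W : Matrix (Fin N) (Fin N) ℂ := hH.eigenvectorUnitary
  let θ := hH.eigenvalues
  let d : ℝ → Matrix (Fin N) (Fin N) ℂ := fun t =>
    Matrix.diagonal fun k => Complex.exp ((t : ℂ) * (Complex.I * θ k))
  have hW : W * star W = 1 := Matrix.mem_unitaryGroup_iff.1 hH.eigenvectorUnitary.2
  have hW' : star W * W = 1 := Matrix.mem_unitaryGroup_iff'.1 hH.eigenvectorUnitary.2
  have hHW : H = W * Matrix.diagonal (fun k => (θ k : ℂ)) * star W := by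
    conv_lhs => rw [hH.spectral_theorem]
    rfl
  have hsum : ∑ k, (θ k : ℂ) = 0 := by
    rw [← htr, hH.trace_eq_sum_eigenvalues]
    rfl
  have hd : ∀ t, d t * star (d t) = 1 := by
    intro t
    simp only [d, Matrix.star_eq_conjTranspose, Matrix.diagonal_conjTranspose,
      Matrix.diagonal_mul_diagonal]
    rw [← Matrix.diagonal_one]
    congr 1
    ext k
    simp only [Pi.star_apply, RCLike.star_def]
    rw [← Complex.exp_conj, ← Complex.exp_add]
    simp
  have hu : ∀ t, W * d t * star W ∈ Matrix.unitaryGroup (Fin N) ℂ := by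
    intro t
    rw [Matrix.mem_unitaryGroup_iff, star_mul, star_mul, star_star]
    calc W * d t * star W * (W * (star (d t) * star W))
        = W * d t * (star W * W) * (star (d t) * star W) := by simp only [Matrix.mul_assoc]
      _ = W * (d t * star (d t)) * star W := by
        rw [hW', Matrix.mul_one]; simp only [Matrix.mul_assoc]
      _ = 1 := by rw [hd, Matrix.mul_one, hW]
  have hdet : ∀ t, (W * d t * star W).det = 1 := by
    intro t
    rw [Matrix.det_mul, Matrix.det_mul, mul_right_comm, ← Matrix.det_mul, hW, Matrix.det_one,
      one_mul, Matrix.det_diagonal, ← Complex.exp_sum, ← Finset.mul_sum, ← Finset.mul_sum, hsum]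
    simp
  have hderiv : ∀ i j, HasDerivAt (fun t : ℝ => (W * d t * star W) i j)
      ((Complex.I • H) i j) 0 := by
    intro i j
    have h1 : ∀ D : Fin N → ℂ, (W * Matrix.diagonal D * star W) i j =
        ∑ k, W i k * D k * star W k j := by
      intro D
      rw [Matrix.mul_apply]
      simp only [Matrix.mul_diagonal]
    have h2 : (Complex.I • H) i j = ∑ k, W i k * (Complex.I * θ k) * star W k j := by
      rw [Matrix.smul_apply, hHW, h1, Finset.smul_sum]
      refine Finset.sum_congr rfl fun k _ => ?_
      rw [smul_eq_mul]; ring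
    rw [h2]
    simp only [d, h1]
    refine HasDerivAt.fun_sum fun k _ => ?_
    have h3 : HasDerivAt (fun t : ℝ => Complex.exp ((t : ℂ) * (Complex.I * θ k)))
        (Complex.I * θ k) 0 := by
      have h4 := ((hasDerivAt_id (0 : ℝ)).ofReal_comp.mul_const (Complex.I * (θ k : ℂ))).cexp
      simpa using h4
    exact (h3.const_mul _).mul_const _
  have hderiv' : ∀ i j, HasDerivAt (fun t : ℝ => star (W * d t * star W) i j)
      ((-(Complex.I • H)) i j) 0 := by
    intro i j
    have h1 := (hderiv j i).star
    have h2 : (-(Complex.I • H)) i j = star ((Complex.I • H) j i) := by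
      have : star (H j i) = H i j := hH.apply i j
      simp [← this]
    rw [h2]
    exact h1
  have h0 : W * d 0 * star W = 1 := by
    simp [d, hW]
  have key := hasDerivAt_linSubst
    (M := fun t => tripleMat (W * d t * star W) (star (W * d t * star W)) 1)
    (hasDerivAt_tripleMat (R' := 0) (R := fun _ => 1) hderiv hderiv'
      (fun _ _ => hasDerivAt_const _ _))
    (by simp only [h0, star_one, tripleMat_one]) f (haarFunctional μ B)
  have hconst : ∀ t, haarFunctional μ B (linSubst (tripleMat (W * d t * star W)
      (star (W * d t * star W)) 1) f) = haarFunctional μ B f := fun t =>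
    haarFunctional_linSubst_left μ (sunMk _ (hu t) (hdet t)) B f
  simp only [hconst] at key
  have h5 : haarFunctional μ B (leftDer (Complex.I • H) f) = 0 :=
    key.unique (hasDerivAt_const _ _)
  rw [map_smul, Derivation.smul_apply, map_smul, smul_eq_mul] at h5
  exact (mul_eq_zero.1 h5).resolve_left Complex.I_ne_zero

/-- Infinitesimal invariance of the Haar integral, for functions annihilated by the
infinitesimal scaling. -/
theorem haarFunctional_leftDer (Y B : Matrix (Fin N) (Fin N) ℂ)
    {f : MvPolynomial (TripleVar N) ℂ} (hf : leftDer (1 : Matrix (Fin N) (Fin N) ℂ) f = 0) :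
    haarFunctional μ B (leftDer Y f) = 0 := by
  have h1 : ∀ H : Matrix (Fin N) (Fin N) ℂ, H.IsHermitian →
      haarFunctional μ B (leftDer H f) = 0 := by
    intro H hH
    rcases Nat.eq_zero_or_pos N with rfl | hN
    · exact haarFunctional_leftDer_of_isHermitian μ hH (by simp [Matrix.trace]) B f
    have hN' : (N : ℂ) ≠ 0 := by exact_mod_cast hN.ne'
    have htr : star H.trace = H.trace := by
      rw [← Matrix.trace_conjTranspose, hH.eq]
    have hH' : (H - (H.trace / N) • (1 : Matrix (Fin N) (Fin N) ℂ)).IsHermitian := by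
      unfold Matrix.IsHermitian
      rw [Matrix.conjTranspose_sub, hH.eq, Matrix.conjTranspose_smul, Matrix.conjTranspose_one,
        star_div₀, htr]
      simp
    have h := haarFunctional_leftDer_of_isHermitian μ hH' (by simp [hN']) B f
    rwa [map_sub, map_smul, Derivation.sub_apply, Derivation.smul_apply, hf, smul_zero,
      sub_zero] at h
  have h2 := realPart_add_I_smul_imaginaryPart Y
  rw [← h2, map_add, map_smul, Derivation.add_apply, Derivation.smul_apply, map_add, map_smul,
    h1 _ (realPart Y).2, h1 _ (imaginaryPart Y).2, smul_zero, add_zero]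

end Invariance

/-- If a sum of eigenvectors modulo `S` with distinct eigenvalues vanishes modulo `S`, then all
summands vanish modulo `S`. -/
theorem Submodule.mem_of_sum_mem_of_sub_smul_mem {V ι : Type*} [AddCommGroup V] [Module ℂ V]
    (S : Submodule ℂ V) (T : V →ₗ[ℂ] V) (hT : ∀ x ∈ S, T x ∈ S) {c : ι → ℂ}
    (hc : Function.Injective c) (s : Finset ι) {f : ι → V} (hf : ∀ i ∈ s, T (f i) - c i • f i ∈ S)
    (hsum : ∑ i ∈ s, f i ∈ S) : ∀ i ∈ s, f i ∈ S := by
  induction s using Finset.induction_on generalizing f with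
  | empty => simp
  | insert a s ha ih =>
    have h1 : ∑ i ∈ s, (c i - c a) • f i ∈ S := by
      have h2 : T (∑ i ∈ insert a s, f i) - c a • ∑ i ∈ insert a s, f i -
          ∑ i ∈ insert a s, (T (f i) - c i • f i) ∈ S :=
        S.sub_mem (S.sub_mem (hT _ hsum) (S.smul_mem _ hsum)) (S.sum_mem hf)
      have h3 : T (∑ i ∈ insert a s, f i) - c a • ∑ i ∈ insert a s, f i -
          ∑ i ∈ insert a s, (T (f i) - c i • f i) = ∑ i ∈ s, (c i - c a) • f i := by
        rw [map_sum, Finset.smul_sum, ← Finset.sum_sub_distrib, ← Finset.sum_sub_distrib,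
          Finset.sum_insert ha]
        have : T (f a) - c a • f a - (T (f a) - c a • f a) = 0 := sub_self _
        rw [this, zero_add]
        exact Finset.sum_congr rfl fun i _ => by rw [sub_smul]; abel
      rwa [h3] at h2
    have h4 : ∀ i ∈ s, f i ∈ S := by
      intro i hi
      have h5 := ih (f := fun i => (c i - c a) • f i) (fun i hi => by
        rw [map_smul, smul_comm, ← smul_sub]
        exact S.smul_mem _ (hf i (Finset.mem_insert_of_mem hi))) h1 i hi
      refine (S.smul_mem_iff ?_).1 h5
      rw [sub_ne_zero]
      exact fun h => ha (hc h ▸ hi)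
    intro i hi
    rcases Finset.mem_insert.1 hi with rfl | hi
    · rw [Finset.sum_insert ha] at hsum
      exact (S.add_mem_iff_left (S.sum_mem h4)).1 hsum
    · exact h4 i hi

section CharacterIntegral

open MvPolynomial

variable {N : ℕ}

/-- A constant matrix, as a matrix over the polynomial ring. -/
def constMat (Y : Matrix (Fin N) (Fin N) ℂ) :
    Matrix (Fin N) (Fin N) (MvPolynomial (TripleVar N) ℂ) :=
  Matrix.of fun i j => C (Y i j)

theorem constMat_apply (Y : Matrix (Fin N) (Fin N) ℂ) (a b : Fin N) : constMat Y a b = C (Y a b) :=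
  rfl

theorem constMat_one : constMat (1 : Matrix (Fin N) (Fin N) ℂ) = 1 := by
  ext1 a b
  by_cases h : a = b <;> simp [constMat, Matrix.one_apply, h]

theorem derivation_mul_constMat (D : Derivation ℂ (MvPolynomial (TripleVar N) ℂ)
    (MvPolynomial (TripleVar N) ℂ)) (P : Matrix (Fin N) (Fin N) (MvPolynomial (TripleVar N) ℂ))
    (Y : Matrix (Fin N) (Fin N) ℂ) (a b : Fin N) :
    D ((P * constMat Y) a b) = (Matrix.of (fun i j => D (P i j)) * constMat Y) a b := by
  simp [Matrix.mul_apply, constMat_apply, Derivation.leibniz, mul_comm]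

theorem derivation_constMat_mul (D : Derivation ℂ (MvPolynomial (TripleVar N) ℂ)
    (MvPolynomial (TripleVar N) ℂ)) (P : Matrix (Fin N) (Fin N) (MvPolynomial (TripleVar N) ℂ))
    (Y : Matrix (Fin N) (Fin N) ℂ) (a b : Fin N) :
    D ((constMat Y * P) a b) = (constMat Y * Matrix.of (fun i j => D (P i j))) a b := by
  simp [Matrix.mul_apply, constMat_apply, Derivation.leibniz]

theorem leftDer_varMat_zero (Y : Matrix (Fin N) (Fin N) ℂ) (a b : Fin N) :
    leftDer Y (varMat N 0 a b) = (constMat Y * varMat N 0) a b := by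
  change tripleDer _ _ _ (X ((a, b), 0)) = _
  rw [tripleDer_X, Matrix.mul_apply]
  rfl

theorem leftDer_varMat_one (Y : Matrix (Fin N) (Fin N) ℂ) (a b : Fin N) :
    leftDer Y (varMat N 1 a b) = -(varMat N 1 * constMat Y) a b := by
  change tripleDer _ _ _ (X ((a, b), 1)) = _
  rw [tripleDer_X, Matrix.mul_apply, ← Finset.sum_neg_distrib]
  change ∑ c : Fin N, _ = _
  simp [constMat_apply]

theorem leftDer_varMat_two (Y : Matrix (Fin N) (Fin N) ℂ) (a b : Fin N) :
    leftDer Y (varMat N 2 a b) = 0 := by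
  change tripleDer _ _ _ (X ((a, b), 2)) = _
  rw [tripleDer_X]
  change ∑ c : Fin N, _ = _
  simp

theorem paramDer_varMat_zero (Y : Matrix (Fin N) (Fin N) ℂ) (a b : Fin N) :
    paramDer Y (varMat N 0 a b) = 0 := by
  change tripleDer _ _ _ (X ((a, b), 0)) = _
  rw [tripleDer_X]
  change ∑ c : Fin N, _ = _
  simp

theorem paramDer_varMat_one (Y : Matrix (Fin N) (Fin N) ℂ) (a b : Fin N) :
    paramDer Y (varMat N 1 a b) = 0 := by
  change tripleDer _ _ _ (X ((a, b), 1)) = _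
  rw [tripleDer_X]
  change ∑ c : Fin N, _ = _
  simp

theorem paramDer_varMat_two (Y : Matrix (Fin N) (Fin N) ℂ) (a b : Fin N) :
    paramDer Y (varMat N 2 a b) = (constMat Y * varMat N 2) a b := by
  change tripleDer _ _ _ (X ((a, b), 2)) = _
  rw [tripleDer_X, Matrix.mul_apply]
  rfl

theorem tripleVar_derivation_ext {D D' : Derivation ℂ (MvPolynomial (TripleVar N) ℂ)
    (MvPolynomial (TripleVar N) ℂ)} (h0 : ∀ a b, D (varMat N 0 a b) = D' (varMat N 0 a b))
    (h1 : ∀ a b, D (varMat N 1 a b) = D' (varMat N 1 a b))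
    (h2 : ∀ a b, D (varMat N 2 a b) = D' (varMat N 2 a b)) : D = D' := by
  apply MvPolynomial.derivation_ext
  rintro ⟨⟨a, b⟩, k⟩
  fin_cases k
  · exact h0 a b
  · exact h1 a b
  · exact h2 a b

theorem leftDer_comm_one (Y : Matrix (Fin N) (Fin N) ℂ) (f : MvPolynomial (TripleVar N) ℂ) :
    leftDer (1 : Matrix (Fin N) (Fin N) ℂ) (leftDer Y f) =
      leftDer Y (leftDer (1 : Matrix (Fin N) (Fin N) ℂ) f) := by
  have h : ⁅leftDer (1 : Matrix (Fin N) (Fin N) ℂ), leftDer Y⁆ = 0 := by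
    apply tripleVar_derivation_ext <;> intro a b <;> rw [Derivation.commutator_apply]
    · simp only [leftDer_varMat_zero, constMat_one, derivation_constMat_mul, Matrix.one_mul]
      exact sub_self _
    · simp only [leftDer_varMat_one, constMat_one, derivation_mul_constMat, Matrix.mul_one,
        map_neg]
      simp [Matrix.mul_apply]
    · simp [leftDer_varMat_two]
  have h' := congrArg (fun D => D f) h
  simp only [Derivation.commutator_apply, Derivation.zero_apply] at h'
  exact sub_eq_zero.1 h'

theorem paramDer_leftDer_comm (Y Z : Matrix (Fin N) (Fin N) ℂ) (f : MvPolynomial (TripleVar N) ℂ) :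
    paramDer Y (leftDer Z f) = leftDer Z (paramDer Y f) := by
  have h : ⁅paramDer Y, leftDer Z⁆ = 0 := by
    apply tripleVar_derivation_ext <;> intro a b <;> rw [Derivation.commutator_apply]
    · simp [leftDer_varMat_zero, constMat_apply, paramDer_varMat_zero, Matrix.mul_apply]
    · simp [leftDer_varMat_one, constMat_apply, paramDer_varMat_one, Matrix.mul_apply]
    · simp [leftDer_varMat_two, constMat_apply, paramDer_varMat_two, Matrix.mul_apply]
  have h' := congrArg (fun D => D f) h
  simp only [Derivation.commutator_apply, Derivation.zero_apply] at h'
  exact sub_eq_zero.1 h'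

theorem constMat_single_mul (i j : Fin N)
    (M : Matrix (Fin N) (Fin N) (MvPolynomial (TripleVar N) ℂ))
    (a b : Fin N) : (constMat (Matrix.single i j (1 : ℂ)) * M) a b =
      if a = i then M j b else 0 := by
  rw [Matrix.mul_apply, Finset.sum_eq_single j]
  · by_cases h : a = i
    · simp [constMat, h]
    · simp [constMat, h, Ne.symm h]
  · intro c _ hc
    simp [constMat, Ne.symm hc]
  · simp

/-- The generators of left translations. -/
def leftGen (N : ℕ) (i j : Fin N) : Derivation ℂ (MvPolynomial (TripleVar N) ℂ)
    (MvPolynomial (TripleVar N) ℂ) := leftDer (Matrix.single i j 1)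

/-- The generators of left translations of the parameter. -/
def paramGen (N : ℕ) (i j : Fin N) : Derivation ℂ (MvPolynomial (TripleVar N) ℂ)
    (MvPolynomial (TripleVar N) ℂ) := paramDer (Matrix.single i j 1)

theorem isLeftAction_leftGen (A : Matrix (Fin N) (Fin N) ℂ) :
    IsLeftAction (leftGen N) (varMat N 0 * constMat A) := by
  intro i j a b
  rw [Matrix.mul_apply, map_sum]
  simp only [Derivation.leibniz, constMat_apply, MvPolynomial.derivation_C, smul_zero, zero_add,
    leftGen, leftDer_varMat_zero, constMat_single_mul]
  split_ifs with h
  · rw [Matrix.mul_apply]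
    exact Finset.sum_congr rfl fun c _ => by rw [smul_eq_mul, mul_comm, constMat_apply]
  · simp

theorem isLeftAction_paramGen (A : Matrix (Fin N) (Fin N) ℂ) :
    IsLeftAction (paramGen N) (varMat N 2 * constMat A) := by
  intro i j a b
  rw [Matrix.mul_apply, map_sum]
  simp only [Derivation.leibniz, constMat_apply, MvPolynomial.derivation_C, smul_zero, zero_add,
    paramGen, paramDer_varMat_two, constMat_single_mul]
  split_ifs with h
  · rw [Matrix.mul_apply]
    exact Finset.sum_congr rfl fun c _ => by rw [smul_eq_mul, mul_comm, constMat_apply]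
  · simp

theorem sum_leftGen : ∑ i, leftGen N i i = leftDer 1 := by
  simp only [leftGen]
  rw [← map_sum]
  congr 1
  ext a b
  rw [Matrix.sum_apply]
  by_cases h : a = b
  · subst h; simp [Matrix.single_apply]
  · rw [Matrix.one_apply_ne h]
    refine Finset.sum_eq_zero fun i _ => ?_
    rw [Matrix.single_apply, if_neg]
    rintro ⟨rfl, rfl⟩
    exact h rfl

/-- The trace of `U† B` as a polynomial. -/
def pairTrace (N : ℕ) : MvPolynomial (TripleVar N) ℂ := (varMat N 1 * varMat N 2).trace

/-- The polynomial `Tr(U† B) ^ m / m!`. -/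
def pairPow (N m : ℕ) : MvPolynomial (TripleVar N) ℂ := (m.factorial : ℂ)⁻¹ • pairTrace N ^ m

/-- The Schur polynomial of `U A`. -/
def charLeft (A : Matrix (Fin N) (Fin N) ℂ) (l : Fin N → ℕ) : MvPolynomial (TripleVar N) ℂ :=
  jacobiTrudi (psumMat (varMat N 0 * constMat A)) l

/-- The Schur polynomial of `B A`. -/
def charParam (A : Matrix (Fin N) (Fin N) ℂ) (l : Fin N → ℕ) : MvPolynomial (TripleVar N) ℂ :=
  jacobiTrudi (psumMat (varMat N 2 * constMat A)) l

theorem leftDer_pairTrace (Y : Matrix (Fin N) (Fin N) ℂ) :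
    leftDer Y (pairTrace N) = -(varMat N 1 * constMat Y * varMat N 2).trace := by
  simp only [pairTrace, Matrix.trace, Matrix.diag_apply, Matrix.mul_apply (M := varMat N 1),
    Matrix.mul_apply (M := varMat N 1 * constMat Y), map_sum,
    Derivation.leibniz, leftDer_varMat_one, leftDer_varMat_two, smul_zero, zero_add,
    ← Finset.sum_neg_distrib]
  refine Finset.sum_congr rfl fun a _ => Finset.sum_congr rfl fun b _ => ?_
  rw [Finset.sum_neg_distrib, smul_eq_mul]; ring

theorem paramDer_pairTrace (Y : Matrix (Fin N) (Fin N) ℂ) :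
    paramDer Y (pairTrace N) = (varMat N 1 * constMat Y * varMat N 2).trace := by
  rw [Matrix.mul_assoc]
  simp only [pairTrace, Matrix.trace, Matrix.diag_apply, Matrix.mul_apply (M := varMat N 1),
    map_sum,
    Derivation.leibniz, paramDer_varMat_one, paramDer_varMat_two, smul_eq_mul, mul_zero, add_zero]

theorem derivation_pairPow_succ (D : Derivation ℂ (MvPolynomial (TripleVar N) ℂ)
    (MvPolynomial (TripleVar N) ℂ)) (m : ℕ) :
    D (pairPow N (m + 1)) = D (pairTrace N) * pairPow N m := by
  have h : (((m + 1).factorial : ℕ) : ℂ)⁻¹ * ((m + 1 : ℕ) : ℂ) = ((m.factorial : ℕ) : ℂ)⁻¹ := by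
    rw [Nat.factorial_succ]
    push_cast
    field_simp
  rw [pairPow, pairPow, Derivation.map_smul, Derivation.leibniz_pow, ← Nat.cast_smul_eq_nsmul ℂ,
    smul_smul, h, Nat.add_sub_cancel, smul_eq_mul, mul_smul_comm, mul_comm]

theorem derivation_pairPow_zero (D : Derivation ℂ (MvPolynomial (TripleVar N) ℂ)
    (MvPolynomial (TripleVar N) ℂ)) : D (pairPow N 0) = 0 := by
  simp [pairPow]

theorem paramDer_pairPow (Y : Matrix (Fin N) (Fin N) ℂ) (m : ℕ) :
    paramDer Y (pairPow N m) = -leftDer Y (pairPow N m) := by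
  cases m with
  | zero => simp only [derivation_pairPow_zero, neg_zero]
  | succ m => simp only [derivation_pairPow_succ, paramDer_pairTrace, leftDer_pairTrace, neg_mul,
      neg_neg]

theorem leftDer_one_pairPow (m : ℕ) :
    leftDer (1 : Matrix (Fin N) (Fin N) ℂ) (pairPow N m) = (-(m : ℂ)) • pairPow N m := by
  have h : leftDer (1 : Matrix (Fin N) (Fin N) ℂ) (pairTrace N) = -pairTrace N := by
    rw [leftDer_pairTrace, constMat_one, Matrix.mul_one, pairTrace]
  rw [pairPow, Derivation.map_smul, Derivation.leibniz_pow, h, smul_comm (-(m : ℂ)), neg_smul,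
    Nat.cast_smul_eq_nsmul]
  cases m with
  | zero => simp
  | succ m => rw [Nat.add_sub_cancel, smul_eq_mul, mul_neg, smul_neg, pow_succ]

theorem leftDer_one_charLeft (A : Matrix (Fin N) (Fin N) ℂ) (l : Fin N → ℕ) :
    leftDer (1 : Matrix (Fin N) (Fin N) ℂ) (charLeft A l) = (wt l : ℂ) • charLeft A l := by
  have h := derivation_jacobiTrudi (leftDer (1 : Matrix (Fin N) (Fin N) ℂ)) (c := 1)
    (p := psumMat (varMat N 0 * constMat A))
    (fun m => by rw [← sum_leftGen]; exact (isLeftAction_leftGen A).sum_diag_psumMat m) l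
  rwa [one_mul] at h

theorem derivation_trace_pow_eq_zero {K : Type*} [CommRing K] [Algebra ℂ K] (D : Derivation ℂ K K)
    {X : Matrix (Fin N) (Fin N) K} (h : ∀ a b, D (X a b) = 0) (m : ℕ) (a b : Fin N) :
    D ((X ^ m) a b) = 0 := by
  induction m generalizing a b with
  | zero =>
    by_cases hab : a = b <;> simp [hab]
  | succ m ih =>
    rw [pow_succ, Matrix.mul_apply, map_sum]
    exact Finset.sum_eq_zero fun c _ => by rw [Derivation.leibniz, ih, h]; simp

theorem paramDer_charLeft (A Y : Matrix (Fin N) (Fin N) ℂ) (l : Fin N → ℕ) :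
    paramDer Y (charLeft A l) = 0 := by
  have h := derivation_jacobiTrudi (paramDer Y) (c := 0)
    (p := psumMat (varMat N 0 * constMat A)) (fun m => by
      rw [zero_mul, zero_smul, psumMat, Matrix.trace, map_sum]
      refine Finset.sum_eq_zero fun i _ => derivation_trace_pow_eq_zero _ (fun a b => ?_) _ _ _
      rw [derivation_mul_constMat]
      simp only [paramDer_varMat_zero]
      exact congrFun (congrFun (Matrix.zero_mul (constMat A)) a) b) l
  rwa [zero_mul, zero_smul] at h

theorem leftDer_one_mul {f g : MvPolynomial (TripleVar N) ℂ} {a b : ℂ}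
    (hf : leftDer (1 : Matrix (Fin N) (Fin N) ℂ) f = a • f)
    (hg : leftDer (1 : Matrix (Fin N) (Fin N) ℂ) g = b • g) :
    leftDer (1 : Matrix (Fin N) (Fin N) ℂ) (f * g) = (a + b) • (f * g) := by
  rw [Derivation.leibniz, hf, hg, smul_eq_mul, smul_eq_mul, mul_smul_comm, mul_smul_comm,
    mul_comm g f, add_smul, add_comm]

theorem leftDer_one_leftDer {f : MvPolynomial (TripleVar N) ℂ} {a : ℂ}
    (hf : leftDer (1 : Matrix (Fin N) (Fin N) ℂ) f = a • f) (Y : Matrix (Fin N) (Fin N) ℂ) :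
    leftDer (1 : Matrix (Fin N) (Fin N) ℂ) (leftDer Y f) = a • leftDer Y f := by
  rw [leftDer_comm_one, hf, Derivation.map_smul]

variable (μ : Measure (SUN N)) [IsProbabilityMeasure μ]

/-- The polynomials whose integral over `SU(N)` vanishes for all values of the parameter. -/
def haarNull : Submodule ℂ (MvPolynomial (TripleVar N) ℂ) :=
  ⨅ B, LinearMap.ker (haarFunctional μ B)

theorem mem_haarNull {f : MvPolynomial (TripleVar N) ℂ} :
    f ∈ haarNull μ ↔ ∀ B, haarFunctional μ B f = 0 := by
  simp [haarNull, Submodule.mem_iInf]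

theorem mem_haarNull_of_aeval_eq_zero {f : MvPolynomial (TripleVar N) ℂ}
    (hf : ∀ (V : SUN N) B, aeval (triplePoint (sunMat V) (star (sunMat V)) B) f = 0) :
    f ∈ haarNull μ := by
  rw [mem_haarNull]
  intro B
  change ∫ V : SUN N, _ ∂μ = 0
  simp only [hf, integral_zero]

theorem paramDer_mem_haarNull {f : MvPolynomial (TripleVar N) ℂ} (hf : f ∈ haarNull μ)
    (Y : Matrix (Fin N) (Fin N) ℂ) : paramDer Y f ∈ haarNull μ := by
  rw [mem_haarNull] at *
  exact haarFunctional_paramDer_eq_zero μ hf Y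

theorem map_varMat_aeval (U V B : Matrix (Fin N) (Fin N) ℂ) (k : Fin 3) :
    (varMat N k).map (aeval (triplePoint U V B) : MvPolynomial (TripleVar N) ℂ →ₐ[ℂ] ℂ) =
      ![U, V, B] k := by
  ext a b
  rw [Matrix.map_apply, varMat, Matrix.of_apply, aeval_X]
  rfl

theorem map_constMat_aeval (U V B A : Matrix (Fin N) (Fin N) ℂ) :
    (constMat A).map (aeval (triplePoint U V B) : MvPolynomial (TripleVar N) ℂ →ₐ[ℂ] ℂ) = A := by
  ext a b
  rw [Matrix.map_apply, constMat_apply, aeval_C]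
  rfl

theorem aeval_psumMat (w : TripleVar N → ℂ)
    (X : Matrix (Fin N) (Fin N) (MvPolynomial (TripleVar N) ℂ)) (m : ℕ) :
    aeval w (psumMat X m) =
      psumMat (X.map (aeval w : MvPolynomial (TripleVar N) ℂ →ₐ[ℂ] ℂ)) m :=
  map_psumMat (aeval w : MvPolynomial (TripleVar N) ℂ →ₐ[ℂ] ℂ).toRingHom X m

theorem aeval_psumMat_param (U V B A : Matrix (Fin N) (Fin N) ℂ) (m : ℕ) :
    aeval (triplePoint U V B) (psumMat (varMat N 2 * constMat A) m) = psumMat (B * A) m := by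
  rw [aeval_psumMat, Matrix.map_mul, map_varMat_aeval, map_constMat_aeval]
  rfl

theorem aeval_charParam (U V B A : Matrix (Fin N) (Fin N) ℂ) (l : Fin N → ℕ) :
    aeval (triplePoint U V B) (charParam A l) = schur l (B * A) := by
  rw [charParam, map_jacobiTrudi, schur_eq_jacobiTrudi]
  simp only [aeval_psumMat_param]

theorem aeval_charLeft (U V B A : Matrix (Fin N) (Fin N) ℂ) (l : Fin N → ℕ) :
    aeval (triplePoint U V B) (charLeft A l) = schur l (U * A) := by
  rw [charLeft, map_jacobiTrudi, schur_eq_jacobiTrudi]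
  congr 1
  ext m
  rw [aeval_psumMat, Matrix.map_mul, map_varMat_aeval, map_constMat_aeval]
  rfl

theorem aeval_pairTrace (U V B : Matrix (Fin N) (Fin N) ℂ) :
    aeval (triplePoint U V B) (pairTrace N) = (V * B).trace := by
  have h := aeval_psumMat (triplePoint U V B) (varMat N 1 * varMat N 2) 0
  rw [Matrix.map_mul, map_varMat_aeval, map_varMat_aeval] at h
  simpa [psumMat, pairTrace] using h

theorem aeval_pairPow (U V B : Matrix (Fin N) (Fin N) ℂ) (m : ℕ) :
    aeval (triplePoint U V B) (pairPow N m) = (V * B).trace ^ m / m.factorial := by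
  rw [pairPow, map_smul, map_pow, aeval_pairTrace, smul_eq_mul, div_eq_inv_mul]

theorem psum_param_mul_mem_haarNull {f : MvPolynomial (TripleVar N) ℂ} (hf : f ∈ haarNull μ)
    (A : Matrix (Fin N) (Fin N) ℂ) (m : ℕ) :
    psumMat (varMat N 2 * constMat A) m * f ∈ haarNull μ := by
  rw [mem_haarNull] at *
  intro B
  have h := hf B
  change ∫ V : SUN N, _ ∂μ = 0 at h
  change ∫ V : SUN N, _ ∂μ = 0
  simp only [map_mul, aeval_psumMat_param]
  rw [integral_const_mul, h, mul_zero]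

variable [μ.IsMulLeftInvariant]

theorem leftDer_mem_haarNull {f : MvPolynomial (TripleVar N) ℂ}
    (hf : leftDer (1 : Matrix (Fin N) (Fin N) ℂ) f = 0) (Y : Matrix (Fin N) (Fin N) ℂ) :
    leftDer Y f ∈ haarNull μ := by
  rw [mem_haarNull]
  exact fun B => haarFunctional_leftDer μ Y B hf

theorem leftDer_mul_mem_haarNull {f g : MvPolynomial (TripleVar N) ℂ} {a : ℂ}
    (hf : leftDer (1 : Matrix (Fin N) (Fin N) ℂ) f = a • f)
    (hg : leftDer (1 : Matrix (Fin N) (Fin N) ℂ) g = (-a) • g) (Y : Matrix (Fin N) (Fin N) ℂ) :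
    leftDer Y (f * g) ∈ haarNull μ := by
  apply leftDer_mem_haarNull
  rw [leftDer_one_mul hf hg, add_neg_cancel, zero_smul]

/-- The Casimir operator acting on the parameter preserves, up to null polynomials, the products
of Schur polynomials with powers of the pairing. -/
theorem casimir_paramGen_charLeft_mul_pairPow (A : Matrix (Fin N) (Fin N) ℂ) (l : Fin N → ℕ) :
    casimir (paramGen N) (charLeft A l * pairPow N (wt l)) -
      casimirEigenvalue l • (charLeft A l * pairPow N (wt l)) ∈ haarNull μ := by
  set s := charLeft A l with hs
  set h := pairPow N (wt l) with hh
  have hs1 : leftDer (1 : Matrix (Fin N) (Fin N) ℂ) s = (wt l : ℂ) • s := leftDer_one_charLeft A l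
  have hh1 : leftDer (1 : Matrix (Fin N) (Fin N) ℂ) h = (-(wt l : ℂ)) • h :=
    leftDer_one_pairPow (wt l)
  have h1 : casimir (leftGen N) s = casimirEigenvalue l • s := by
    rw [smul_eq_C_mul]
    exact casimir_jacobiTrudi (isLeftAction_leftGen A) l
  have h2 : ∀ i j, paramGen N i j (paramGen N j i (s * h)) =
      leftGen N j i (s * leftGen N i j h) - leftGen N i j (leftGen N j i s * h) +
        leftGen N i j (leftGen N j i s) * h := by
    intro i j
    have h3 : ∀ i j, paramGen N i j s = 0 := fun i j => paramDer_charLeft A _ l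
    have h4 : ∀ i j, paramGen N i j h = -leftGen N i j h := fun i j => paramDer_pairPow _ _
    have h5 : paramGen N i j (leftGen N j i h) = leftGen N j i (paramGen N i j h) :=
      paramDer_leftDer_comm _ _ _
    simp only [Derivation.leibniz, h3, h4, h5, smul_eq_mul, map_neg, mul_zero, add_zero]
    ring
  rw [← smul_mul_assoc, ← h1]
  unfold casimir
  simp only [h2, Finset.sum_add_distrib, ← Finset.sum_mul, add_sub_cancel_right]
  exact Submodule.sum_mem _ fun i _ => Submodule.sum_mem _ fun j _ => Submodule.sub_mem _
    (leftDer_mul_mem_haarNull μ hs1 (leftDer_one_leftDer hh1 _) _)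
    (leftDer_mul_mem_haarNull μ (leftDer_one_leftDer hs1 _) hh1 _)

theorem psumMat_zero_eq_trace {K : Type*} [CommRing K] (X : Matrix (Fin N) (Fin N) K) :
    psumMat X 0 = X.trace := by
  rw [psumMat, zero_add, pow_one]

theorem IsLeftAction.sum_sum_self {K : Type*} [CommRing K] [Algebra ℂ K]
    {E : Fin N → Fin N → Derivation ℂ K K} {X : Matrix (Fin N) (Fin N) K} (hE : IsLeftAction E X) :
    ∑ i, ∑ j, E i j (X i j) = N * X.trace := by
  have hE' : ∀ i j a b, E i j (X a b) = if a = i then X j b else 0 := hE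
  simp [hE', Matrix.trace]

/-- The Casimir operator as a linear map. -/
def casimirLinear {K : Type*} [CommRing K] [Algebra ℂ K]
    (E : Fin N → Fin N → Derivation ℂ K K) : K →ₗ[ℂ] K where
  toFun := casimir E
  map_add' := casimir_add
  map_smul' c f := by
    simp only [casimir, Derivation.map_smul, Finset.smul_sum, RingHom.id_apply]

theorem sum_smul_jacobiTrudi_update {τ : Type*}
    {E : Fin N → Fin N → Derivation ℂ (MvPolynomial τ ℂ) (MvPolynomial τ ℂ)}
    {Y : Matrix (Fin N) (Fin N) (MvPolynomial τ ℂ)} (hE : IsLeftAction E Y) (l : Fin N → ℕ) :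
    ∑ i, ∑ j, E i j (jacobiTrudi (psumMat Y) l) * Y i j + N * Y.trace * jacobiTrudi (psumMat Y) l =
      ∑ k, ((shiftedPart l k : ℂ) + 1) •
        jacobiTrudi (psumMat Y) (Function.update l k (l k + 1)) := by
  have hp := pieri_psum Y l
  rw [psumMat_zero_eq_trace] at hp
  have h1 : casimir E Y.trace = N * Y.trace := by
    simpa using hE.casimir_trace 1
  have h2 : ∀ i j, E i j Y.trace = Y j i := by
    intro i j
    simpa using hE.apply_trace i j 1
  have h3 := congrArg (casimir E) hp
  rw [casimir_mul, casimir_jacobiTrudi hE, h1, casimirForm_comm] at h3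
  have h4 : casimir E (∑ k, jacobiTrudi (psumMat Y) (Function.update l k (l k + 1))) =
      ∑ k, casimirEigenvalue (Function.update l k (l k + 1)) •
        jacobiTrudi (psumMat Y) (Function.update l k (l k + 1)) := by
    change casimirLinear E _ = _
    rw [map_sum]
    refine Finset.sum_congr rfl fun k _ => ?_
    rw [smul_eq_C_mul]
    exact casimir_jacobiTrudi hE _
  have h5 : ∀ k, casimirEigenvalue (Function.update l k (l k + 1)) =
      2 * ((shiftedPart l k : ℂ) + 1) + (casimirEigenvalue l - N) := fun k => by
    linear_combination casimirEigenvalue_update_succ l k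
  rw [h4] at h3
  simp only [h5, add_smul, Finset.sum_add_distrib, mul_smul, ← Finset.smul_sum, hp] at h3
  simp only [casimirForm, h2] at h3
  rw [smul_eq_C_mul _ (2 : ℂ), smul_eq_C_mul _ (casimirEigenvalue l - N), map_sub] at h3
  simp only [map_ofNat, map_natCast] at h3
  have h6 : (2 : MvPolynomial τ ℂ) ≠ 0 := two_ne_zero
  refine mul_left_cancel₀ h6 ?_
  simp only [add_smul, Finset.sum_add_distrib, ← Finset.smul_sum, hp]
  linear_combination -h3

variable (μ : Measure (SUN N)) [IsProbabilityMeasure μ] [μ.IsMulLeftInvariant]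

theorem sum_smul_charLeft_update_mem_haarNull (A : Matrix (Fin N) (Fin N) ℂ) (l : Fin N → ℕ) :
    ∑ k, ((shiftedPart l k : ℂ) + 1) •
        (charLeft A (Function.update l k (l k + 1)) * pairPow N (wt l + 1)) -
      psumMat (varMat N 2 * constMat A) 0 * (charLeft A l * pairPow N (wt l)) ∈ haarNull μ := by
  set X : Matrix (Fin N) (Fin N) (MvPolynomial (TripleVar N) ℂ) := varMat N 0 * constMat A with hX
  have hE : IsLeftAction (leftGen N) X := isLeftAction_leftGen A
  have hX1 : ∀ a b, leftDer (1 : Matrix (Fin N) (Fin N) ℂ) (X a b) = (1 : ℂ) • X a b := by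
    intro a b
    rw [hX, derivation_mul_constMat, one_smul]
    simp only [leftDer_varMat_zero, constMat_one, Matrix.one_mul]
    rfl
  have h1 : ∑ i, ∑ j, leftGen N i j (charLeft A l * X i j * pairPow N (wt l + 1)) ∈ haarNull μ := by
    refine Submodule.sum_mem _ fun i _ => Submodule.sum_mem _ fun j _ => ?_
    refine leftDer_mul_mem_haarNull μ (leftDer_one_mul (leftDer_one_charLeft A l) (hX1 i j)) ?_ _
    rw [leftDer_one_pairPow]
    push_cast
    rfl
  have h2 : ∀ i j, leftGen N i j (pairTrace N) = -(varMat N 2 * varMat N 1) j i := by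
    intro i j
    rw [leftGen, leftDer_pairTrace, Matrix.mul_assoc, Matrix.trace_mul_comm, Matrix.mul_assoc,
      Matrix.trace]
    simp only [Matrix.diag_apply, constMat_single_mul]
    simp
  have h3 : ∑ i, ∑ j, leftGen N i j (charLeft A l * X i j * pairPow N (wt l + 1)) =
      ∑ k, ((shiftedPart l k : ℂ) + 1) •
        (charLeft A (Function.update l k (l k + 1)) * pairPow N (wt l + 1)) -
      (X * (varMat N 2 * varMat N 1)).trace * (charLeft A l * pairPow N (wt l)) := by
    have h4 := sum_smul_jacobiTrudi_update hE l
    simp only [← smul_mul_assoc]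
    rw [← Finset.sum_mul]
    change _ = (∑ k, ((shiftedPart l k : ℂ) + 1) •
      jacobiTrudi (psumMat X) (Function.update l k (l k + 1))) * _ - _
    rw [← h4, ← hE.sum_sum_self]
    simp only [Derivation.leibniz, derivation_pairPow_succ, h2, smul_eq_mul, Matrix.trace,
      Matrix.diag_apply, Matrix.mul_apply (M := X), add_mul, Finset.sum_mul,
      ← Finset.sum_add_distrib,
      ← Finset.sum_sub_distrib]
    refine Finset.sum_congr rfl fun i _ => Finset.sum_congr rfl fun j _ => ?_
    change _ = leftGen N i j (charLeft A l) * _ * _ + _ * charLeft A l * _ - _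
    ring
  rw [h3] at h1
  have h5 : (X * (varMat N 2 * varMat N 1)).trace * (charLeft A l * pairPow N (wt l)) -
      psumMat (varMat N 2 * constMat A) 0 * (charLeft A l * pairPow N (wt l)) ∈ haarNull μ := by
    apply mem_haarNull_of_aeval_eq_zero
    intro V B
    rw [← sub_mul, map_mul, map_sub, aeval_psumMat_param, ← psumMat_zero_eq_trace,
      aeval_psumMat, hX]
    simp only [Matrix.map_mul, map_varMat_aeval, map_constMat_aeval]
    change (psumMat (sunMat V * A * (B * star (sunMat V))) 0 - _) * _ = 0
    rw [psumMat_zero_eq_trace, psumMat_zero_eq_trace, Matrix.trace_mul_comm, Matrix.mul_assoc,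
      ← Matrix.mul_assoc (star (sunMat V)), star_sunMat_mul, Matrix.one_mul, sub_self, zero_mul]
  have h6 := Submodule.add_mem _ h1 h5
  rwa [sub_add_sub_cancel] at h6

/-- Induction on the size of a partition by adding boxes. -/
theorem antitone_induction {P : (Fin N → ℕ) → Prop} (h0 : P fun _ => 0)
    (hs : ∀ l, Antitone l → P l → ∀ i, Antitone (Function.update l i (l i + 1)) →
      P (Function.update l i (l i + 1))) (l : Fin N → ℕ) (hl : Antitone l) : P l := by
  induction hn : wt l generalizing l with
  | zero =>
    have : l = fun _ => 0 := by
      ext i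
      exact (Finset.sum_eq_zero_iff.1 hn) i (Finset.mem_univ i)
    rw [this]
    exact h0
  | succ n ih =>
    have hne : (Finset.univ.filter fun i => l i ≠ 0).Nonempty := by
      by_contra hcon
      rw [Finset.not_nonempty_iff_eq_empty, Finset.filter_eq_empty_iff] at hcon
      have : wt l = 0 := Finset.sum_eq_zero fun i hi => not_not.1 (hcon hi)
      omega
    set i := (Finset.univ.filter fun i => l i ≠ 0).max' hne with hi
    have hi0 : l i ≠ 0 := (Finset.mem_filter.1 (Finset.max'_mem _ hne)).2
    have hlast : ∀ j, i < j → l j = 0 := by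
      intro j hj
      by_contra hcon
      exact absurd (Finset.le_max' _ j (Finset.mem_filter.2 ⟨Finset.mem_univ j, hcon⟩))
        (not_le.2 hj)
    set k := Function.update l i (l i - 1) with hk
    have hki : k i = l i - 1 := Function.update_self ..
    have hkj : ∀ j, j ≠ i → k j = l j := fun j hj => Function.update_of_ne hj ..
    have hupd : Function.update k i (k i + 1) = l := by
      rw [hki, hk, Function.update_idem, Nat.sub_add_cancel (Nat.one_le_iff_ne_zero.2 hi0),
        Function.update_eq_self]
    have hka : Antitone k := by
      intro a b hab
      by_cases hb : b = i
      · by_cases ha : a = i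
        · rw [ha, hb]
        · rw [hb, hki, hkj a ha]
          exact (Nat.sub_le _ _).trans (hl (hb ▸ hab))
      · by_cases ha : a = i
        · rw [hkj b hb, hlast b (lt_of_le_of_ne (ha ▸ hab) (Ne.symm hb))]
          exact Nat.zero_le _
        · rw [hkj a ha, hkj b hb]
          exact hl hab
    have hw : wt k = n := by
      have := wt_update_succ k i
      rw [hupd] at this
      omega
    rw [← hupd]
    exact hs k hka (ih k hka hw) i (by rwa [hupd])

theorem charLeft_mul_pairPow_sub_mem_haarNull (A : Matrix (Fin N) (Fin N) ℂ) (l : Fin N → ℕ)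
    (hl : Antitone l) :
    charLeft A l * pairPow N (wt l) - schurRatio l • charParam A l ∈ haarNull μ := by
  refine antitone_induction (P := fun l => charLeft A l * pairPow N (wt l) -
    schurRatio l • charParam A l ∈ haarNull μ) ?_ (fun l hl ih i _ => ?_) l hl
  · have h1 : wt (fun _ : Fin N => 0) = 0 := by simp [wt]
    rw [h1, charLeft, charParam, jacobiTrudi_zero, jacobiTrudi_zero, pairPow]
    simp [schurRatio_zero]
  · have hinj : Function.Injective fun k => casimirEigenvalue (Function.update l k (l k + 1)) := by
      intro a b hab
      have h1 := casimirEigenvalue_update_succ l a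
      have h2 := casimirEigenvalue_update_succ l b
      apply shiftedPart_injective hl
      have h3 : (2 : ℂ) * (shiftedPart l a : ℂ) = 2 * (shiftedPart l b : ℂ) := by
        simp only at hab
        linear_combination hab - h1 + h2
      exact_mod_cast mul_left_cancel₀ two_ne_zero h3
    have h1 := Submodule.mem_of_sum_mem_of_sub_smul_mem (haarNull μ) (casimirLinear (paramGen N))
      (fun f hf => by
        change ∑ i, ∑ j, paramGen N i j (paramGen N j i f) ∈ haarNull μ
        exact Submodule.sum_mem _ fun i _ => Submodule.sum_mem _ fun j _ =>
          paramDer_mem_haarNull μ (paramDer_mem_haarNull μ hf _) _) hinj Finset.univ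
      (f := fun k => ((shiftedPart l k : ℂ) + 1) •
        (charLeft A (Function.update l k (l k + 1)) * pairPow N (wt l + 1)) -
        schurRatio l • charParam A (Function.update l k (l k + 1)))
      (fun k _ => by
        have h2 := casimir_paramGen_charLeft_mul_pairPow μ A (Function.update l k (l k + 1))
        rw [wt_update_succ] at h2
        have h3 : casimirLinear (paramGen N) (charParam A (Function.update l k (l k + 1))) =
            casimirEigenvalue (Function.update l k (l k + 1)) •
              charParam A (Function.update l k (l k + 1)) := by
          rw [smul_eq_C_mul]
          exact casimir_jacobiTrudi (isLeftAction_paramGen A) _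
        rw [map_sub, map_smul, map_smul, h3, smul_sub, smul_comm _ (schurRatio l),
          sub_sub_sub_cancel_right, smul_comm _ ((shiftedPart l k : ℂ) + 1), ← smul_sub]
        exact Submodule.smul_mem _ _ h2)
      (by
        have h2 := sum_smul_charLeft_update_mem_haarNull μ A l
        have h3 := psum_param_mul_mem_haarNull μ ih A 0
        have h4 := Submodule.add_mem _ h2 h3
        rw [mul_sub, mul_smul_comm, sub_add_sub_cancel, charParam, ← pieri_psum,
          Finset.smul_sum, ← Finset.sum_sub_distrib] at h4
        exact h4) i (Finset.mem_univ i)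
    have h2 : ((shiftedPart l i : ℂ) + 1) ≠ 0 := Nat.cast_add_one_ne_zero _
    rw [← schurRatio_update_succ l i, mul_smul, ← smul_sub] at h1
    rw [wt_update_succ]
    exact ((haarNull μ).smul_mem_iff h2).1 h1

theorem integral_schur_mul_trace_pow (A B : Matrix (Fin N) (Fin N) ℂ) (l : Fin N → ℕ)
    (hl : Antitone l) :
    ∫ V : SUN N, schur l (sunMat V * A) *
      ((star (sunMat V) * B).trace ^ wt l / (wt l).factorial) ∂μ =
      schurRatio l * schur l (B * A) := by
  have h := (mem_haarNull μ).1 (charLeft_mul_pairPow_sub_mem_haarNull μ A l hl) B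
  rw [map_sub, map_smul, sub_eq_zero] at h
  have h1 : haarFunctional μ B (charLeft A l * pairPow N (wt l)) =
      ∫ V : SUN N, schur l (sunMat V * A) *
        ((star (sunMat V) * B).trace ^ wt l / (wt l).factorial) ∂μ := by
    change ∫ V : SUN N, _ ∂μ = _
    simp only [map_mul, aeval_charLeft, aeval_pairPow]
  have h2 : haarFunctional μ B (charParam A l) = schur l (B * A) := by
    change ∫ V : SUN N, _ ∂μ = _
    simp only [aeval_charParam]
    simp
  rw [← h1, h, h2, smul_eq_mul]

end CharacterIntegral

section Moments

open MvPolynomial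

variable {N : ℕ} (μ : Measure (SUN N)) [IsProbabilityMeasure μ]

/-- The mixed moments of the traces of `U A` and `U† B`. -/
def traceMoment (A B : Matrix (Fin N) (Fin N) ℂ) (n m : ℕ) : ℂ :=
  ∫ V : SUN N, ((sunMat V * A).trace ^ n / n.factorial) *
    ((star (sunMat V) * B).trace ^ m / m.factorial) ∂μ

theorem psumMat_mul_comm {K : Type*} [CommRing K] (A B : Matrix (Fin N) (Fin N) K) (m : ℕ) :
    psumMat (A * B) m = psumMat (B * A) m := by
  have h : ∀ k : ℕ, (B * A) ^ k * B = B * (A * B) ^ k := by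
    intro k
    induction k with
    | zero => simp
    | succ k ih => rw [pow_succ', Matrix.mul_assoc, ih, pow_succ']; simp only [Matrix.mul_assoc]
  rw [psumMat, psumMat, pow_succ (B * A), ← Matrix.mul_assoc, h, pow_succ', Matrix.mul_assoc,
    Matrix.trace_mul_comm]

theorem schur_mul_comm (l : Fin N → ℕ) (A B : Matrix (Fin N) (Fin N) ℂ) :
    schur l (A * B) = schur l (B * A) := by
  rw [schur_eq_jacobiTrudi, schur_eq_jacobiTrudi]
  congr 1
  ext m
  exact psumMat_mul_comm A B m

theorem schur_add_const (l : Fin N → ℕ) (X : Matrix (Fin N) (Fin N) ℂ) (q : ℕ) :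
    schur (fun i => l i + q) X = X.det ^ q * schur l X := by
  rw [schur_eq_jacobiTrudi, schur_eq_jacobiTrudi, jacobiTrudi_add_const]

theorem wt_add_const (l : Fin N → ℕ) (q : ℕ) : wt (fun i => l i + q) = wt l + q * N := by
  simp [wt, Finset.sum_add_distrib, mul_comm]

theorem antitone_add_const {l : Fin N → ℕ} (hl : Antitone l) (q : ℕ) :
    Antitone fun i => l i + q := fun _ _ h => Nat.add_le_add_right (hl h) q

theorem traceMoment_eq_sum_of_le [μ.IsMulLeftInvariant] {A B : Matrix (Fin N) (Fin N) ℂ}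
    (hA : IsUnit A.det) (n q : ℕ) :
    traceMoment μ A B n (n + q * N) =
      ∑ l ∈ partsOf N n, schurPInf l * schurPInf (fun i => l i + q) *
        (schur (fun i => l i + q) (A * B) / schur (fun i => l i + q)
          (1 : Matrix (Fin N) (Fin N) ℂ)) * A.det ^ (-(q : ℤ)) := by
  have hA' : A.det ^ q ≠ 0 := pow_ne_zero _ hA.ne_zero
  have h1 : ∀ V : SUN N, ((sunMat V * A).trace ^ n / n.factorial) *
      ((star (sunMat V) * B).trace ^ (n + q * N) / (n + q * N).factorial) =
      ∑ l ∈ partsOf N n, (schurPInf l * A.det ^ (-(q : ℤ))) *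
        (schur (fun i => l i + q) (sunMat V * A) *
          ((star (sunMat V) * B).trace ^ (n + q * N) / (n + q * N).factorial)) := by
    intro V
    rw [← psumMat_zero_eq_trace (sunMat V * A), psumMat_pow_eq_sum, Finset.sum_mul]
    refine Finset.sum_congr rfl fun l _ => ?_
    rw [schur_add_const, Matrix.det_mul, det_sunMat, one_mul, _root_.zpow_neg, _root_.zpow_natCast]
    field_simp
  have h2 : ∀ l : Fin N → ℕ, Integrable (fun V : SUN N => (schurPInf l * A.det ^ (-(q : ℤ))) *
        (schur (fun i => l i + q) (sunMat V * A) *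
          ((star (sunMat V) * B).trace ^ (n + q * N) / (n + q * N).factorial))) μ := by
    intro l
    have h := integrable_aeval_sunMat μ B
      (charLeft A (fun i => l i + q) * pairPow N (n + q * N))
    simp only [map_mul, aeval_charLeft, aeval_pairPow] at h
    exact h.const_mul _
  rw [traceMoment]
  simp only [h1]
  rw [integral_finsetSum _ fun l _ => h2 l]
  refine Finset.sum_congr rfl fun l hl => ?_
  obtain ⟨hw, hl⟩ := mem_partsOf.1 hl
  have hl' := antitone_add_const hl q
  have h3 := integral_schur_mul_trace_pow μ A B _ hl'
  rw [wt_add_const, hw] at h3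
  rw [integral_const_mul, h3, schur_mul_comm _ B A, ← schurPInf_div_schur_one hl']
  ring

instance instSecondCountableTopologySUN (N : ℕ) : SecondCountableTopology (SUN N) := by
  have : SecondCountableTopology (Matrix (Fin N) (Fin N) ℂ) :=
    inferInstanceAs (SecondCountableTopology (Fin N → Fin N → ℂ))
  have : SecondCountableTopology (UN N) := TopologicalSpace.Subtype.secondCountableTopology _
  exact TopologicalSpace.Subtype.secondCountableTopology _

theorem integral_star_sunMat [μ.IsMulLeftInvariant]
    (f : Matrix (Fin N) (Fin N) ℂ → ℂ) (hf : Continuous f) {c : ℝ}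
    (hc : ∀ V : SUN N, ‖f (sunMat V)‖ ≤ c) :
    ∫ V : SUN N, f (star (sunMat V)) ∂μ = ∫ V : SUN N, f (sunMat V) ∂μ := by
  have hcont : Continuous fun p : SUN N × SUN N => f (star (sunMat p.1) * sunMat p.2) :=
    hf.comp ((continuous_star.comp (continuous_sunMat.comp continuous_fst)).matrix_mul
      (continuous_sunMat.comp continuous_snd))
  have hInt : Integrable (Function.uncurry fun V W : SUN N => f (star (sunMat V) * sunMat W))
      (μ.prod μ) :=
    Integrable.of_bound hcont.aestronglyMeasurable c
      (Filter.Eventually.of_forall fun p => hc (p.1⁻¹ * p.2))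
  have h := integral_integral_swap hInt
  have h1 : ∀ V : SUN N, ∫ W : SUN N, f (star (sunMat V) * sunMat W) ∂μ =
      ∫ W : SUN N, f (sunMat W) ∂μ := fun V =>
    integral_mul_left_eq_self (fun W : SUN N => f (sunMat W)) V⁻¹
  have h2 : ∀ W : SUN N, ∫ V : SUN N, f (star (sunMat V) * sunMat W) ∂μ =
      ∫ V : SUN N, f (star (sunMat V)) ∂μ := by
    intro W
    rw [← integral_mul_left_eq_self (fun V : SUN N => f (star (sunMat V) * sunMat W)) W]
    refine integral_congr_ae (Filter.Eventually.of_forall fun V => ?_)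
    simp only [sunMat_mul, star_mul, Matrix.mul_assoc, star_sunMat_mul, Matrix.mul_one]
  simp only [h1, h2] at h
  simpa using h.symm

theorem norm_trace_sunMat_mul_le (V : SUN N) (A : Matrix (Fin N) (Fin N) ℂ) :
    ‖(sunMat V * A).trace‖ ≤ ∑ i, ∑ j, ‖A i j‖ := by
  rw [Matrix.trace, Finset.sum_comm]
  refine (norm_sum_le _ _).trans (Finset.sum_le_sum fun i _ => ?_)
  rw [Matrix.diag_apply, Matrix.mul_apply]
  refine (norm_sum_le _ _).trans (Finset.sum_le_sum fun j _ => ?_)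
  rw [norm_mul]
  exact mul_le_of_le_one_left (norm_nonneg _) (norm_sunMat_le V i j)

theorem norm_trace_star_sunMat_mul_le (V : SUN N) (A : Matrix (Fin N) (Fin N) ℂ) :
    ‖(star (sunMat V) * A).trace‖ ≤ ∑ i, ∑ j, ‖A i j‖ :=
  norm_trace_sunMat_mul_le V⁻¹ A

theorem norm_traceMoment_integrand_le (A B : Matrix (Fin N) (Fin N) ℂ) (n m : ℕ) (V : SUN N) :
    ‖((sunMat V * A).trace ^ n / n.factorial) *
      ((star (sunMat V) * B).trace ^ m / m.factorial)‖ ≤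
      ((∑ i, ∑ j, ‖A i j‖) ^ n / n.factorial) * ((∑ i, ∑ j, ‖B i j‖) ^ m / m.factorial) := by
  rw [norm_mul, norm_div, norm_div, norm_pow, norm_pow, RCLike.norm_natCast, RCLike.norm_natCast]
  gcongr
  · exact norm_trace_sunMat_mul_le V A
  · exact norm_trace_star_sunMat_mul_le V B

theorem continuous_traceMoment_integrand (A B : Matrix (Fin N) (Fin N) ℂ) (n m : ℕ) :
    Continuous fun V : Matrix (Fin N) (Fin N) ℂ => ((V * A).trace ^ n / n.factorial) *
      ((star V * B).trace ^ m / m.factorial) := by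
  refine Continuous.mul (Continuous.div_const (Continuous.pow ?_ n) _)
    (Continuous.div_const (Continuous.pow ?_ m) _)
  · exact (continuous_id.matrix_mul continuous_const).matrix_trace
  · exact (continuous_star.matrix_mul continuous_const).matrix_trace

theorem traceMoment_comm [μ.IsMulLeftInvariant] (A B : Matrix (Fin N) (Fin N) ℂ) (n m : ℕ) :
    traceMoment μ A B n m = traceMoment μ B A m n := by
  have h := integral_star_sunMat μ _ (continuous_traceMoment_integrand B A m n)
    (norm_traceMoment_integrand_le B A m n)
  rw [traceMoment, traceMoment, ← h]
  simp only [star_star]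
  refine integral_congr_ae (Filter.Eventually.of_forall fun V => ?_)
  exact mul_comm _ _

theorem traceMoment_eq_zero [μ.IsMulLeftInvariant] (hN : N ≠ 0) (A B : Matrix (Fin N) (Fin N) ℂ)
    {n m : ℕ} (h : ¬n ≡ m [MOD N]) : traceMoment μ A B n m = 0 := by
  set ζ : ℂ := Complex.exp (2 * Real.pi * Complex.I / N) with hζ
  have hprim : IsPrimitiveRoot ζ N := Complex.isPrimitiveRoot_exp N hN
  have hnorm : ‖ζ‖ = 1 := hprim.norm'_eq_one hN
  have hconj : ζ * star ζ = 1 := by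
    rw [RCLike.star_def, RCLike.mul_conj, hnorm]; simp
  let g : SUN N := sunMk (ζ • 1)
    (by
      rw [Matrix.mem_unitaryGroup_iff, star_smul, star_one, Matrix.smul_mul, Matrix.one_mul,
        smul_smul, hconj, one_smul])
    (by rw [Matrix.det_smul, Matrix.det_one, Fintype.card_fin, hprim.pow_eq_one, one_mul])
  have h1 : traceMoment μ A B n m = ζ ^ n * star ζ ^ m * traceMoment μ A B n m := by
    conv_lhs => rw [traceMoment, ← integral_mul_left_eq_self _ g]
    rw [traceMoment, ← integral_const_mul]
    refine integral_congr_ae (Filter.Eventually.of_forall fun V => ?_)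
    have h2 : sunMat g = ζ • 1 := rfl
    simp only [sunMat_mul, h2, star_smul, Matrix.smul_mul, Matrix.one_mul,
      Matrix.trace_smul, smul_eq_mul, mul_pow]
    ring
  by_contra h0
  have h3 : ζ ^ n * star ζ ^ m = 1 := by
    apply mul_right_cancel₀ h0
    rw [← h1, one_mul]
  apply h
  have h4 : ζ ^ n = ζ ^ m := by
    calc ζ ^ n = ζ ^ n * (ζ * star ζ) ^ m := by rw [hconj, one_pow, mul_one]
      _ = ζ ^ n * star ζ ^ m * ζ ^ m := by rw [mul_pow]; ring
      _ = ζ ^ m := by rw [h3, one_mul]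
  have h5 : ζ ≠ 0 := hprim.ne_zero hN
  rw [Nat.modEq_iff_dvd, ← hprim.zpow_eq_one_iff_dvd, zpow_sub₀ h5, _root_.zpow_natCast,
    _root_.zpow_natCast, h4, div_self (pow_ne_zero _ h5)]

end Moments

section Bounds

variable {N : ℕ}

theorem norm_det_le_of_row {A : Matrix (Fin N) (Fin N) ℂ} {r : Fin N → ℝ}
    (h : ∀ i j, ‖A i j‖ ≤ r i) : ‖A.det‖ ≤ N.factorial * ∏ i, r i := by
  have h1 : ∀ σ : Equiv.Perm (Fin N), ‖Equiv.Perm.sign σ • ∏ i, A (σ i) i‖ ≤ ∏ i, r i := by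
    intro σ
    rw [Units.smul_def, zsmul_eq_mul, norm_mul, norm_prod, ← Equiv.prod_comp σ r]
    have : ‖((Equiv.Perm.sign σ : ℤ) : ℂ)‖ = 1 := by
      rcases Int.units_eq_one_or (Equiv.Perm.sign σ) with h | h <;> simp [h]
    rw [this, one_mul]
    exact Finset.prod_le_prod (fun i _ => norm_nonneg _) fun i _ => h _ _
  rw [Matrix.det_apply]
  refine (norm_sum_le_of_le _ fun σ _ => h1 σ).trans (le_of_eq ?_)
  simp [Fintype.card_perm]

theorem norm_hseq_le {p : ℕ → ℂ} {M : ℝ} (hM : 0 ≤ M) (hp : ∀ m, ‖p m‖ ≤ M ^ (m + 1)) (k : ℕ) :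
    ‖hseq p k‖ ≤ M ^ k := by
  induction k using Nat.strong_induction_on with
  | _ k ih =>
    cases k with
    | zero => simp [hseq_zero]
    | succ k =>
      rw [hseq, norm_smul, norm_inv]
      have h1 : ‖(k : ℂ) + 1‖ = k + 1 := by exact_mod_cast RCLike.norm_natCast (K := ℂ) (k + 1)
      have h2 : ‖∑ m ∈ Finset.range (k + 1), p m * hseq p (k - m)‖ ≤
          ∑ m ∈ Finset.range (k + 1), M ^ (k + 1) := by
        refine norm_sum_le_of_le _ fun m hm => ?_
        have hm' : m ≤ k := Nat.lt_succ_iff.1 (Finset.mem_range.1 hm)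
        rw [norm_mul]
        calc ‖p m‖ * ‖hseq p (k - m)‖ ≤ M ^ (m + 1) * M ^ (k - m) :=
              mul_le_mul (hp m) (ih _ (by omega)) (norm_nonneg _) (by positivity)
          _ = M ^ (k + 1) := by rw [← pow_add]; congr 1; omega
      rw [h1, inv_mul_le_iff₀ (by positivity)]
      simpa using h2

theorem norm_jacobiTrudi_le {p : ℕ → ℂ} {M : ℝ} (hM : 1 ≤ M) (hp : ∀ m, ‖p m‖ ≤ M ^ (m + 1))
    (l : Fin N → ℕ) : ‖jacobiTrudi p l‖ ≤ N.factorial * ∏ i, M ^ (l i + N) := by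
  refine norm_det_le_of_row fun i j => ?_
  rw [Matrix.of_apply, hseqZ]
  split_ifs with h
  · simp only [norm_zero]; positivity
  · refine (norm_hseq_le (by positivity) hp _).trans (pow_le_pow_right₀ hM ?_)
    have := i.2; have := j.2
    omega

theorem exists_norm_psumMat_le (X : Matrix (Fin N) (Fin N) ℂ) :
    ∃ M : ℝ, 1 ≤ M ∧ ∀ m, ‖psumMat X m‖ ≤ M ^ (m + 1) := by
  let _ := Matrix.linftyOpNormedRing (n := Fin N) (α := ℂ)
  have h0 : ∀ (Y : Matrix (Fin N) (Fin N) ℂ), ‖Y.trace‖ ≤ N * ‖Y‖ := by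
    intro Y
    have h1 : ∀ i, ‖Y i i‖ ≤ ‖Y‖ := by
      intro i
      rw [Matrix.linfty_opNorm_def]
      refine le_trans ?_ (NNReal.coe_le_coe.2 (Finset.le_sup (Finset.mem_univ i)))
      rw [NNReal.coe_sum]
      exact Finset.single_le_sum (f := fun j => ‖Y i j‖) (fun j _ => norm_nonneg _)
        (Finset.mem_univ i)
    refine (norm_sum_le_of_le _ fun i _ => h1 i).trans (le_of_eq ?_)
    simp
  refine ⟨(N + 1) * (‖X‖ + 1), ?_, fun m => ?_⟩
  · have : (0 : ℝ) ≤ N := N.cast_nonneg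
    nlinarith [norm_nonneg X]
  · rw [psumMat, mul_pow]
    refine (h0 _).trans (mul_le_mul ?_ ?_ (norm_nonneg _) (by positivity))
    · calc (N : ℝ) ≤ N + 1 := by linarith
        _ ≤ (N + 1) ^ (m + 1) := le_self_pow₀ (by linarith [N.cast_nonneg (α := ℝ)]) (by omega)
    · exact (norm_pow_le' X (Nat.succ_pos m)).trans
        (pow_le_pow_left₀ (norm_nonneg _) (by linarith) _)

theorem norm_schurPInf_le (l : Fin N → ℕ) : ‖schurPInf l‖ ≤ N.factorial := by
  have h : ‖schurPInf l‖ ≤ N.factorial * ∏ _i : Fin N, (1 : ℝ) := by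
    refine norm_det_le_of_row fun i j => ?_
    rw [Matrix.of_apply, factInvZ]
    split_ifs
    · simp
    · rw [norm_inv, RCLike.norm_natCast]
      exact inv_le_one_of_one_le₀ (by exact_mod_cast Nat.factorial_pos _)
  simpa using h

theorem norm_schurRatio_add_const_le (hN : N ≠ 0) (l : Fin N → ℕ) (q : ℕ) :
    ‖schurRatio fun i => l i + q‖ ≤
      (∏ i : Fin N, ((N - 1 - i).factorial : ℝ)) * (∏ i, ((l i).factorial : ℝ)⁻¹) *
        (q.factorial : ℝ)⁻¹ := by
  have hq : ((q.factorial : ℝ)⁻¹) ^ N ≤ (q.factorial : ℝ)⁻¹ :=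
    pow_le_of_le_one (by positivity)
      (inv_le_one_of_one_le₀ (by exact_mod_cast Nat.factorial_pos _)) hN
  refine le_trans ?_ (mul_le_mul_of_nonneg_left hq (by positivity))
  have hq' : ((q.factorial : ℝ)⁻¹) ^ N = ∏ _i : Fin N, (q.factorial : ℝ)⁻¹ := by simp
  rw [hq', ← Finset.prod_mul_distrib, ← Finset.prod_mul_distrib, schurRatio, norm_prod]
  refine Finset.prod_le_prod (fun i _ => norm_nonneg _) fun i _ => ?_
  rw [norm_div, RCLike.norm_natCast, RCLike.norm_natCast, div_eq_mul_inv, mul_assoc, ← mul_inv]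
  gcongr
  have h1 : (l i).factorial * q.factorial ≤ (shiftedPart (fun i => l i + q) i).factorial :=
    (Nat.le_of_dvd (Nat.factorial_pos _) (Nat.factorial_mul_factorial_dvd_factorial_add _ _)).trans
      (Nat.factorial_le (Nat.le_add_right _ _))
  exact_mod_cast h1

theorem summable_prod_apply {g : ℕ → ℝ} (hg : Summable g) (hg0 : ∀ n, 0 ≤ g n) :
    ∀ N : ℕ, Summable fun l : Fin N → ℕ => ∏ i, g (l i)
  | 0 => (hasSum_fintype _).summable
  | N + 1 => by
    rw [← (Fin.consEquiv fun _ => ℕ).summable_iff]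
    refine (hg.mul_of_nonneg (summable_prod_apply hg hg0 N) hg0
      fun l => Finset.prod_nonneg fun i _ => hg0 _).congr fun p => ?_
    simp [Fin.prod_univ_succ, Fin.consEquiv]

/-- The summand of the character expansion of weight `q`. -/
def expansionTerm (β c : ℂ) (X : Matrix (Fin N) (Fin N) ℂ) (q : ℕ) (l : Fin N → ℕ) : ℂ :=
  β ^ (2 * wt l + q * N) * schurPInf l * schurPInf (fun i => l i + q) *
    (schur (fun i => l i + q) X / schur (fun i => l i + q) (1 : Matrix (Fin N) (Fin N) ℂ)) * c ^ q

theorem exists_norm_expansionTerm_le (hN : N ≠ 0) (β c : ℂ) (X : Matrix (Fin N) (Fin N) ℂ) :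
    ∃ K x y : ℝ, 0 ≤ K ∧ 0 ≤ x ∧ 0 ≤ y ∧ ∀ (q : ℕ) (l : Fin N → ℕ), Antitone l →
      ‖expansionTerm β c X q l‖ ≤
        K * ((y ^ q / q.factorial) * ∏ i, (x ^ l i / (l i).factorial)) := by
  obtain ⟨M, hM, hX⟩ := exists_norm_psumMat_le X
  have hM0 : 0 ≤ M := zero_le_one.trans hM
  refine ⟨N.factorial * (∏ i : Fin N, ((N - 1 - i).factorial : ℝ)) *
    (N.factorial * ∏ _i : Fin N, M ^ N), ‖β‖ ^ 2 * M, ‖β‖ ^ N * ‖X.det‖ * ‖c‖, by positivity,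
    by positivity, by positivity, fun q l hl => ?_⟩
  have h1 : expansionTerm β c X q l = β ^ (2 * wt l + q * N) * c ^ q * X.det ^ q *
      schurPInf l * (schurRatio fun i => l i + q) * schur l X := by
    rw [expansionTerm, ← schurPInf_div_schur_one (antitone_add_const hl q), schur_add_const l X]
    ring
  have h2 : ‖schur l X‖ ≤ (N.factorial * ∏ _i : Fin N, M ^ N) * ∏ i, M ^ l i := by
    rw [schur_eq_jacobiTrudi]
    refine (norm_jacobiTrudi_le hM hX l).trans (le_of_eq ?_)
    simp only [pow_add, Finset.prod_mul_distrib]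
    ring
  have h3 : ‖β‖ ^ (2 * wt l + q * N) = (∏ i, (‖β‖ ^ 2) ^ l i) * (‖β‖ ^ N) ^ q := by
    rw [Finset.prod_pow_eq_pow_sum, ← pow_mul, ← pow_mul, ← pow_add, wt, mul_comm q]
  rw [h1]
  simp only [norm_mul, norm_pow]
  calc ‖β‖ ^ (2 * wt l + q * N) * ‖c‖ ^ q * ‖X.det‖ ^ q * ‖schurPInf l‖ *
        ‖schurRatio fun i => l i + q‖ * ‖schur l X‖
      ≤ ‖β‖ ^ (2 * wt l + q * N) * ‖c‖ ^ q * ‖X.det‖ ^ q * N.factorial *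
        ((∏ i : Fin N, ((N - 1 - i).factorial : ℝ)) * (∏ i, ((l i).factorial : ℝ)⁻¹) *
        (q.factorial : ℝ)⁻¹) * ((N.factorial * ∏ _i : Fin N, M ^ N) * ∏ i, M ^ l i) := by
        gcongr
        · exact norm_schurPInf_le l
        · exact norm_schurRatio_add_const_le hN l q
    _ = _ := by
        rw [h3]
        simp only [div_eq_mul_inv, mul_pow, Finset.prod_mul_distrib]
        ring

theorem summable_expansionTerm (hN : N ≠ 0) (β c : ℂ) (X : Matrix (Fin N) (Fin N) ℂ) :
    Summable fun p : ℕ × PartitionN N => expansionTerm β c X p.1 p.2.1 := by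
  obtain ⟨K, x, y, hK, hx, hy, h⟩ := exists_norm_expansionTerm_le hN β c X
  have h1 : Summable fun l : PartitionN N => ∏ i, (x ^ l.1 i / (l.1 i).factorial) :=
    (summable_prod_apply (Real.summable_pow_div_factorial x) (fun n => by positivity)
      N).comp_injective (i := Subtype.val) Subtype.val_injective
  have h2 := ((Real.summable_pow_div_factorial y).mul_of_nonneg h1 (fun n => by positivity)
    (fun l => Finset.prod_nonneg fun i _ => by positivity)).mul_left K
  exact Summable.of_norm_bounded h2 fun p => h p.1 p.2.1 p.2.2

end Bounds

theorem hasSum_cexp (z : ℂ) : HasSum (fun n : ℕ => z ^ n / n.factorial) (Complex.exp z) := by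
  rw [Complex.exp_eq_exp_ℂ]; exact NormedSpace.expSeries_div_hasSum_exp z

theorem summable_norm_pow_div (z : ℂ) : Summable fun n : ℕ => ‖z ^ n / (n.factorial : ℂ)‖ :=
  NormedSpace.norm_expSeries_div_summable z

theorem hasSum_exp_mul_exp (β x y : ℂ) :
    HasSum (fun p : ℕ × ℕ => β ^ (p.1 + p.2) *
      ((x ^ p.1 / p.1.factorial) * (y ^ p.2 / p.2.factorial))) (Complex.exp (β * (x + y))) := by
  have hs := summable_mul_of_summable_norm (R := ℂ)
    (f := fun n : ℕ => (β * x) ^ n / (n.factorial : ℂ))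
    (g := fun n : ℕ => (β * y) ^ n / (n.factorial : ℂ)) (summable_norm_pow_div (β * x))
    (summable_norm_pow_div (β * y))
  have hm := HasSum.mul (hasSum_cexp (β * x)) (hasSum_cexp (β * y)) hs
  rw [← Complex.exp_add, ← mul_add] at hm
  have h : (fun p : ℕ × ℕ => (β * x) ^ p.1 / (p.1.factorial : ℂ) *
      ((β * y) ^ p.2 / (p.2.factorial : ℂ))) = fun p : ℕ × ℕ => β ^ (p.1 + p.2) *
      ((x ^ p.1 / p.1.factorial) * (y ^ p.2 / p.2.factorial)) := by
    funext p
    rw [mul_pow, mul_pow, pow_add]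
    ring
  rw [← h]
  exact hm

section Expansion

variable {N : ℕ} (μ : Measure (SUN N)) [IsProbabilityMeasure μ]

theorem hasSum_traceMoment (β : ℂ) (A B : Matrix (Fin N) (Fin N) ℂ) :
    HasSum (fun p : ℕ × ℕ => β ^ (p.1 + p.2) * traceMoment μ A B p.1 p.2)
      (∫ V : SUN N, Complex.exp (β * ((sunMat V * A).trace + (star (sunMat V) * B).trace)) ∂μ) := by
  set a := ∑ i, ∑ j, ‖A i j‖
  set b := ∑ i, ∑ j, ‖B i j‖
  have hle : ∀ (p : ℕ × ℕ) (V : SUN N), ‖β ^ (p.1 + p.2) *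
      (((sunMat V * A).trace ^ p.1 / p.1.factorial) *
      ((star (sunMat V) * B).trace ^ p.2 / p.2.factorial))‖ ≤
      ((‖β‖ * a) ^ p.1 / p.1.factorial) * ((‖β‖ * b) ^ p.2 / p.2.factorial) := by
    intro p V
    rw [norm_mul, norm_pow]
    refine (mul_le_mul_of_nonneg_left (norm_traceMoment_integrand_le A B p.1 p.2 V)
      (by positivity)).trans (le_of_eq ?_)
    rw [mul_pow, mul_pow, pow_add]
    ring
  have hInt : ∀ p : ℕ × ℕ, Integrable (fun V : SUN N => β ^ (p.1 + p.2) *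
      (((sunMat V * A).trace ^ p.1 / p.1.factorial) *
      ((star (sunMat V) * B).trace ^ p.2 / p.2.factorial))) μ := fun p =>
    Integrable.of_bound ((((continuous_traceMoment_integrand A B p.1 p.2).comp
      continuous_sunMat).const_mul _).aestronglyMeasurable) _
      (Filter.Eventually.of_forall (hle p))
  have hsum := hasSum_integral_of_summable_integral_norm hInt (by
    refine Summable.of_nonneg_of_le (fun p => integral_nonneg fun V => norm_nonneg _) (fun p => ?_)
      ((Real.summable_pow_div_factorial (‖β‖ * a)).mul_of_nonneg
        (Real.summable_pow_div_factorial (‖β‖ * b)) (fun n => by positivity) fun n => by positivity)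
    refine (integral_mono (hInt p).norm (integrable_const _) (hle p)).trans (le_of_eq ?_)
    simp)
  simp only [(hasSum_exp_mul_exp β _ _).tsum_eq, integral_const_mul] at hsum
  exact hsum

end Expansion

section Assembly

variable {N : ℕ}

/-- Partitions sorted by weight, with an additional index. -/
def partsEquiv (ι : Type*) (N : ℕ) :
    (Σ p : ι × ℕ, {l // l ∈ partsOf N p.2}) ≃ ι × PartitionN N where
  toFun s := (s.1.1, ⟨s.2.1, (mem_partsOf.1 s.2.2).2⟩)
  invFun p := ⟨(p.1, wt p.2.1), ⟨p.2.1, mem_partsOf.2 ⟨rfl, p.2.2⟩⟩⟩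
  left_inv := by
    rintro ⟨⟨i, n⟩, ⟨l, hl⟩⟩
    obtain ⟨rfl, -⟩ := mem_partsOf.1 hl
    rfl
  right_inv := fun _ => rfl

theorem summable_expansionTerm_pnat (hN : N ≠ 0) (β c : ℂ) (X : Matrix (Fin N) (Fin N) ℂ) :
    Summable fun p : ℕ+ × PartitionN N => expansionTerm β c X p.1 p.2.1 :=
  (summable_expansionTerm hN β c X).comp_injective
    (i := fun p : ℕ+ × PartitionN N => ((p.1 : ℕ), p.2))
    (PNat.coe_injective.prodMap Function.injective_id)

theorem hasSum_sum_partsOf {ι : Type*} {f : ι → (Fin N → ℕ) → ℂ} {a : ℂ}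
    (h : HasSum (fun p : ι × PartitionN N => f p.1 p.2.1) a) :
    HasSum (fun p : ι × ℕ => ∑ l ∈ partsOf N p.2, f p.1 l) a :=
  ((partsEquiv ι N).hasSum_iff.2 h).sigma fun p => (partsOf N p.2).hasSum (f p.1)

/-- Pairs of naturals congruent modulo `N`, indexed by their difference and their minimum. -/
def congrPair (N : ℕ) : (ℕ × ℕ) ⊕ (ℕ+ × ℕ) → ℕ × ℕ
  | .inl (q, n) => (n, n + q * N)
  | .inr (q, n) => (n + q * N, n)

theorem congrPair_injective (hN : 0 < N) : Function.Injective (congrPair N) := by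
  rintro (⟨q, n⟩ | ⟨q, n⟩) (⟨q', n'⟩ | ⟨q', n'⟩) h <;>
    simp only [congrPair, Prod.mk.injEq] at h <;> obtain ⟨h1, h2⟩ := h
  · subst h1
    have : q = q' := Nat.eq_of_mul_eq_mul_right hN (by omega)
    rw [this]
  · have := Nat.mul_pos q'.pos hN
    omega
  · have := Nat.mul_pos q.pos hN
    omega
  · subst h2
    have : (q : ℕ) = q' := Nat.eq_of_mul_eq_mul_right hN (by omega)
    rw [PNat.coe_injective this]

theorem mem_range_congrPair {n m : ℕ} (h : n ≡ m [MOD N]) :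
    (n, m) ∈ Set.range (congrPair N) := by
  rcases le_or_gt n m with hle | hlt
  · obtain ⟨q, hq⟩ := (Nat.modEq_iff_dvd' hle).1 h
    exact ⟨.inl (q, n), by simp only [congrPair, Prod.mk.injEq, true_and]; rw [mul_comm]; omega⟩
  · obtain ⟨q, hq⟩ := (Nat.modEq_iff_dvd' hlt.le).1 h.symm
    have hq0 : 0 < q := by
      rcases Nat.eq_zero_or_pos q with rfl | h0
      · rw [mul_zero] at hq; omega
      · exact h0
    exact ⟨.inr (⟨q, hq0⟩, m),
      by simp only [congrPair, Prod.mk.injEq, and_true, PNat.mk_coe]; rw [mul_comm]; omega⟩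

variable (μ : Measure (SUN N)) [IsProbabilityMeasure μ] [μ.IsMulLeftInvariant]

theorem pow_mul_traceMoment_eq_sum (β : ℂ) {A B : Matrix (Fin N) (Fin N) ℂ}
    (hA : IsUnit A.det) (n q : ℕ) :
    β ^ (n + (n + q * N)) * traceMoment μ A B n (n + q * N) =
      ∑ l ∈ partsOf N n, expansionTerm β A.det⁻¹ (A * B) q l := by
  rw [traceMoment_eq_sum_of_le μ hA, Finset.mul_sum]
  refine Finset.sum_congr rfl fun l hl => ?_
  rw [expansionTerm, (mem_partsOf.1 hl).1, _root_.zpow_neg, _root_.zpow_natCast, inv_pow,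
    ← add_assoc, ← two_mul]
  ring

theorem hasSum_of_expansionTerm {ι : Type*} {κ : ι → ℕ} {β c : ℂ}
    {X : Matrix (Fin N) (Fin N) ℂ} {g : ι × ℕ → ℂ}
    (hs : Summable fun p : ι × PartitionN N => expansionTerm β c X (κ p.1) p.2.1)
    (hg : ∀ q n, g (q, n) = ∑ l ∈ partsOf N n, expansionTerm β c X (κ q) l) :
    HasSum g (∑' p : ι × PartitionN N, expansionTerm β c X (κ p.1) p.2.1) := by
  rw [show g = fun p => ∑ l ∈ partsOf N p.2, expansionTerm β c X (κ p.1) l from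
    funext fun p => hg p.1 p.2]
  exact hasSum_sum_partsOf (f := fun q l => expansionTerm β c X (κ q) l) hs.hasSum

theorem integral_exp_eq_tsum (hN : 0 < N) (β : ℂ) {A B : Matrix (Fin N) (Fin N) ℂ}
    (hA : IsUnit A.det) (hB : IsUnit B.det) :
    ∫ V : SUN N, Complex.exp (β * ((sunMat V * A).trace + (star (sunMat V) * B).trace)) ∂μ =
      (∑' p : ℕ × PartitionN N, expansionTerm β A.det⁻¹ (A * B) p.1 p.2.1) +
        ∑' p : ℕ+ × PartitionN N, expansionTerm β B.det⁻¹ (A * B) p.1 p.2.1 := by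
  refine (hasSum_traceMoment μ β A B).unique
    (((congrPair_injective hN).hasSum_iff fun p hp => ?_).1 (HasSum.sum ?_ ?_))
  · rw [traceMoment_eq_zero μ hN.ne' A B fun h => hp (mem_range_congrPair h), mul_zero]
  · exact hasSum_of_expansionTerm (κ := id) (summable_expansionTerm hN.ne' β A.det⁻¹ (A * B))
      fun q n => pow_mul_traceMoment_eq_sum μ β hA n q
  · refine hasSum_of_expansionTerm (κ := ((↑) : ℕ+ → ℕ))
      (summable_expansionTerm_pnat hN.ne' β B.det⁻¹ (A * B)) fun q n => ?_
    have h := pow_mul_traceMoment_eq_sum μ β (B := A) hB n q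
    simp only [expansionTerm, schur_mul_comm _ B A, ← traceMoment_comm μ A B,
      add_comm n (n + (q : ℕ) * N)] at h
    exact h

end Assembly

/-- The `SU(N)` Brezin-Gross-Witten partition function, for invertible
`A`, `B`: `∫_{SU(N)} exp(β Tr(UA + U†B)) dμ(U)
= Σ_λ β^{2|λ|} s_λ(p_∞)² s_λ(AB)/s_λ(I_N)
+ Σ_{q≥1} Σ_λ β^{2|λ|+qN} s_λ(p_∞) s_{λ+q^N}(p_∞) (s_{λ+q^N}(AB)/s_{λ+q^N}(I_N))
  ((det A)^{-q} + (det B)^{-q})`, all sums converging absolutely. -/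
theorem statement18 {N : ℕ} (hN : 1 ≤ N) (β : ℂ)
    (A B : Matrix (Fin N) (Fin N) ℂ) (hA : IsUnit A.det) (hB : IsUnit B.det)
    (μ : Measure (SUN N)) [μ.IsHaarMeasure] [IsProbabilityMeasure μ] :
    Summable (fun l : PartitionN N =>
      β ^ (2 * wt l.1) * (schurPInf l.1) ^ 2 *
        schur l.1 (A * B) / schur l.1 (1 : Matrix (Fin N) (Fin N) ℂ)) ∧
    Summable (fun ql : ℕ+ × PartitionN N =>
      β ^ (2 * wt ql.2.1 + (ql.1 : ℕ) * N) * schurPInf ql.2.1 *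
        schurPInf (fun i => ql.2.1 i + (ql.1 : ℕ)) *
        (schur (fun i => ql.2.1 i + (ql.1 : ℕ)) (A * B) /
          schur (fun i => ql.2.1 i + (ql.1 : ℕ)) (1 : Matrix (Fin N) (Fin N) ℂ)) *
        (A.det ^ (-((ql.1 : ℕ) : ℤ)) + B.det ^ (-((ql.1 : ℕ) : ℤ)))) ∧
    (∫ V : SUN N,
        Complex.exp (β * ((((V : UN N) : Matrix (Fin N) (Fin N) ℂ) * A).trace +
          (star ((V : UN N) : Matrix (Fin N) (Fin N) ℂ) * B).trace)) ∂μ) =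
      (∑' l : PartitionN N,
        β ^ (2 * wt l.1) * (schurPInf l.1) ^ 2 *
          schur l.1 (A * B) / schur l.1 (1 : Matrix (Fin N) (Fin N) ℂ)) +
      ∑' q : ℕ+, ∑' l : PartitionN N,
        β ^ (2 * wt l.1 + (q : ℕ) * N) * schurPInf l.1 *
          schurPInf (fun i => l.1 i + (q : ℕ)) *
          (schur (fun i => l.1 i + (q : ℕ)) (A * B) /
            schur (fun i => l.1 i + (q : ℕ)) (1 : Matrix (Fin N) (Fin N) ℂ)) *
          (A.det ^ (-((q : ℕ) : ℤ)) + B.det ^ (-((q : ℕ) : ℤ))) := by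
  have hN' : N ≠ 0 := by omega
  have hsA := summable_expansionTerm hN' β A.det⁻¹ (A * B)
  have hsA' := summable_expansionTerm_pnat hN' β A.det⁻¹ (A * B)
  have hsB' := summable_expansionTerm_pnat hN' β B.det⁻¹ (A * B)
  have h0 : ∀ l : PartitionN N, expansionTerm β A.det⁻¹ (A * B) 0 l.1 =
      β ^ (2 * wt l.1) * (schurPInf l.1) ^ 2 *
        schur l.1 (A * B) / schur l.1 (1 : Matrix (Fin N) (Fin N) ℂ) := by
    intro l
    simp only [expansionTerm, zero_mul, add_zero, pow_zero]
    ring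
  have h1 : ∀ (q : ℕ+) (l : PartitionN N), expansionTerm β A.det⁻¹ (A * B) q l.1 +
      expansionTerm β B.det⁻¹ (A * B) q l.1 =
      β ^ (2 * wt l.1 + (q : ℕ) * N) * schurPInf l.1 *
        schurPInf (fun i => l.1 i + (q : ℕ)) *
        (schur (fun i => l.1 i + (q : ℕ)) (A * B) /
          schur (fun i => l.1 i + (q : ℕ)) (1 : Matrix (Fin N) (Fin N) ℂ)) *
        (A.det ^ (-((q : ℕ) : ℤ)) + B.det ^ (-((q : ℕ) : ℤ))) := by
    intro q l
    simp only [expansionTerm, _root_.zpow_neg, _root_.zpow_natCast, inv_pow]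
    ring
  simp only [← h0, ← h1]
  refine ⟨hsA.prod_factor 0, hsA'.add hsB', ?_⟩
  refine (integral_exp_eq_tsum μ hN β hA hB).trans ?_
  rw [← (hsA'.add hsB').tsum_prod, hsA'.tsum_add hsB', ← add_assoc]
  congr 1
  rw [hsA.tsum_prod, hsA.prod.tsum_eq_zero_add, hsA'.tsum_prod,
    tsum_pnat_eq_tsum_succ (f := fun q : ℕ => ∑' l : PartitionN N,
      expansionTerm β A.det⁻¹ (A * B) q l.1)]

end
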